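/- Suppose 3α + 2β = π, triangle ABC is N-tiled by a tile with angles (α, β, γ) that is not similar to ABC, and α is not a rational multiple of π. Then N ≥ 12. -/

import Mathlib

open EuclideanGeometry Real

noncomputable section

/-- A point of the Euclidean plane. -/
abbrev Pt : Type := EuclideanSpace ℝ (Fin 2)

/-- A triangle, given by its three vertices. -/
abbrev Tri : Type := Fin 3 → Pt

/-- A genuine (nondegenerate) triangle. -/
def IsTriangle (T : Tri) : Prop := AffineIndependent ℝ T

/-- The closed triangle (convex hull of the vertices). -/
def triSet (T : Tri) : Set Pt := convexHull ℝ (Set.range T)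

/-- Two triangles are congruent iff corresponding distances agree
up to a permutation of the vertices. -/
def CongruentTri (T₁ T₂ : Tri) : Prop :=
  ∃ σ : Equiv.Perm (Fin 3), ∀ i j : Fin 3, dist (T₁ i) (T₁ j) = dist (T₂ (σ i)) (T₂ (σ j))

/-- An `N`-tiling of the triangle `ABC` by the tile `T`: a family of `N` triangles,
each congruent to `T`, with pairwise disjoint interiors, whose union is the
closed triangle `ABC`. -/
structure IsTiling (N : ℕ) (ABC T : Tri) (tiles : Fin N → Tri) : Prop where
  congr : ∀ i, CongruentTri (tiles i) T
  disj : ∀ i j, i ≠ j → interior (triSet (tiles i)) ∩ interior (triSet (tiles j)) = ∅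
  cover : (⋃ i, triSet (tiles i)) = triSet ABC

/-- The interior angle of the triangle `T` at its `k`-th vertex. -/
def triAngle (T : Tri) (k : Fin 3) : ℝ := ∠ (T (k + 1)) (T k) (T (k + 2))

/-- The side of `T` opposite to the `k`-th vertex. -/
def sideLen (T : Tri) (k : Fin 3) : ℝ := dist (T (k + 1)) (T (k + 2))

/-- `T` has angles `α`, `β`, `γ` (at vertices `0`, `1`, `2`, which are opposite
the sides of lengths `a`, `b`, `c` respectively). -/
def HasAngles (T : Tri) (α β γ : ℝ) : Prop :=
  triAngle T 0 = α ∧ triAngle T 1 = β ∧ triAngle T 2 = γ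

/-- Two triangles are similar iff corresponding distances agree up to a
permutation of the vertices and a positive scale factor. -/
def SimilarTri (T₁ T₂ : Tri) : Prop :=
  ∃ r : ℝ, 0 < r ∧ ∃ σ : Equiv.Perm (Fin 3),
    ∀ i j : Fin 3, dist (T₁ i) (T₁ j) = r * dist (T₂ (σ i)) (T₂ (σ j))

namespace TT
section
open Filter Topology

/-- cross product -/
def cr (u v : ℂ) : ℝ := u.re * v.im - u.im * v.re
/-- dot product -/
def dt (u v : ℂ) : ℝ := u.re * v.re + u.im * v.im
/-- lexicographic positivity -/
def pos3 (x y z : ℝ) : Prop := 0 < x ∨ (x = 0 ∧ (0 < y ∨ (y = 0 ∧ 0 < z)))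
/-- edge vector -/
def ed (P : Fin 3 → ℂ) (j : Fin 3) : ℂ := P (j + 1) - P j
def Reg (P : Fin 3 → ℂ) : Set ℂ := {x | ∀ j, 0 ≤ cr (ed P j) (x - P j)}
def SReg (P : Fin 3 → ℂ) : Set ℂ := {x | ∀ j, 0 < cr (ed P j) (x - P j)}
/-- flag membership -/
def Fl (P : Fin 3 → ℂ) (x ζ : ℂ) (σ : ℝ) : Prop :=
  ∀ j, pos3 (cr (ed P j) (x - P j)) (cr (ed P j) ζ) (σ * dt (ed P j) ζ)
def Ccw (P : Fin 3 → ℂ) : Prop := 0 < cr (P 1 - P 0) (P 2 - P 0)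

structure Tl (N : ℕ) (V : Fin 3 → ℂ) (t : Fin N → Fin 3 → ℂ) : Prop where
  ccwV : Ccw V
  ccw : ∀ i, Ccw (t i)
  disj : ∀ i k, i ≠ k → ∀ x, x ∈ SReg (t i) → x ∈ SReg (t k) → False
  cover : ∀ x, x ∈ Reg V ↔ ∃ i, x ∈ Reg (t i)

lemma pos3_ev {x y z : ℝ} (h : pos3 x y z) :
    ∀ᶠ ε in 𝓝[>] (0:ℝ), 0 < x + ε * y + ε ^ 2 * z := by
  have hc : ∀ (p q r : ℝ), 0 < p → ∀ᶠ ε in 𝓝[>] (0:ℝ), 0 < p + ε * q + ε ^ 2 * r := by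
    intro p q r hp
    have : Tendsto (fun ε : ℝ => p + ε * q + ε ^ 2 * r) (𝓝 0) (𝓝 (p + 0 * q + 0 ^ 2 * r)) := by
      apply Continuous.tendsto; fun_prop
    have h2 : (0:ℝ) < p + 0 * q + 0 ^ 2 * r := by simpa using hp
    exact (this.eventually (lt_mem_nhds h2)).filter_mono nhdsWithin_le_nhds
  have hp : ∀ᶠ ε in 𝓝[>] (0:ℝ), 0 < ε := self_mem_nhdsWithin
  rcases h with h | ⟨rfl, h | ⟨rfl, h⟩⟩
  · exact hc x y z h
  · filter_upwards [hc y z 0 h, hp] with ε h1 h2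
    have := mul_pos h2 h1
    nlinarith
  · filter_upwards [hp] with ε h2
    have := mul_pos (pow_pos h2 2) h
    nlinarith

lemma not_pos3 {x y z : ℝ} (h : ¬ pos3 x y z) (hz : y = 0 → z ≠ 0) : pos3 (-x) (-y) (-z) := by
  unfold pos3 at *
  push Not at h
  obtain ⟨h1, h2⟩ := h
  rcases h1.lt_or_eq with h | h
  · left; linarith
  · right
    obtain ⟨h3, h4⟩ := h2 h
    refine ⟨by linarith, ?_⟩
    rcases h3.lt_or_eq with h5 | h5
    · left; linarith
    · right
      have := h4 h5
      have h6 := hz h5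
      refine ⟨by linarith, ?_⟩
      have := lt_of_le_of_ne this h6
      linarith

lemma not_pos3_ev {x y z : ℝ} (h : ¬ pos3 x y z) (hz : y = 0 → z ≠ 0) :
    ∀ᶠ ε in 𝓝[>] (0:ℝ), x + ε * y + ε ^ 2 * z < 0 := by
  filter_upwards [pos3_ev (not_pos3 h hz)] with ε h
  linarith

lemma cr_dt_sq (u v : ℂ) : cr u v ^ 2 + dt u v ^ 2 = Complex.normSq u * Complex.normSq v := by
  simp only [cr, dt, Complex.normSq_apply]; ring

lemma ccw_rot {P : Fin 3 → ℂ} (h : Ccw P) (j : Fin 3) : 0 < cr (ed P j) (P (j + 2) - P j) := by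
  unfold Ccw cr at h
  simp only [Complex.sub_re, Complex.sub_im] at h
  fin_cases j <;> simp [ed, cr] <;> linarith

lemma ed_ne {P : Fin 3 → ℂ} (h : Ccw P) (j : Fin 3) : ed P j ≠ 0 := by
  intro h0
  have := ccw_rot h j
  rw [h0] at this
  simp [cr] at this

lemma germ_cr (e p x ζ : ℂ) (σ ε : ℝ) :
    cr e (x + ε * ζ + ε ^ 2 * (σ * (Complex.I * ζ)) - p)
      = cr e (x - p) + ε * cr e ζ + ε ^ 2 * (σ * dt e ζ) := by
  have : ((ε:ℂ) ^ 2) = ((ε ^ 2 : ℝ) : ℂ) := by push_cast; rfl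
  rw [this]
  simp only [cr, dt, Complex.sub_re, Complex.sub_im, Complex.add_re, Complex.add_im,
    Complex.mul_re, Complex.mul_im, Complex.ofReal_re, Complex.ofReal_im, Complex.I_re,
    Complex.I_im]
  ring

lemma nondeg {P : Fin 3 → ℂ} (h : Ccw P) (j : Fin 3) {ζ : ℂ} (hζ : ζ ≠ 0) {σ : ℝ} (hσ : σ ≠ 0) :
    cr (ed P j) ζ = 0 → σ * dt (ed P j) ζ ≠ 0 := by
  intro h0 h1
  have h2 : dt (ed P j) ζ = 0 := by
    rcases mul_eq_zero.mp h1 with h | h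
    · exact absurd h hσ
    · exact h
  have := cr_dt_sq (ed P j) ζ
  rw [h0, h2] at this
  have h3 := Complex.normSq_pos.mpr (ed_ne h j)
  have h4 := Complex.normSq_pos.mpr hζ
  nlinarith [mul_pos h3 h4]

def germ (x ζ : ℂ) (σ ε : ℝ) : ℂ := x + ε * ζ + ε ^ 2 * (σ * (Complex.I * ζ))

lemma Fl_ev {P : Fin 3 → ℂ} {x ζ : ℂ} {σ : ℝ} (h : Fl P x ζ σ) :
    ∀ᶠ ε in 𝓝[>] (0:ℝ), germ x ζ σ ε ∈ SReg P := by
  have : ∀ᶠ ε in 𝓝[>] (0:ℝ), ∀ j, 0 < cr (ed P j) (germ x ζ σ ε - P j) := by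
    rw [eventually_all]
    intro j
    filter_upwards [pos3_ev (h j)] with ε hε
    unfold germ; rw [germ_cr]; exact hε
  exact this

lemma not_Fl_ev {P : Fin 3 → ℂ} (hP : Ccw P) {x ζ : ℂ} (hζ : ζ ≠ 0) {σ : ℝ} (hσ : σ ≠ 0)
    (h : ¬ Fl P x ζ σ) :
    ∀ᶠ ε in 𝓝[>] (0:ℝ), germ x ζ σ ε ∉ Reg P := by
  unfold Fl at h
  push Not at h
  obtain ⟨j, hj⟩ := h
  filter_upwards [not_pos3_ev hj (nondeg hP j hζ hσ)] with ε hε hm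
  have := hm j
  unfold germ at this; rw [germ_cr] at this; linarith

lemma SReg_sub {P : Fin 3 → ℂ} {x} (h : x ∈ SReg P) : x ∈ Reg P := fun j => (h j).le

variable {N : ℕ} {V : Fin 3 → ℂ} {t : Fin N → Fin 3 → ℂ}

lemma Tl.fl_ex (T : Tl N V t) {x ζ : ℂ} (hζ : ζ ≠ 0) {σ : ℝ} (hσ : σ ≠ 0) :
    Fl V x ζ σ ↔ ∃ i, Fl (t i) x ζ σ := by
  constructor
  · intro h
    by_contra hn
    push Not at hn
    have h1 : ∀ᶠ ε in 𝓝[>] (0:ℝ), ∀ i, germ x ζ σ ε ∉ Reg (t i) := by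
      rw [eventually_all]; intro i; exact not_Fl_ev (T.ccw i) hζ hσ (hn i)
    obtain ⟨ε, h2, h3⟩ := (h1.and (Fl_ev h)).exists
    obtain ⟨i, hi⟩ := (T.cover _).1 (SReg_sub h3)
    exact h2 i hi
  · rintro ⟨i, hi⟩
    by_contra hn
    obtain ⟨ε, h2, h3⟩ := ((not_Fl_ev T.ccwV hζ hσ hn).and (Fl_ev hi)).exists
    exact h2 ((T.cover _).2 ⟨i, SReg_sub h3⟩)

lemma Tl.fl_uniq (T : Tl N V t) {x ζ : ℂ} {σ : ℝ} {i k : Fin N}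
    (hi : Fl (t i) x ζ σ) (hk : Fl (t k) x ζ σ) : i = k := by
  by_contra hn
  obtain ⟨ε, h2, h3⟩ := ((Fl_ev hi).and (Fl_ev hk)).exists
  exact T.disj i k hn _ h2 h3
end
end TT

namespace TT
section
open Filter Topology

lemma f12 (j : Fin 3) : j + 1 + 1 = j + 2 := by fin_cases j <;> rfl
lemma f21 (j : Fin 3) : j + 2 + 1 = j := by fin_cases j <;> rfl
lemma f22 (j : Fin 3) : j + 2 + 2 = j + 1 := by fin_cases j <;> rfl
lemma f11 (j : Fin 3) : j + 1 + 2 = j := by fin_cases j <;> rfl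
lemma fin3_cases (j k : Fin 3) : k = j ∨ k = j + 1 ∨ k = j + 2 := by
  fin_cases j <;> fin_cases k <;> simp
lemma all3 {p : Fin 3 → Prop} (j : Fin 3) (h0 : p j) (h1 : p (j+1)) (h2 : p (j+2)) : ∀ k, p k := by
  intro k
  rcases fin3_cases j k with rfl | rfl | rfl <;> assumption

lemma cr_add_r (u v w : ℂ) : cr u (v + w) = cr u v + cr u w := by simp [cr]; ring
lemma cr_sub_r (u v w : ℂ) : cr u (v - w) = cr u v - cr u w := by simp [cr]; ring
lemma cr_add_l (u v w : ℂ) : cr (u + v) w = cr u w + cr v w := by simp [cr]; ring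
lemma cr_neg_r (u v : ℂ) : cr u (-v) = - cr u v := by simp [cr]; ring
lemma cr_neg_l (u v : ℂ) : cr (-u) v = - cr u v := by simp [cr]; ring
lemma cr_smul_r (u v : ℂ) (l : ℝ) : cr u (l * v) = l * cr u v := by simp [cr]; ring
lemma cr_smul_l (u v : ℂ) (l : ℝ) : cr (l * u) v = l * cr u v := by simp [cr]; ring
lemma dt_smul_r (u v : ℂ) (l : ℝ) : dt u (l * v) = l * dt u v := by simp [dt]; ring
lemma dt_smul_l (u v : ℂ) (l : ℝ) : dt (l * u) v = l * dt u v := by simp [dt]; ring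
lemma dt_neg_l (u v : ℂ) : dt (-u) v = - dt u v := by simp [dt]; ring
lemma cr_self (u : ℂ) : cr u u = 0 := by simp [cr]; ring
lemma cr_zero (u : ℂ) : cr u 0 = 0 := by simp [cr]
lemma cr_swap (u v : ℂ) : cr u v = - cr v u := by simp [cr]; ring
lemma dt_self (u : ℂ) : dt u u = Complex.normSq u := by simp [dt, Complex.normSq_apply]

lemma ed_sum (P : Fin 3 → ℂ) (j : Fin 3) : ed P (j+2) = -(ed P j + ed P (j+1)) := by
  unfold ed; rw [f21, f12]; ring

/-- signed parallel -/
lemma par {e ζ : ℂ} (hζ : ζ ≠ 0) (h : cr e ζ = 0) : e = ((dt e ζ / Complex.normSq ζ : ℝ) : ℂ) * ζ := by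
  have hz : Complex.normSq ζ ≠ 0 := (Complex.normSq_pos.mpr hζ).ne'
  unfold cr at h
  apply Complex.ext
  · simp only [Complex.re_ofReal_mul, dt]
    rw [div_mul_eq_mul_div, eq_div_iff hz, Complex.normSq_apply]
    linear_combination ζ.im * h
  · simp only [Complex.im_ofReal_mul, dt]
    rw [div_mul_eq_mul_div, eq_div_iff hz, Complex.normSq_apply]
    linear_combination (-ζ.re) * h

lemma ccw_e {P : Fin 3 → ℂ} (h : Ccw P) (j : Fin 3) : 0 < cr (ed P j) (ed P (j+1)) := by
  have := ccw_rot h j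
  have e : P (j+2) - P j = ed P j + ed P (j+1) := by unfold ed; rw [f12]; ring
  rw [e, cr_add_r, cr_self] at this; linarith

/-- the three defining functionals at a point on the line of edge j -/
lemma on_line {P : Fin 3 → ℂ} (h : Ccw P) (j : Fin 3) (x : ℂ) (hx : cr (ed P j) (x - P j) = 0) :
    ∃ r : ℝ, x = P j + r * ed P j ∧
      cr (ed P (j+1)) (x - P (j+1)) = (1 - r) * cr (ed P j) (ed P (j+1)) ∧
      cr (ed P (j+2)) (x - P (j+2)) = r * cr (ed P j) (ed P (j+1)) := by
  have h1 : cr (x - P j) (ed P j) = 0 := by rw [cr_swap, hx]; simp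
  obtain h2 := par (ed_ne h j) h1
  refine ⟨_, by linear_combination h2, ?_, ?_⟩
  · set r := dt (x - P j) (ed P j) / Complex.normSq (ed P j)
    have : x - P (j+1) = (r:ℂ) * ed P j - ed P j := by
      have e0 : ed P j = P (j+1) - P j := rfl
      linear_combination h2 + e0
    rw [this, cr_sub_r, cr_smul_r, cr_swap (ed P (j+1))]; ring
  · set r := dt (x - P j) (ed P j) / Complex.normSq (ed P j)
    have e2 : ed P (j+2) = P j - P (j+2) := by unfold ed; rw [f21]
    have : x - P (j+2) = (r:ℂ) * ed P j + ed P (j+2) := by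
      linear_combination h2 - e2
    rw [this, cr_add_r, cr_self, cr_smul_r, ed_sum, cr_neg_l, cr_add_l, cr_self, cr_swap (ed P (j+1))]; ring

def Up (P : Fin 3 → ℂ) (j : Fin 3) (ζ x : ℂ) : Prop :=
  ∃ l : ℝ, 0 < l ∧ ed P j = l * ζ ∧ ∃ τ : ℝ, 0 ≤ τ ∧ τ < l ∧ x = P j + τ * ζ
def Dn (P : Fin 3 → ℂ) (j : Fin 3) (ζ x : ℂ) : Prop :=
  ∃ l : ℝ, 0 < l ∧ ed P j = -(l * ζ) ∧ ∃ τ : ℝ, 0 ≤ τ ∧ τ < l ∧ x = P (j+1) + τ * ζ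

lemma pos3_neg {a b c : ℝ} (h : b < 0) : pos3 a b c ↔ 0 < a := by
  unfold pos3; constructor
  · rintro (h1 | ⟨h1, h2 | ⟨h2, h3⟩⟩) <;> linarith
  · exact Or.inl
lemma pos3_pos {a b c : ℝ} (h : 0 < b) : pos3 a b c ↔ 0 ≤ a := by
  unfold pos3; constructor
  · rintro (h1 | ⟨h1, h2 | ⟨h2, h3⟩⟩) <;> linarith
  · intro h1; rcases h1.lt_or_eq with h2 | h2
    · exact Or.inl h2
    · exact Or.inr ⟨h2.symm, Or.inl h⟩

lemma up_fl {P : Fin 3 → ℂ} (h : Ccw P) {j : Fin 3} {ζ x : ℂ} (hu : Up P j ζ x) :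
    Fl P x ζ 1 ∧ ¬ Fl P x ζ (-1) := by
  obtain ⟨l, hl, he, τ, h0, h1, hx⟩ := hu
  have hl' : (l:ℂ) ≠ 0 := by exact_mod_cast hl.ne'
  have hz : ζ = ((l⁻¹ : ℝ):ℂ) * ed P j := by rw [he]; push_cast; field_simp
  have hc : cr (ed P j) (x - P j) = 0 := by
    rw [hx, add_sub_cancel_left, cr_smul_r, hz, cr_smul_r, cr_self]; simp
  obtain ⟨r, hr, h2, h3⟩ := on_line h j x hc
  have hlp : 0 < l⁻¹ := by positivity
  have hE := ccw_e h j
  have hr2 : r = τ * l⁻¹ := by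
    have : (r : ℂ) * ed P j = ((τ * l⁻¹ : ℝ):ℂ) * ed P j := by
      rw [hz] at hx; push_cast at hx ⊢; linear_combination hx - hr
    have := mul_right_cancel₀ (ed_ne h j) this
    exact_mod_cast this
  have r0 : 0 ≤ r := by rw [hr2]; positivity
  have r1 : r < 1 := by rw [hr2, ← div_eq_mul_inv, div_lt_one hl]; exact h1
  have c0 : cr (ed P j) ζ = 0 := by rw [hz, cr_smul_r, cr_self]; simp
  have d0 : 0 < dt (ed P j) ζ := by
    rw [hz, dt_smul_r, dt_self]; exact mul_pos hlp (Complex.normSq_pos.mpr (ed_ne h j))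
  have c1 : cr (ed P (j+1)) ζ < 0 := by
    rw [hz, cr_smul_r, cr_swap]; nlinarith
  have c2 : 0 < cr (ed P (j+2)) ζ := by
    rw [hz, cr_smul_r, ed_sum, cr_neg_l, cr_add_l, cr_self, cr_swap (ed P (j+1))]; nlinarith
  constructor
  · refine all3 (p := fun j => pos3 (cr (ed P j) (x - P j)) (cr (ed P j) ζ) (_ * dt (ed P j) ζ)) j ?_ ?_ ?_
    · rw [hc, c0]; right; refine ⟨rfl, Or.inr ⟨rfl, ?_⟩⟩; linarith
    · rw [pos3_neg c1, h2]; nlinarith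
    · rw [pos3_pos c2, h3]; nlinarith
  · intro hf
    have := hf j
    rw [hc, c0] at this
    simp only [pos3] at this
    rcases this with h | ⟨_, h | ⟨_, h⟩⟩ <;> linarith

lemma fl_up {P : Fin 3 → ℂ} (h : Ccw P) {ζ x : ℂ} (hζ : ζ ≠ 0)
    (h1 : Fl P x ζ 1) (h2 : ¬ Fl P x ζ (-1)) : ∃ j, Up P j ζ x := by
  unfold Fl at h2; push Not at h2
  obtain ⟨j, hj⟩ := h2
  have hj1 := h1 j
  have nd := nondeg h j hζ (one_ne_zero (α := ℝ))
  have key : cr (ed P j) (x - P j) = 0 ∧ cr (ed P j) ζ = 0 ∧ 0 < dt (ed P j) ζ := by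
    unfold pos3 at hj hj1
    push Not at hj
    rcases hj1 with h | ⟨h, h' | ⟨h', h''⟩⟩
    · linarith [hj.1]
    · linarith [(hj.2 h).1]
    · exact ⟨h, h', by linarith⟩
  obtain ⟨hc, c0, d0⟩ := key
  obtain ⟨r, hr, e2, e3⟩ := on_line h j x hc
  have hp := par hζ c0
  set l := dt (ed P j) ζ / Complex.normSq ζ with hl
  have lp : 0 < l := div_pos d0 (Complex.normSq_pos.mpr hζ)
  have hE := ccw_e h j
  have c1 : l * cr (ed P (j+1)) ζ < 0 := by
    rw [← cr_smul_r, ← hp, cr_swap]; linarith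
  have c1 : cr (ed P (j+1)) ζ < 0 := by nlinarith
  have c2 : 0 < l * cr (ed P (j+2)) ζ := by
    rw [← cr_smul_r, ← hp, ed_sum, cr_neg_l, cr_add_l, cr_self, cr_swap (ed P (j+1))]; linarith
  have c2 : 0 < cr (ed P (j+2)) ζ := by nlinarith
  have h3 := h1 (j+1)
  have h4 := h1 (j+2)
  rw [pos3_neg c1, e2] at h3
  rw [pos3_pos c2, e3] at h4
  have r0 : 0 ≤ r := by nlinarith
  have r1 : r < 1 := by nlinarith
  refine ⟨j, l, lp, hp, r * l, by positivity, by nlinarith, ?_⟩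
  rw [hr]; nth_rw 1 [hp]; push_cast; ring

lemma dn_fl {P : Fin 3 → ℂ} (h : Ccw P) {j : Fin 3} {ζ x : ℂ} (hu : Dn P j ζ x) :
    Fl P x ζ (-1) ∧ ¬ Fl P x ζ 1 := by
  obtain ⟨l, hl, he, τ, h0, h1, hx⟩ := hu
  have hl' : (l:ℂ) ≠ 0 := by exact_mod_cast hl.ne'
  have hz : ζ = ((-l⁻¹ : ℝ):ℂ) * ed P j := by rw [he]; push_cast; field_simp
  have hP1 : P (j+1) = P j + ed P j := by unfold ed; ring
  have hc : cr (ed P j) (x - P j) = 0 := by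
    rw [hx, hP1, show P j + ed P j + τ * ζ - P j = ed P j + τ * ζ by ring,
      cr_add_r, cr_smul_r, hz, cr_smul_r, cr_self]; simp
  obtain ⟨r, hr, h2, h3⟩ := on_line h j x hc
  have hlp : 0 < l⁻¹ := by positivity
  have hE := ccw_e h j
  have hr2 : r = 1 - τ * l⁻¹ := by
    have : (r : ℂ) * ed P j = ((1 - τ * l⁻¹ : ℝ):ℂ) * ed P j := by
      rw [hz, hP1] at hx; push_cast at hx ⊢; linear_combination hx - hr
    have := mul_right_cancel₀ (ed_ne h j) this
    exact_mod_cast this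
  have r0 : r ≤ 1 := by rw [hr2]; have : 0 ≤ τ * l⁻¹ := by positivity
                        linarith
  have r1 : 0 < r := by
    rw [hr2, ← div_eq_mul_inv]; have := (div_lt_one hl).2 h1; linarith
  have c0 : cr (ed P j) ζ = 0 := by rw [hz, cr_smul_r, cr_self]; simp
  have d0 : dt (ed P j) ζ < 0 := by
    rw [hz, dt_smul_r, dt_self]
    have := mul_pos hlp (Complex.normSq_pos.mpr (ed_ne h j)); linarith
  have c1 : 0 < cr (ed P (j+1)) ζ := by
    rw [hz, cr_smul_r, cr_swap]; nlinarith
  have c2 : cr (ed P (j+2)) ζ < 0 := by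
    rw [hz, cr_smul_r, ed_sum, cr_neg_l, cr_add_l, cr_self, cr_swap (ed P (j+1))]; nlinarith
  constructor
  · refine all3 (p := fun j => pos3 (cr (ed P j) (x - P j)) (cr (ed P j) ζ) (_ * dt (ed P j) ζ)) j ?_ ?_ ?_
    · rw [hc, c0]; right; refine ⟨rfl, Or.inr ⟨rfl, ?_⟩⟩; linarith
    · rw [pos3_pos c1, h2]; nlinarith
    · rw [pos3_neg c2, h3]; nlinarith
  · intro hf
    have := hf j
    rw [hc, c0] at this
    simp only [pos3] at this
    rcases this with h | ⟨_, h | ⟨_, h⟩⟩ <;> linarith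

lemma fl_dn {P : Fin 3 → ℂ} (h : Ccw P) {ζ x : ℂ} (hζ : ζ ≠ 0)
    (h1 : Fl P x ζ (-1)) (h2 : ¬ Fl P x ζ 1) : ∃ j, Dn P j ζ x := by
  unfold Fl at h2; push Not at h2
  obtain ⟨j, hj⟩ := h2
  have hj1 := h1 j
  have nd := nondeg h j hζ (one_ne_zero (α := ℝ))
  have key : cr (ed P j) (x - P j) = 0 ∧ cr (ed P j) ζ = 0 ∧ 0 < - dt (ed P j) ζ := by
    unfold pos3 at hj hj1
    push Not at hj
    rcases hj1 with h | ⟨h, h' | ⟨h', h''⟩⟩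
    · linarith [hj.1]
    · linarith [(hj.2 h).1]
    · exact ⟨h, h', by linarith⟩
  obtain ⟨hc, c0, d0⟩ := key
  obtain ⟨r, hr, e2, e3⟩ := on_line h j x hc
  have hp := par hζ c0
  obtain ⟨l, hl⟩ : ∃ l, l = - (dt (ed P j) ζ / Complex.normSq ζ) := ⟨_, rfl⟩
  have lp : 0 < l := by
    rw [hl, ← neg_div]; exact div_pos d0 (Complex.normSq_pos.mpr hζ)
  have hp : ed P j = -((l:ℂ) * ζ) := by rw [hl]; push_cast at hp ⊢; linear_combination hp
  have hp2 : (l:ℂ) * ζ = - ed P j := by rw [hp]; ring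
  have hE := ccw_e h j
  have c1 : 0 < l * cr (ed P (j+1)) ζ := by
    rw [← cr_smul_r, hp2, cr_neg_r, cr_swap]; linarith
  have c1 : 0 < cr (ed P (j+1)) ζ := by nlinarith
  have c2 : l * cr (ed P (j+2)) ζ < 0 := by
    rw [← cr_smul_r, hp2, cr_neg_r, ed_sum, cr_neg_l, cr_add_l, cr_self, cr_swap (ed P (j+1))]; linarith
  have c2 : cr (ed P (j+2)) ζ < 0 := by nlinarith
  have h3 := h1 (j+1)
  have h4 := h1 (j+2)
  rw [pos3_pos c1, e2] at h3
  rw [pos3_neg c2, e3] at h4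
  have r0 : 0 < r := by nlinarith
  have r1 : r ≤ 1 := by nlinarith
  have hP1 : P (j+1) = P j + ed P j := by unfold ed; ring
  refine ⟨j, l, lp, hp, (1 - r) * l, by nlinarith, by nlinarith, ?_⟩
  rw [hr, hP1]; push_cast; linear_combination (r - 1) * hp

lemma par_uniq {P : Fin 3 → ℂ} (h : Ccw P) {j k : Fin 3} {ζ : ℂ} {l m : ℝ}
    (hj : ed P j = l * ζ) (hk : ed P k = m * ζ) : j = k := by
  have hc : cr (ed P j) (ed P k) = 0 := by
    rw [hj, hk, cr_smul_l, cr_smul_r, cr_self]; simp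
  have hE := ccw_e h j
  rcases fin3_cases j k with rfl | rfl | rfl
  · rfl
  · linarith
  · rw [ed_sum, cr_neg_r, cr_add_r, cr_self] at hc; linarith

open Classical in
/-- pointwise signed identity for a single triangle -/
lemma sgn_id {P : Fin 3 → ℂ} (h : Ccw P) {ζ : ℂ} (x : ℂ) (hζ : ζ ≠ 0) :
    (if Fl P x ζ 1 then (1:ℝ) else 0) - (if Fl P x ζ (-1) then 1 else 0)
      = ∑ j, ((if Up P j ζ x then (1:ℝ) else 0) - (if Dn P j ζ x then 1 else 0)) := by
  rw [Finset.sum_sub_distrib]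
  by_cases h1 : Fl P x ζ 1 <;> by_cases h2 : Fl P x ζ (-1)
  · have a : ∀ j, ¬ Up P j ζ x := fun j hj => (up_fl h hj).2 h2
    have b : ∀ j, ¬ Dn P j ζ x := fun j hj => (dn_fl h hj).2 h1
    simp [a, b, h1, h2]
  · have b : ∀ j, ¬ Dn P j ζ x := fun j hj => (dn_fl h hj).2 h1
    obtain ⟨j, hj⟩ := fl_up h hζ h1 h2
    have : ∀ k, Up P k ζ x ↔ k = j := by
      intro k; constructor
      · rintro ⟨l, _, hl, _⟩; obtain ⟨m, _, hm, _⟩ := hj; exact par_uniq h hl hm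
      · rintro rfl; exact hj
    simp [b, h1, h2, this]
  · have b : ∀ j, ¬ Up P j ζ x := fun j hj => (up_fl h hj).2 h2
    obtain ⟨j, hj⟩ := fl_dn h hζ h2 h1
    have : ∀ k, Dn P k ζ x ↔ k = j := by
      intro k; constructor
      · rintro ⟨l, _, hl, _⟩; obtain ⟨m, _, hm, _⟩ := hj
        exact par_uniq (ζ := -ζ) (l := l) (m := m) h (by rw [hl]; ring) (by rw [hm]; ring)
      · rintro rfl; exact hj
    simp [b, h1, h2, this]
  · have a : ∀ j, ¬ Up P j ζ x := fun j hj => h1 (up_fl h hj).1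
    have b : ∀ j, ¬ Dn P j ζ x := fun j hj => h2 (dn_fl h hj).1
    simp [a, b, h1, h2]

variable {N : ℕ} {V : Fin 3 → ℂ} {t : Fin N → Fin 3 → ℂ}

open Classical in
lemma Tl.fl_sum (T : Tl N V t) (x : ℂ) {ζ : ℂ} (hζ : ζ ≠ 0) {σ : ℝ} (hσ : σ ≠ 0) :
    ∑ i, (if Fl (t i) x ζ σ then (1:ℝ) else 0) = if Fl V x ζ σ then 1 else 0 := by
  by_cases h : Fl V x ζ σ
  · obtain ⟨i, hi⟩ := (T.fl_ex hζ hσ).1 h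
    have : ∀ k, Fl (t k) x ζ σ ↔ k = i := fun k => ⟨fun hk => T.fl_uniq hk hi, by rintro rfl; exact hi⟩
    simp [h, this]
  · have : ∀ k, ¬ Fl (t k) x ζ σ := fun k hk => h ((T.fl_ex hζ hσ).2 ⟨k, hk⟩)
    simp [h, this]

/-- direction and offset of an edge -/
def dr (P : Fin 3 → ℂ) (j : Fin 3) : ℂ := ((‖ed P j‖⁻¹ : ℝ) : ℂ) * ed P j
def off (P : Fin 3 → ℂ) (j : Fin 3) : ℝ := cr (dr P j) (P j)

lemma ed_dr {P : Fin 3 → ℂ} (h : Ccw P) (j : Fin 3) : ed P j = ‖ed P j‖ * dr P j := by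
  have : (‖ed P j‖ : ℂ) ≠ 0 := by exact_mod_cast (norm_pos_iff.mpr (ed_ne h j)).ne'
  unfold dr; push_cast; field_simp
lemma norm_dr {P : Fin 3 → ℂ} (h : Ccw P) (j : Fin 3) : ‖dr P j‖ = 1 := by
  have := (norm_pos_iff.mpr (ed_ne h j)).ne'
  unfold dr; rw [norm_mul, Complex.norm_real, norm_inv, norm_norm]; field_simp
lemma ed_pos {P : Fin 3 → ℂ} (h : Ccw P) (j : Fin 3) : 0 < ‖ed P j‖ := norm_pos_iff.mpr (ed_ne h j)

lemma dr_of {P : Fin 3 → ℂ} (h : Ccw P) {j : Fin 3} {l : ℝ} (hl : 0 < l) {ζ : ℂ} (hζ : ‖ζ‖ = 1)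
    (he : ed P j = l * ζ) : dr P j = ζ ∧ ‖ed P j‖ = l := by
  have h1 : ‖ed P j‖ = l := by rw [he, norm_mul, hζ, Complex.norm_real, norm_of_nonneg hl.le, mul_one]
  refine ⟨?_, h1⟩
  have hl' : (l:ℂ) ≠ 0 := by exact_mod_cast hl.ne'
  unfold dr; rw [h1, he]; push_cast; field_simp

lemma dec {ζ : ℂ} (hζ : ‖ζ‖ = 1) (p : ℂ) : p = (cr ζ p : ℝ) * (Complex.I * ζ) + (dt ζ p : ℝ) * ζ := by
  have h : ζ.re * ζ.re + ζ.im * ζ.im = 1 := by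
    have := Complex.normSq_eq_norm_sq ζ; rw [hζ, Complex.normSq_apply] at this; simpa using this
  apply Complex.ext
  · simp [cr, dt]; linear_combination (-p.re) * h
  · simp [cr, dt]; linear_combination (-p.im) * h

lemma cr_I {ζ : ℂ} (hζ : ‖ζ‖ = 1) (o τ : ℝ) : cr ζ (o * (Complex.I * ζ) + τ * ζ) = o := by
  have h : ζ.re * ζ.re + ζ.im * ζ.im = 1 := by
    have := Complex.normSq_eq_norm_sq ζ; rw [hζ, Complex.normSq_apply] at this; simpa using this
  simp [cr]; linear_combination o * h

lemma dt_I {ζ : ℂ} (hζ : ‖ζ‖ = 1) (o τ : ℝ) : dt ζ (o * (Complex.I * ζ) + τ * ζ) = τ := by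
  have h : ζ.re * ζ.re + ζ.im * ζ.im = 1 := by
    have := Complex.normSq_eq_norm_sq ζ; rw [hζ, Complex.normSq_apply] at this; simpa using this
  simp [dt]; linear_combination τ * h

lemma cr_unit_add {ζ : ℂ} (p : ℂ) (s : ℝ) : cr ζ (p + s * ζ) = cr ζ p := by
  rw [cr_add_r, cr_smul_r, cr_self]; simp
lemma dt_unit_add {ζ : ℂ} (hζ : ‖ζ‖ = 1) (p : ℂ) (s : ℝ) : dt ζ (p + s * ζ) = dt ζ p + s := by
  have h : ζ.re * ζ.re + ζ.im * ζ.im = 1 := by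
    have := Complex.normSq_eq_norm_sq ζ; rw [hζ, Complex.normSq_apply] at this; simpa using this
  simp [dt]; linear_combination s * h

open Classical in
lemma up_set {P : Fin 3 → ℂ} (h : Ccw P) (j : Fin 3) {ζ : ℂ} (hζ : ‖ζ‖ = 1) (o τ : ℝ) :
    Up P j ζ (o * (Complex.I * ζ) + τ * ζ) ↔
      (dr P j = ζ ∧ off P j = o) ∧ τ ∈ Set.Ico (dt ζ (P j)) (dt ζ (P j) + ‖ed P j‖) := by
  constructor
  · rintro ⟨l, hl, he, s, h0, h1, hx⟩
    obtain ⟨h2, h3⟩ := dr_of h hl hζ he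
    have a1 := cr_I hζ o τ
    have a2 := dt_I hζ o τ
    rw [hx] at a1 a2
    rw [cr_unit_add] at a1
    rw [dt_unit_add hζ] at a2
    refine ⟨⟨h2, by unfold off; rw [h2, a1]⟩, by linarith, by rw [h3]; linarith⟩
  · rintro ⟨⟨h1, h2⟩, h3, h4⟩
    unfold off at h2
    refine ⟨_, ed_pos h j, by rw [← h1]; exact ed_dr h j, τ - dt ζ (P j), by linarith, by linarith, ?_⟩
    have := dec hζ (P j)
    rw [← h2, h1]; push_cast; linear_combination -this

open Classical in
lemma dn_set {P : Fin 3 → ℂ} (h : Ccw P) (j : Fin 3) {ζ : ℂ} (hζ : ‖ζ‖ = 1) (o τ : ℝ) :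
    Dn P j ζ (o * (Complex.I * ζ) + τ * ζ) ↔
      (dr P j = -ζ ∧ off P j = -o) ∧ τ ∈ Set.Ico (dt ζ (P (j+1))) (dt ζ (P (j+1)) + ‖ed P j‖) := by
  have hP : P j = P (j+1) - ed P j := by unfold ed; ring
  constructor
  · rintro ⟨l, hl, he, s, h0, h1, hx⟩
    obtain ⟨h2, h3⟩ := dr_of (ζ := -ζ) h hl (by simpa using hζ) (by rw [he]; ring)
    have a1 := cr_I hζ o τ
    have a2 := dt_I hζ o τ
    rw [hx] at a1 a2
    rw [cr_unit_add] at a1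
    rw [dt_unit_add hζ] at a2
    refine ⟨⟨h2, ?_⟩, by linarith, by rw [h3]; linarith⟩
    unfold off
    rw [h2, cr_neg_l, hP, he, show P (j+1) - -(l * ζ) = P (j+1) + l * ζ by ring, cr_unit_add, a1]
  · rintro ⟨⟨h1, h2⟩, h3, h4⟩
    have h5 : ed P j = -(‖ed P j‖ * ζ) := by
      have := ed_dr h j
      rw [h1] at this; linear_combination this
    unfold off at h2
    refine ⟨_, ed_pos h j, h5, τ - dt ζ (P (j+1)), by linarith, by linarith, ?_⟩
    have := dec hζ (P (j+1))
    have h6 : o = cr ζ (P (j+1)) := by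
      rw [h1, cr_neg_l, hP, h5, show ∀ y : ℂ, P (j+1) - -(y * ζ) = P (j+1) + y * ζ by intro y; ring,
        cr_unit_add] at h2
      linarith
    rw [h6]; push_cast; linear_combination -this

open MeasureTheory in
lemma int_ico (p : Prop) (u L : ℝ) (hL : 0 ≤ L)
    [Decidable p] [∀ τ : ℝ, Decidable (p ∧ τ ∈ Set.Ico u (u + L))] :
    Integrable (fun τ : ℝ => if p ∧ τ ∈ Set.Ico u (u + L) then (1:ℝ) else 0) ∧
    ∫ τ : ℝ, (if p ∧ τ ∈ Set.Ico u (u + L) then (1:ℝ) else 0) = if p then L else 0 := by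
  by_cases hp : p
  · have : (fun τ : ℝ => if p ∧ τ ∈ Set.Ico u (u + L) then (1:ℝ) else 0)
        = Set.indicator (Set.Ico u (u+L)) (fun _ => 1) := by
      ext τ; simp [hp, Set.indicator_apply]
    rw [this]
    constructor
    · rw [integrable_indicator_iff measurableSet_Ico]; simp
    · rw [integral_indicator measurableSet_Ico]; simp [hp, hL]
  · simp [hp]

open Classical in
def lw (P : Fin 3 → ℂ) (ζ : ℂ) (o : ℝ) : ℝ := ∑ j,
  ((if dr P j = ζ ∧ off P j = o then ‖ed P j‖ else 0)
    - (if dr P j = -ζ ∧ off P j = -o then ‖ed P j‖ else 0))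

open Classical MeasureTheory in
lemma Tl.line (T : Tl N V t) {ζ : ℂ} (hζ : ‖ζ‖ = 1) (o : ℝ) :
    ∑ i, lw (t i) ζ o = lw V ζ o := by
  have hz : ζ ≠ 0 := by intro h; simp [h] at hζ
  have key : ∀ P : Fin 3 → ℂ, Ccw P →
      Integrable (fun τ : ℝ => (if Fl P (o * (Complex.I * ζ) + τ * ζ) ζ 1 then (1:ℝ) else 0)
        - (if Fl P (o * (Complex.I * ζ) + τ * ζ) ζ (-1) then 1 else 0)) ∧
      ∫ τ : ℝ, ((if Fl P (o * (Complex.I * ζ) + τ * ζ) ζ 1 then (1:ℝ) else 0)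
        - (if Fl P (o * (Complex.I * ζ) + τ * ζ) ζ (-1) then 1 else 0)) = lw P ζ o := by
    intro P hP
    simp_rw [sgn_id hP _ hz, up_set hP _ hζ, dn_set hP _ hζ]
    constructor
    · apply integrable_finsetSum
      intro j _
      exact (int_ico _ _ _ (norm_nonneg (ed P j))).1.sub (int_ico _ _ _ (norm_nonneg (ed P j))).1
    · rw [integral_finsetSum]
      · unfold lw
        congr 1; ext j
        rw [integral_sub (int_ico _ _ _ (norm_nonneg (ed P j))).1 (int_ico _ _ _ (norm_nonneg (ed P j))).1,
          (int_ico _ _ _ (norm_nonneg (ed P j))).2, (int_ico _ _ _ (norm_nonneg (ed P j))).2]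
      · intro j _
        exact (int_ico _ _ _ (norm_nonneg (ed P j))).1.sub (int_ico _ _ _ (norm_nonneg (ed P j))).1
  rw [← (key V T.ccwV).2]
  rw [Finset.sum_congr rfl (fun i _ => ((key (t i) (T.ccw i)).2).symm), ← integral_finsetSum]
  · congr 1; ext τ
    rw [Finset.sum_sub_distrib, T.fl_sum _ hz (by norm_num), T.fl_sum _ hz (by norm_num)]
  · intro i _; exact (key (t i) (T.ccw i)).1

/-- edges theorem -/
theorem Tl.edges (T : Tl N V t) (w : ℂ → ℝ → ℝ) (hw : ∀ ζ o, w (-ζ) (-o) = - w ζ o) :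
    ∑ i, ∑ j, ‖ed (t i) j‖ * w (dr (t i) j) (off (t i) j)
      = ∑ j, ‖ed V j‖ * w (dr V j) (off V j) := by
  classical
  let S0 : Finset (ℂ × ℝ) := (Finset.univ.image (fun p : Fin N × Fin 3 => (dr (t p.1) p.2, off (t p.1) p.2)))
    ∪ Finset.univ.image (fun j : Fin 3 => (dr V j, off V j))
  let S : Finset (ℂ × ℝ) := S0 ∪ S0.image (fun p => -p)
  have hS1 : ∀ p ∈ S, ‖p.1‖ = 1 := by
    have h0 : ∀ p ∈ S0, ‖p.1‖ = 1 := by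
      intro p hp
      rcases Finset.mem_union.1 hp with hp | hp
      · obtain ⟨q, _, rfl⟩ := Finset.mem_image.1 hp; exact norm_dr (T.ccw _) _
      · obtain ⟨q, _, rfl⟩ := Finset.mem_image.1 hp; exact norm_dr T.ccwV _
    intro p hp
    rcases Finset.mem_union.1 hp with hp | hp
    · exact h0 p hp
    · obtain ⟨q, hq, rfl⟩ := Finset.mem_image.1 hp; simpa using h0 q hq
  have hneg : ∀ p ∈ S0, p ∈ S ∧ -p ∈ S := fun p hp =>
    ⟨Finset.mem_union_left _ hp, Finset.mem_union_right _ (Finset.mem_image_of_mem _ hp)⟩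
  have key : ∀ P : Fin 3 → ℂ, (∀ j, (dr P j, off P j) ∈ S0) →
      ∑ p ∈ S, w p.1 p.2 * lw P p.1 p.2 = 2 * ∑ j, ‖ed P j‖ * w (dr P j) (off P j) := by
    intro P hP
    unfold lw
    simp_rw [Finset.mul_sum]
    rw [Finset.sum_comm]
    congr 1; ext j
    obtain ⟨h1, h2⟩ := hneg _ (hP j)
    simp_rw [mul_sub]
    rw [Finset.sum_sub_distrib]
    have e1 : ∑ p ∈ S, w p.1 p.2 * (if dr P j = p.1 ∧ off P j = p.2 then ‖ed P j‖ else 0)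
        = w (dr P j) (off P j) * ‖ed P j‖ := by
      rw [Finset.sum_eq_single_of_mem _ h1]
      · simp
      · intro p _ hp
        rw [if_neg, mul_zero]; rintro ⟨h, h'⟩; exact hp (Prod.ext h.symm h'.symm)
    have e2 : ∑ p ∈ S, w p.1 p.2 * (if dr P j = -p.1 ∧ off P j = -p.2 then ‖ed P j‖ else 0)
        = - w (dr P j) (off P j) * ‖ed P j‖ := by
      rw [Finset.sum_eq_single_of_mem _ h2]
      · simp [hw]
      · intro p _ hp
        rw [if_neg, mul_zero]; rintro ⟨h, h'⟩; apply hp; apply Prod.ext <;> simp [h, h']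
    rw [e1, e2]; ring
  have k1 : ∀ i, _ := fun i => key (t i) (fun j => Finset.mem_union_left _ (Finset.mem_image.2 ⟨(i,j), Finset.mem_univ _, rfl⟩))
  have k2 := key V (fun j => Finset.mem_union_right _ (Finset.mem_image.2 ⟨j, Finset.mem_univ _, rfl⟩))
  have : ∑ i, ∑ p ∈ S, w p.1 p.2 * lw (t i) p.1 p.2 = ∑ p ∈ S, w p.1 p.2 * lw V p.1 p.2 := by
    rw [Finset.sum_comm]
    apply Finset.sum_congr rfl
    intro p hp
    rw [← T.line (hS1 p hp), Finset.mul_sum]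
  rw [k2, Finset.sum_congr rfl (fun i _ => k1 i), ← Finset.mul_sum] at this
  linarith
end
end TT

namespace TT
section
open Filter Topology

def cs (θ : ℝ) : ℂ := ⟨cos θ, sin θ⟩
@[simp] lemma cs_re (θ : ℝ) : (cs θ).re = cos θ := rfl
@[simp] lemma cs_im (θ : ℝ) : (cs θ).im = sin θ := rfl
lemma cs_add (a b : ℝ) : cs (a + b) = cs a * cs b := by
  apply Complex.ext <;> simp [cos_add, sin_add]; ring
lemma cs_exp (θ : ℝ) : cs θ = Complex.exp (θ * Complex.I) := by
  apply Complex.ext <;> simp [Complex.exp_ofReal_mul_I_re, Complex.exp_ofReal_mul_I_im]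
lemma norm_cs (θ : ℝ) : ‖cs θ‖ = 1 := by rw [cs_exp]; exact Complex.norm_exp_ofReal_mul_I θ
lemma cs_ne (θ : ℝ) : cs θ ≠ 0 := by intro h; have := norm_cs θ; rw [h] at this; simp at this
lemma cs_zero : cs 0 = 1 := by apply Complex.ext <;> simp
lemma cs_pi : cs π = -1 := by apply Complex.ext <;> simp
lemma cs_neg_mul (θ : ℝ) : cs (-θ) * cs θ = 1 := by rw [← cs_add]; simp [cs_zero]
lemma cs_per (θ : ℝ) : cs (θ + 2 * π) = cs θ := by apply Complex.ext <;> simp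
lemma ex_cs {ζ : ℂ} (h : ‖ζ‖ = 1) : ∃ φ, ζ = cs φ := by
  refine ⟨Complex.arg ζ, ?_⟩
  rw [cs_exp]
  have := Complex.norm_mul_exp_arg_mul_I ζ
  rw [h] at this; simpa using this.symm

lemma cr_cs (φ ψ : ℝ) : cr (cs φ) (cs (φ + ψ)) = sin ψ := by
  simp [cr, cos_add, sin_add]
  linear_combination sin ψ * sin_sq_add_cos_sq φ
lemma dt_cs (φ ψ : ℝ) : dt (cs φ) (cs (φ + ψ)) = cos ψ := by
  simp [dt, cos_add, sin_add]
  linear_combination cos ψ * sin_sq_add_cos_sq φ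

open Classical in
/-- angular measure of P at x -/
def am (P : Fin 3 → ℂ) (x : ℂ) : ℝ := ∫ θ in (0:ℝ)..(2 * π), if Fl P x (cs θ) 1 then (1:ℝ) else 0

open Classical MeasureTheory in
lemma am_win {P : Fin 3 → ℂ} {x : ℂ} (φ A : ℝ) (h0 : 0 ≤ A) (h1 : A ≤ 2 * π)
    (h : ∀ ψ, 0 < ψ → ψ < 2 * π → (Fl P x (cs (φ + ψ)) 1 ↔ ψ < A)) : am P x = A := by
  unfold am
  set f : ℝ → ℝ := fun θ => if Fl P x (cs θ) 1 then (1:ℝ) else 0 with hf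
  have hp : Function.Periodic f (2 * π) := by
    intro θ; simp only [hf]; rw [cs_per]
  have e1 : ∫ θ in (0:ℝ)..(2 * π), f θ = ∫ θ in φ..(φ + 2 * π), f θ := by
    have := hp.intervalIntegral_add_eq 0 φ
    rwa [zero_add] at this
  have e2 : ∫ θ in φ..(φ + 2 * π), f θ = ∫ ψ in (0:ℝ)..(2 * π), f (φ + ψ) := by
    rw [intervalIntegral.integral_comp_add_left]; simp
  rw [e1, e2, intervalIntegral.integral_of_le (by positivity), integral_Ioc_eq_integral_Ioo]
  have e3 : ∫ ψ in Set.Ioo 0 (2 * π), f (φ + ψ) = ∫ ψ in Set.Ioo 0 (2 * π), Set.indicator (Set.Iio A) (fun _ => (1:ℝ)) ψ := by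
    apply setIntegral_congr_fun measurableSet_Ioo
    intro ψ hψ
    simp only [hf, Set.indicator_apply, Set.mem_Iio]
    rw [h ψ hψ.1 hψ.2]
  rw [e3, integral_indicator measurableSet_Iio, Measure.restrict_restrict measurableSet_Iio]
  have : Set.Iio A ∩ Set.Ioo 0 (2 * π) = Set.Ioo 0 A := by
    ext y; simp only [Set.mem_inter_iff, Set.mem_Iio, Set.mem_Ioo]
    constructor
    · rintro ⟨a, b, c⟩; exact ⟨b, a⟩
    · rintro ⟨a, b⟩; exact ⟨b, a, by linarith⟩
  rw [this]; simp [h0]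

open Classical in
lemma am_nonneg (P : Fin 3 → ℂ) (x : ℂ) : 0 ≤ am P x := by
  unfold am
  apply intervalIntegral.integral_nonneg (by positivity)
  intro θ _; split_ifs <;> norm_num

lemma cs_cont : Continuous cs := by
  have : cs = fun θ : ℝ => Complex.exp (θ * Complex.I) := by ext1; exact cs_exp _
  rw [this]; fun_prop

open Classical MeasureTheory in
lemma fl_meas (P : Fin 3 → ℂ) (x : ℂ) : MeasurableSet {θ : ℝ | Fl P x (cs θ) 1} := by
  have : {θ : ℝ | Fl P x (cs θ) 1} = ⋂ j, {θ | pos3 (cr (ed P j) (x - P j)) (cr (ed P j) (cs θ)) (1 * dt (ed P j) (cs θ))} := by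
    ext θ; simp [Fl]
  rw [this]
  apply MeasurableSet.iInter
  intro j
  have c1 : Measurable (fun θ => cr (ed P j) (cs θ)) := by
    apply Continuous.measurable; unfold cr; simp only [cs_re, cs_im]; fun_prop
  have c2 : Measurable (fun θ => 1 * dt (ed P j) (cs θ)) := by
    apply Continuous.measurable; unfold dt; simp only [cs_re, cs_im]; fun_prop
  unfold pos3
  exact (MeasurableSet.const _).union ((MeasurableSet.const _).inter
    ((measurableSet_lt measurable_const c1).union ((measurableSet_eq_fun c1 measurable_const).inter
      (measurableSet_lt measurable_const c2))))

variable {N : ℕ} {V : Fin 3 → ℂ} {t : Fin N → Fin 3 → ℂ}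

open Classical MeasureTheory in
lemma Tl.am_sum (T : Tl N V t) (x : ℂ) : ∑ i, am (t i) x = am V x := by
  unfold am
  rw [← intervalIntegral.integral_finsetSum]
  · apply intervalIntegral.integral_congr
    intro θ _
    exact T.fl_sum x (cs_ne θ) one_ne_zero
  · intro i _
    have : (fun θ => if Fl (t i) x (cs θ) 1 then (1:ℝ) else 0)
        = Set.indicator {θ | Fl (t i) x (cs θ) 1} (fun _ => (1:ℝ)) := by
      ext θ; simp [Set.indicator_apply]
    have hc : IntervalIntegrable (fun _ : ℝ => (1:ℝ)) volume 0 (2 * π) := intervalIntegrable_const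
    rw [intervalIntegrable_iff] at hc
    rw [this, intervalIntegrable_iff]
    exact Integrable.indicator hc (fl_meas _ _)

lemma sin_pos3 {ψ l : ℝ} (hl : 0 < l) (h0 : 0 < ψ) (h1 : ψ < 2 * π) :
    pos3 0 (l * sin ψ) (1 * (l * cos ψ)) ↔ ψ < π := by
  unfold pos3
  constructor
  · intro h
    by_contra hn
    push Not at hn
    rcases hn.lt_or_eq with h2 | h2
    · have : sin ψ < 0 := by
        have := sin_pos_of_pos_of_lt_pi (x := ψ - π) (by linarith) (by linarith)
        rw [sin_sub_pi] at this; linarith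
      have : l * sin ψ < 0 := by nlinarith
      rcases h with h | ⟨_, h | ⟨h, _⟩⟩ <;> linarith
    · rw [← h2] at h; simp at h
      linarith
  · intro h
    exact Or.inr ⟨rfl, Or.inl (mul_pos hl (sin_pos_of_pos_of_lt_pi h0 h))⟩

/-- interior angle -/
def IsAng (P : Fin 3 → ℂ) (j : Fin 3) (A : ℝ) : Prop :=
  0 < A ∧ A < π ∧ - dr P (j+2) = dr P j * cs A

lemma cr_ed {P : Fin 3 → ℂ} (h : Ccw P) {j : Fin 3} {φ : ℝ} (hφ : dr P j = cs φ) (ψ : ℝ) :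
    cr (ed P j) (cs (φ + ψ)) = ‖ed P j‖ * sin ψ ∧ dt (ed P j) (cs (φ + ψ)) = ‖ed P j‖ * cos ψ := by
  rw [ed_dr h j, cr_smul_l, dt_smul_l, hφ, cr_cs, dt_cs, norm_mul, norm_cs]; simp

lemma cr_start {P : Fin 3 → ℂ} (j : Fin 3) : cr (ed P j) (P j - P j) = 0 := by simp [cr]
lemma cr_end {P : Fin 3 → ℂ} (j : Fin 3) : cr (ed P (j+2)) (P j - P (j+2)) = 0 := by
  have : P j - P (j+2) = ed P (j+2) := by unfold ed; rw [f21]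
  rw [this, cr_self]
lemma cr_opp {P : Fin 3 → ℂ} (h : Ccw P) (j : Fin 3) : 0 < cr (ed P (j+1)) (P j - P (j+1)) := by
  have := ccw_rot h (j+1); rwa [f11] at this

lemma fl_vertex {P : Fin 3 → ℂ} (h : Ccw P) {j : Fin 3} {A φ : ℝ} (hA : IsAng P j A)
    (hφ : dr P j = cs φ) {ψ : ℝ} (p0 : 0 < ψ) (p1 : ψ < 2 * π) :
    Fl P (P j) (cs (φ + ψ)) 1 ↔ ψ < A := by
  obtain ⟨a0, a1, a2⟩ := hA
  have h2 : dr P (j+2) = cs (φ + A + π) := by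
    rw [cs_add, cs_add, cs_pi, ← hφ, ← a2]; ring
  have e1 := cr_ed h hφ ψ
  have e2 := cr_ed h h2 (ψ - A - π)
  rw [show φ + A + π + (ψ - A - π) = φ + ψ by ring, sin_sub_pi, cos_sub_pi] at e2
  constructor
  · intro hf
    have f0 := hf j
    have f2 := hf (j+2)
    rw [cr_start, e1.1, e1.2, sin_pos3 (ed_pos h j) p0 p1] at f0
    rw [cr_end, e2.1, e2.2] at f2
    by_contra hn
    push Not at hn
    have lp := ed_pos h (j+2)
    rcases hn.lt_or_eq with h3 | h3
    · have := sin_pos_of_pos_of_lt_pi (x := ψ - A) (by linarith) (by linarith)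
      have := mul_pos lp this
      unfold pos3 at f2
      rcases f2 with h | ⟨_, h | ⟨h, _⟩⟩ <;> linarith
    · rw [← h3] at f2; simp [pos3] at f2; linarith
  · intro hψ
    refine all3 (p := fun j => pos3 (cr (ed P j) (_ - P j)) (cr (ed P j) _) (1 * dt (ed P j) _)) j ?_ ?_ ?_
    · rw [cr_start, e1.1, e1.2, sin_pos3 (ed_pos h j) p0 p1]; linarith
    · exact Or.inl (cr_opp h j)
    · rw [cr_end, e2.1]
      refine Or.inr ⟨rfl, Or.inl (mul_pos (ed_pos h (j+2)) ?_)⟩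
      have := sin_pos_of_pos_of_lt_pi (x := A - ψ) (by linarith) (by linarith)
      rw [show ψ - A = -(A - ψ) by ring, sin_neg]; linarith

lemma am_vertex {P : Fin 3 → ℂ} (h : Ccw P) {j : Fin 3} {A : ℝ} (hA : IsAng P j A) :
    am P (P j) = A := by
  obtain ⟨φ, hφ⟩ := ex_cs (norm_dr h j)
  exact am_win φ A hA.1.le (by linarith [hA.2.1, pi_pos]) (fun ψ p0 p1 => fl_vertex h hA hφ p0 p1)

/-- open edge -/
def OE (P : Fin 3 → ℂ) (j : Fin 3) (x : ℂ) : Prop := ∃ r : ℝ, 0 < r ∧ r < 1 ∧ x = P j + r * ed P j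

lemma OE_cr {P : Fin 3 → ℂ} (h : Ccw P) {j : Fin 3} {x : ℂ} (hx : OE P j x) :
    cr (ed P j) (x - P j) = 0 ∧ 0 < cr (ed P (j+1)) (x - P (j+1)) ∧ 0 < cr (ed P (j+2)) (x - P (j+2)) := by
  obtain ⟨r, r0, r1, hr⟩ := hx
  have hc : cr (ed P j) (x - P j) = 0 := by rw [hr, add_sub_cancel_left, cr_smul_r, cr_self]; simp
  obtain ⟨r', hr', e2, e3⟩ := on_line h j x hc
  have : r' = r := by
    have : (r' : ℂ) * ed P j = r * ed P j := by linear_combination hr - hr'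
    exact_mod_cast mul_right_cancel₀ (ed_ne h j) this
  subst this
  have := ccw_e h j
  refine ⟨hc, ?_, ?_⟩
  · rw [e2]; nlinarith
  · rw [e3]; nlinarith

lemma fl_edge {P : Fin 3 → ℂ} (h : Ccw P) {j : Fin 3} {x : ℂ} (hx : OE P j x) {φ : ℝ}
    (hφ : dr P j = cs φ) {ψ : ℝ} (p0 : 0 < ψ) (p1 : ψ < 2 * π) :
    Fl P x (cs (φ + ψ)) 1 ↔ ψ < π := by
  obtain ⟨c0, c1, c2⟩ := OE_cr h hx
  have e1 := cr_ed h hφ ψ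
  constructor
  · intro hf
    have f0 := hf j
    rwa [c0, e1.1, e1.2, sin_pos3 (ed_pos h j) p0 p1] at f0
  · intro hψ
    refine all3 (p := fun j => pos3 (cr (ed P j) (_ - P j)) (cr (ed P j) _) (1 * dt (ed P j) _)) j ?_ (Or.inl c1) (Or.inl c2)
    rwa [c0, e1.1, e1.2, sin_pos3 (ed_pos h j) p0 p1]

lemma am_edge {P : Fin 3 → ℂ} (h : Ccw P) {j : Fin 3} {x : ℂ} (hx : OE P j x) : am P x = π := by
  obtain ⟨φ, hφ⟩ := ex_cs (norm_dr h j)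
  exact am_win φ π pi_pos.le (by linarith [pi_pos]) (fun ψ p0 p1 => fl_edge h hx hφ p0 p1)

lemma am_int {P : Fin 3 → ℂ} {x : ℂ} (hx : x ∈ SReg P) : am P x = 2 * π := by
  refine am_win 0 _ (by positivity) le_rfl (fun ψ _ p1 => ?_)
  exact ⟨fun _ => p1, fun _ j => Or.inl (hx j)⟩

lemma am_out {P : Fin 3 → ℂ} {x : ℂ} (hx : x ∉ Reg P) : am P x = 0 := by
  refine am_win 0 _ le_rfl (by positivity) (fun ψ p0 p1 => ?_)
  constructor
  · intro hf
    exfalso; apply hx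
    intro j
    rcases hf j with h | ⟨h, _⟩
    · exact h.le
    · exact h.ge
  · intro h; linarith

lemma am_class {P : Fin 3 → ℂ} (h : Ccw P) (x : ℂ) :
    (∃ j, x = P j) ∨ (∃ j, OE P j x) ∨ x ∈ SReg P ∨ x ∉ Reg P := by
  by_cases hR : x ∈ Reg P
  swap
  · exact Or.inr (Or.inr (Or.inr hR))
  by_cases hS : x ∈ SReg P
  · exact Or.inr (Or.inr (Or.inl hS))
  have : ∃ j, cr (ed P j) (x - P j) = 0 := by
    by_contra hn; push Not at hn
    exact hS (fun j => lt_of_le_of_ne (hR j) (hn j).symm)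
  obtain ⟨j, hj⟩ := this
  obtain ⟨r, hr, e2, e3⟩ := on_line h j x hj
  have hE := ccw_e h j
  have h1 := hR (j+1)
  have h2 := hR (j+2)
  rw [e2] at h1
  rw [e3] at h2
  have r0 : 0 ≤ r := by nlinarith
  have r1 : r ≤ 1 := by nlinarith
  rcases r0.lt_or_eq with r0 | r0
  · rcases r1.lt_or_eq with r1 | r1
    · exact Or.inr (Or.inl ⟨j, r, r0, r1, hr⟩)
    · left; refine ⟨j+1, ?_⟩; rw [hr, r1]; unfold ed; push_cast; ring
  · left; refine ⟨j, ?_⟩; rw [hr, ← r0]; simp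

lemma ang_ex {P : Fin 3 → ℂ} (h : Ccw P) (j : Fin 3) : ∃ A, IsAng P j A := by
  obtain ⟨φ, hφ⟩ := ex_cs (norm_dr h j)
  have h2 : ‖- dr P (j+2) * cs (-φ)‖ = 1 := by rw [norm_mul, norm_neg, norm_dr h, norm_cs]; simp
  have hs : 0 < (- dr P (j+2) * cs (-φ)).im := by
    have e := ccw_e h (j+2)
    rw [f21, ed_dr h (j+2), ed_dr h j, cr_smul_l, cr_smul_r] at e
    have e1 : 0 < cr (dr P (j+2)) (dr P j) := by
      by_contra hn; push Not at hn
      have := mul_pos (ed_pos h (j+2)) (ed_pos h j)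
      nlinarith
    rw [hφ] at e1
    simp [cr] at e1 ⊢; linarith
  set z := - dr P (j+2) * cs (-φ) with hz
  have hzc : z = cs z.arg := by
    rw [cs_exp]
    have := Complex.norm_mul_exp_arg_mul_I z
    rw [h2] at this; simpa using this.symm
  have hzs : 0 < sin z.arg := by rw [hzc] at hs; simpa using hs
  refine ⟨z.arg, ?_, ?_, ?_⟩
  · by_contra hn; push Not at hn
    have := sin_nonpos_of_nonpos_of_neg_pi_le hn (Complex.neg_pi_lt_arg z).le
    linarith
  · rcases (Complex.arg_le_pi z).lt_or_eq with h | h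
    · exact h
    · rw [h] at hzs; simp at hzs
  · rw [← hzc, hφ, hz]; linear_combination (dr P (j+2)) * cs_neg_mul φ
end
end TT

namespace TT
section
open Filter Topology

structure Par (α β : ℝ) : Prop where
  sum : 3 * α + 2 * β = π
  a0 : 0 < α
  b0 : 0 < β
  irr : ¬ ∃ q : ℚ, α = (q : ℝ) * π

lemma Par.ind {α β : ℝ} (h : Par α β) {m n : ℤ} (e : m * α + n * β = 0) : m = 0 ∧ n = 0 := by
  have e1 : ((2 * m - 3 * n : ℤ) : ℝ) * α = ((-n : ℤ):ℝ) * π := by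
    rw [← h.sum]; push_cast; linear_combination 2 * e
  by_cases h0 : (2 * m - 3 * n) = 0
  · rw [h0] at e1
    have : ((-n : ℤ):ℝ) = 0 := by
      have h2 := e1.symm
      rw [Int.cast_zero, zero_mul] at h2
      rcases mul_eq_zero.1 h2 with h2 | h2
      · exact h2
      · exact absurd h2 pi_ne_zero
    have : n = 0 := by have := (Int.cast_eq_zero.1 this); omega
    omega
  · exfalso; apply h.irr
    refine ⟨((-n : ℤ) : ℚ) / ((2 * m - 3 * n : ℤ) : ℚ), ?_⟩
    have h1 : ((2 * m - 3 * n : ℤ) : ℝ) ≠ 0 := by exact_mod_cast h0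
    have : ((((-n : ℤ) : ℚ) / ((2 * m - 3 * n : ℤ) : ℚ) : ℚ) : ℝ) = ((-n : ℤ):ℝ) / ((2 * m - 3 * n : ℤ) : ℝ) := by
      push_cast; rfl
    rw [this, div_mul_eq_mul_div, eq_div_iff h1]; linear_combination e1

lemma Par.indN {α β : ℝ} (h : Par α β) {p q p' q' : ℕ} (e : p * α + q * β = p' * α + q' * β) :
    p = p' ∧ q = q' := by
  have := h.ind (m := (p:ℤ) - p') (n := (q:ℤ) - q') (by push_cast; linarith)
  omega

def af (α β : ℝ) : Fin 3 → ℝ := ![α, β, 2 * α + β]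
def sv (α : ℝ) : ℝ := 2 * sin (α / 2)
def lf (s : ℝ) : Fin 3 → ℝ := ![s, 1 - s ^ 2, 1]
@[simp] lemma af0 (α β : ℝ) : af α β 0 = α := rfl
@[simp] lemma af1 (α β : ℝ) : af α β 1 = β := rfl
@[simp] lemma af2 (α β : ℝ) : af α β 2 = 2 * α + β := rfl
@[simp] lemma lf0 (s : ℝ) : lf s 0 = s := rfl
@[simp] lemma lf1 (s : ℝ) : lf s 1 = 1 - s ^ 2 := rfl
@[simp] lemma lf2 (s : ℝ) : lf s 2 = 1 := rfl

structure LT (N : ℕ) (α β : ℝ) (V : Fin 3 → ℂ) (t : Fin N → Fin 3 → ℂ) (lab : Fin N → Fin 3 → Fin 3) : Prop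
    extends Tl N V t where
  par : Par α β
  inj : ∀ i, Function.Injective (lab i)
  ang : ∀ i j, IsAng (t i) j (af α β (lab i j))
  len : ∀ i j, ‖ed (t i) j‖ = lf (sv α) (lab i (j+2))

lemma Par.s0 {α β : ℝ} (h : Par α β) : 0 < sv α := by
  unfold sv
  have := sin_pos_of_pos_of_lt_pi (x := α / 2) (by linarith [h.a0]) (by linarith [h.sum, h.a0, h.b0])
  linarith
lemma Par.s1 {α β : ℝ} (h : Par α β) : sv α < 1 := by
  unfold sv
  have : sin (α / 2) < sin (π / 6) := by
    apply sin_lt_sin_of_lt_of_le_pi_div_two <;> linarith [h.sum, h.a0, h.b0, pi_pos]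
  rw [sin_pi_div_six] at this; linarith

/-- k = cos(α/2) -/
def kv (α : ℝ) : ℝ := cos (α / 2)
lemma Par.k0 {α β : ℝ} (h : Par α β) : 0 < kv α := by
  unfold kv; apply cos_pos_of_mem_Ioo; constructor <;> linarith [h.sum, h.a0, h.b0, pi_pos]
lemma ksq (α : ℝ) : 4 * kv α ^ 2 = 4 - sv α ^ 2 := by
  unfold kv sv; nlinarith [sin_sq_add_cos_sq (α / 2)]
lemma Par.cosa {α β : ℝ} (_ : Par α β) : cos α = 1 - sv α ^ 2 / 2 := by
  have : α = 2 * (α / 2) := by ring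
  rw [this, cos_two_mul, ← this]; unfold sv; nlinarith [sin_sq_add_cos_sq (α / 2)]
lemma Par.sina {α β : ℝ} (_ : Par α β) : sin α = kv α * sv α := by
  have : α = 2 * (α / 2) := by ring
  rw [this, sin_two_mul, ← this]; unfold sv kv; ring
lemma Par.sinab {α β : ℝ} (h : Par α β) : sin (α + β) = kv α := by
  have : α + β = π / 2 - α / 2 := by linarith [h.sum]
  rw [this, sin_pi_div_two_sub]; rfl
lemma Par.cosab {α β : ℝ} (h : Par α β) : cos (α + β) = sv α / 2 := by
  have : α + β = π / 2 - α / 2 := by linarith [h.sum]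
  rw [this, cos_pi_div_two_sub]; unfold sv; ring
lemma Par.sinb {α β : ℝ} (h : Par α β) : sin β = kv α * (1 - sv α ^ 2) := by
  have : β = (α + β) - α := by ring
  rw [this, sin_sub, h.sinab, h.cosab, h.cosa, h.sina]; ring
lemma Par.cosb {α β : ℝ} (h : Par α β) : cos β = sv α / 2 * (3 - sv α ^ 2) := by
  have : β = (α + β) - α := by ring
  rw [this, cos_sub, h.sinab, h.cosab, h.cosa, h.sina]
  have := ksq α
  linear_combination sv α / 4 * this
lemma Par.sin2a {α β : ℝ} (h : Par α β) : sin (2 * α) = kv α * sv α * (2 - sv α ^ 2) := by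
  rw [sin_two_mul, h.sina, h.cosa]; ring
lemma Par.sin2b {α β : ℝ} (h : Par α β) : sin (2 * β) = kv α * sv α * (1 - sv α ^ 2) * (3 - sv α ^ 2) := by
  rw [sin_two_mul, h.sinb, h.cosb]; ring
lemma Par.sin3a {α β : ℝ} (h : Par α β) : sin (3 * α) = kv α * sv α * (1 - sv α ^ 2) * (3 - sv α ^ 2) := by
  rw [← h.sin2b, show 3 * α = π - 2 * β by linarith [h.sum], sin_pi_sub]
lemma Par.sina2b {α β : ℝ} (h : Par α β) : sin (α + 2 * β) = kv α * sv α * (2 - sv α ^ 2) := by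
  rw [← h.sin2a, show α + 2 * β = π - 2 * α by linarith [h.sum], sin_pi_sub]

/-! law of sines -/
lemma cr_adj {P : Fin 3 → ℂ} (h : Ccw P) {j : Fin 3} {A : ℝ} (hA : IsAng P (j+1) A) :
    cr (ed P j) (ed P (j+1)) = ‖ed P j‖ * ‖ed P (j+1)‖ * sin A := by
  have h1 := hA.2.2
  rw [f11] at h1
  obtain ⟨φ, hφ⟩ := ex_cs (norm_dr h (j+1))
  rw [hφ, ← cs_add] at h1
  have h2 : dr P j = - cs (φ + A) := by rw [← h1]; ring
  nth_rw 1 [ed_dr h j]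
  nth_rw 1 [ed_dr h (j+1)]
  rw [cr_smul_l, cr_smul_r, h2, cr_neg_l, cr_swap, hφ, cr_cs]; ring

lemma cr_cyc (P : Fin 3 → ℂ) (j : Fin 3) : cr (ed P (j+1)) (ed P (j+2)) = cr (ed P j) (ed P (j+1)) := by
  rw [ed_sum, cr_neg_r, cr_add_r, cr_self, cr_swap]; ring

lemma sines {P : Fin 3 → ℂ} (h : Ccw P) {A : Fin 3 → ℝ} (hA : ∀ j, IsAng P j (A j)) (j : Fin 3) :
    ‖ed P j‖ * sin (A (j+1)) = ‖ed P (j+2)‖ * sin (A (j+2)) := by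
  have h1 := cr_adj h (hA (j+1))
  have h2 := cr_adj (j := j+1) h (by rw [f12]; exact hA (j+2))
  rw [f12, cr_cyc, h1] at h2
  have := ed_pos h (j+1)
  have h3 : ‖ed P (j+1)‖ * (‖ed P j‖ * sin (A (j+1)) - ‖ed P (j+2)‖ * sin (A (j+2))) = 0 := by linarith
  rcases mul_eq_zero.1 h3 with h3 | h3 <;> linarith

lemma sinpos {P : Fin 3 → ℂ} {j : Fin 3} {A : ℝ} (hA : IsAng P j A) : 0 < sin A :=
  sin_pos_of_pos_of_lt_pi hA.1 hA.2.1

/-- sides proportional to sines of opposite angles -/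
lemma sides_mu {P : Fin 3 → ℂ} (h : Ccw P) {A : Fin 3 → ℝ} (hA : ∀ j, IsAng P j (A j)) :
    ∃ μ, 0 < μ ∧ ∀ j, ‖ed P j‖ = μ * sin (A (j+2)) := by
  have p0 := sinpos (hA 0)
  have p1 := sinpos (hA 1)
  have p2 := sinpos (hA 2)
  refine ⟨‖ed P 0‖ / sin (A 2), div_pos (ed_pos h 0) p2, ?_⟩
  have h0 : ‖ed P 0‖ * sin (A 1) = ‖ed P 2‖ * sin (A 2) := sines h hA 0
  have h2 : ‖ed P 1‖ * sin (A 2) = ‖ed P 0‖ * sin (A 0) := sines h hA 1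
  intro j
  fin_cases j
  · show ‖ed P 0‖ = ‖ed P 0‖ / sin (A 2) * sin (A 2)
    field_simp
  · show ‖ed P 1‖ = ‖ed P 0‖ / sin (A 2) * sin (A 0)
    field_simp; linarith
  · show ‖ed P 2‖ = ‖ed P 0‖ / sin (A 2) * sin (A 1)
    field_simp; linarith

lemma ang_sum {P : Fin 3 → ℂ} (h : Ccw P) {A : Fin 3 → ℝ} (hA : ∀ j, IsAng P j (A j)) :
    A 0 + A 1 + A 2 = π := by
  have e0 : - dr P 2 = dr P 0 * cs (A 0) := (hA 0).2.2
  have e1 : - dr P 0 = dr P 1 * cs (A 1) := (hA 1).2.2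
  have e2 : - dr P 1 = dr P 2 * cs (A 2) := (hA 2).2.2
  have hne : dr P 2 ≠ 0 := by intro h0; have := norm_dr h 2; rw [h0] at this; simp at this
  have e3 : cs (A 0 + A 1 + A 2) = -1 := by
    rw [cs_add, cs_add]
    apply mul_left_cancel₀ hne
    linear_combination (-cs (A 0) * cs (A 1)) * e2 - cs (A 0) * e1 * (-1) - e0
  have hc : cos (A 0 + A 1 + A 2 - π) = 1 := by
    have := congrArg Complex.re e3; simp at this; rw [cos_sub_pi]; linarith
  obtain ⟨n, hn⟩ := (cos_eq_one_iff _).1 hc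
  have p := pi_pos
  have a0 := hA 0; have a1 := hA 1; have a2 := hA 2
  have l : (-1:ℝ) < n := by
    have : -π < n * (2 * π) := by rw [hn]; linarith [a0.1, a1.1, a2.1]
    nlinarith
  have u : (n:ℝ) < 1 := by
    have : n * (2 * π) < 2 * π := by rw [hn]; linarith [a0.2.1, a1.2.1, a2.2.1]
    nlinarith
  have : n = 0 := by
    have l' : -1 < n := by exact_mod_cast l
    have u' : n < 1 := by exact_mod_cast u
    omega
  rw [this] at hn; simp at hn; linarith

variable {N : ℕ} {α β : ℝ} {V : Fin 3 → ℂ} {t : Fin N → Fin 3 → ℂ} {lab : Fin N → Fin 3 → Fin 3}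

/-- counts -/
def cn (t : Fin N → Fin 3 → ℂ) (lab : Fin N → Fin 3 → Fin 3) (x : ℂ) (l : Fin 3) : Finset (Fin N) :=
  by classical exact Finset.univ.filter (fun i => ∃ j, t i j = x ∧ lab i j = l)
def mo (t : Fin N → Fin 3 → ℂ) (x : ℂ) : Finset (Fin N) :=
  by classical exact Finset.univ.filter (fun i => ∃ j, OE (t i) j x)
def mi (t : Fin N → Fin 3 → ℂ) (x : ℂ) : Finset (Fin N) :=
  by classical exact Finset.univ.filter (fun i => x ∈ SReg (t i))
lemma mem_cn {x : ℂ} {l : Fin 3} {i : Fin N} : i ∈ cn t lab x l ↔ ∃ j, t i j = x ∧ lab i j = l := by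
  simp [cn]
lemma mem_mo {x : ℂ} {i : Fin N} : i ∈ mo t x ↔ ∃ j, OE (t i) j x := by simp [mo]
lemma mem_mi {x : ℂ} {i : Fin N} : i ∈ mi t x ↔ x ∈ SReg (t i) := by simp [mi]

lemma vert_inj {P : Fin 3 → ℂ} (h : Ccw P) {j k : Fin 3} (e : P j = P k) : j = k := by
  rcases fin3_cases j k with rfl | rfl | rfl
  · rfl
  · exact absurd (by unfold ed; rw [e]; simp) (ed_ne h j)
  · exact absurd (by unfold ed; rw [f21, e]; simp) (ed_ne h (j+2))

lemma vert_not_OE {P : Fin 3 → ℂ} (h : Ccw P) {j k : Fin 3} (e : OE P j (P k)) : False := by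
  obtain ⟨a, b, c⟩ := OE_cr h e
  rcases fin3_cases j k with rfl | rfl | rfl
  · rw [cr_end] at c; linarith
  · rw [cr_start] at b; linarith
  · rw [cr_start] at c; linarith
lemma vert_not_S {P : Fin 3 → ℂ} {k : Fin 3} (e : P k ∈ SReg P) : False := by
  have := e k; rw [cr_start] at this; linarith
lemma OE_not_S {P : Fin 3 → ℂ} (h : Ccw P) {j : Fin 3} {x : ℂ} (e : OE P j x) (e2 : x ∈ SReg P) : False := by
  have := e2 j; rw [(OE_cr h e).1] at this; linarith
lemma vert_mem {P : Fin 3 → ℂ} (h : Ccw P) (k : Fin 3) : P k ∈ Reg P := by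
  refine all3 (p := fun j => 0 ≤ cr (ed P j) (P k - P j)) k ?_ ?_ ?_
  · rw [cr_start]
  · exact (cr_opp h k).le
  · rw [cr_end]
lemma OE_mem {P : Fin 3 → ℂ} (h : Ccw P) {j : Fin 3} {x : ℂ} (e : OE P j x) : x ∈ Reg P := by
  obtain ⟨a, b, c⟩ := OE_cr h e
  exact all3 (p := fun j => 0 ≤ cr (ed P j) (x - P j)) j a.ge b.le c.le

lemma LT.tile_am (T : LT N α β V t lab) (x : ℂ) (i : Fin N) :
    am (t i) x = (if i ∈ cn t lab x 0 then α else 0) + (if i ∈ cn t lab x 1 then β else 0)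
      + (if i ∈ cn t lab x 2 then (2 * α + β) else 0) + (if i ∈ mo t x then π else 0)
      + (if i ∈ mi t x then 2 * π else 0) := by
  have hc := T.ccw i
  rcases am_class hc x with ⟨j, hj⟩ | ⟨j, hj⟩ | hj | hj
  · have h1 : am (t i) x = af α β (lab i j) := by rw [hj]; exact am_vertex hc (T.ang i j)
    have h2 : ∀ l, i ∈ cn t lab x l ↔ lab i j = l := by
      intro l; rw [mem_cn]; constructor
      · rintro ⟨k, hk, hl⟩; rw [hj] at hk; rw [← vert_inj hc hk]; exact hl
      · intro hl; exact ⟨j, hj.symm, hl⟩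
    have h3 : i ∉ mo t x := by rw [mem_mo, hj]; rintro ⟨k, hk⟩; exact vert_not_OE hc hk
    have h4 : i ∉ mi t x := by rw [mem_mi, hj]; exact vert_not_S
    rw [h1, if_neg h3, if_neg h4]
    simp only [h2]
    generalize lab i j = l
    fin_cases l <;> simp
  · have h1 := am_edge hc hj
    have h2 : ∀ l, i ∉ cn t lab x l := by
      intro l; rw [mem_cn]; rintro ⟨k, hk, _⟩; rw [← hk] at hj; exact vert_not_OE hc hj
    have h3 : i ∈ mo t x := mem_mo.2 ⟨j, hj⟩
    have h4 : i ∉ mi t x := by rw [mem_mi]; exact fun h => OE_not_S hc hj h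
    rw [h1, if_pos h3, if_neg h4, if_neg (h2 _), if_neg (h2 _), if_neg (h2 _)]; ring
  · have h1 := am_int hj
    have h2 : ∀ l, i ∉ cn t lab x l := by
      intro l; rw [mem_cn]; rintro ⟨k, hk, _⟩; rw [← hk] at hj; exact vert_not_S hj
    have h3 : i ∉ mo t x := by rw [mem_mo]; rintro ⟨k, hk⟩; exact OE_not_S hc hk hj
    have h4 : i ∈ mi t x := mem_mi.2 hj
    rw [h1, if_neg h3, if_pos h4, if_neg (h2 _), if_neg (h2 _), if_neg (h2 _)]; ring
  · have h1 := am_out hj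
    have h2 : ∀ l, i ∉ cn t lab x l := by
      intro l; rw [mem_cn]; rintro ⟨k, hk, _⟩; rw [← hk] at hj; exact hj (vert_mem hc k)
    have h3 : i ∉ mo t x := by rw [mem_mo]; rintro ⟨k, hk⟩; exact hj (OE_mem hc hk)
    have h4 : i ∉ mi t x := by rw [mem_mi]; exact fun h => hj (SReg_sub h)
    rw [h1, if_neg h3, if_neg h4, if_neg (h2 _), if_neg (h2 _), if_neg (h2 _)]; ring

lemma LT.am_eq (T : LT N α β V t lab) (x : ℂ) :
    am V x = (((cn t lab x 0).card + 2 * (cn t lab x 2).card + 3 * (mo t x).card + 6 * (mi t x).card : ℕ) : ℝ) * α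
      + (((cn t lab x 1).card + (cn t lab x 2).card + 2 * (mo t x).card + 4 * (mi t x).card : ℕ) : ℝ) * β := by
  rw [← T.toTl.am_sum x]
  simp_rw [T.tile_am x]
  simp only [Finset.sum_add_distrib, Finset.sum_ite_mem, Finset.univ_inter, Finset.sum_const, nsmul_eq_mul]
  rw [← T.par.sum]
  push_cast; ring

lemma LT.cls (T : LT N α β V t lab) {x : ℂ} {i : Fin N} (h : x ∈ Reg (t i)) :
    (∃ l, i ∈ cn t lab x l) ∨ i ∈ mo t x ∨ i ∈ mi t x := by
  rcases am_class (T.ccw i) x with ⟨j, hj⟩ | ⟨j, hj⟩ | hj | hj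
  · exact Or.inl ⟨lab i j, mem_cn.2 ⟨j, hj.symm, rfl⟩⟩
  · exact Or.inr (Or.inl (mem_mo.2 ⟨j, hj⟩))
  · exact Or.inr (Or.inr (mem_mi.2 hj))
  · exact absurd h hj

lemma Fl_Reg {P : Fin 3 → ℂ} {x ζ : ℂ} {σ : ℝ} (h : Fl P x ζ σ) : x ∈ Reg P := by
  intro j
  rcases h j with h | ⟨h, _⟩
  · exact h.le
  · exact h.ge

/-- counting at a corner of V -/
lemma LT.corner (T : LT N α β V t lab) (k : Fin 3) {A : ℝ} (hA : IsAng V k A) :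
    (mo t (V k)).card = 0 ∧ (mi t (V k)).card = 0 ∧
    A = (((cn t lab (V k) 0).card + 2 * (cn t lab (V k) 2).card : ℕ) : ℝ) * α
      + (((cn t lab (V k) 1).card + (cn t lab (V k) 2).card : ℕ) : ℝ) * β := by
  have h := T.am_eq (V k)
  rw [am_vertex T.ccwV hA] at h
  have hp := hA.2.1
  rw [h, ← T.par.sum] at hp
  have a0 := T.par.a0
  have b0 := T.par.b0
  have key : (mo t (V k)).card = 0 ∧ (mi t (V k)).card = 0 := by
    by_contra hn
    have h1 : 1 ≤ (mo t (V k)).card + (mi t (V k)).card := by omega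
    have h2 : 3 ≤ (cn t lab (V k) 0).card + 2 * (cn t lab (V k) 2).card + 3 * (mo t (V k)).card + 6 * (mi t (V k)).card := by omega
    have h3 : 2 ≤ (cn t lab (V k) 1).card + (cn t lab (V k) 2).card + 2 * (mo t (V k)).card + 4 * (mi t (V k)).card := by omega
    have h2' : (3:ℝ) ≤ (((cn t lab (V k) 0).card + 2 * (cn t lab (V k) 2).card + 3 * (mo t (V k)).card + 6 * (mi t (V k)).card : ℕ) : ℝ) := by exact_mod_cast h2
    have h3' : (2:ℝ) ≤ (((cn t lab (V k) 1).card + (cn t lab (V k) 2).card + 2 * (mo t (V k)).card + 4 * (mi t (V k)).card : ℕ) : ℝ) := by exact_mod_cast h3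
    nlinarith
  refine ⟨key.1, key.2, ?_⟩
  rw [h, key.1, key.2]; simp

/-- counting at an open edge point of V -/
lemma LT.side (T : LT N α β V t lab) {k : Fin 3} {x : ℂ} (hx : OE V k x) :
    (cn t lab x 0).card + 2 * (cn t lab x 2).card + 3 * (mo t x).card + 6 * (mi t x).card = 3 ∧
    (cn t lab x 1).card + (cn t lab x 2).card + 2 * (mo t x).card + 4 * (mi t x).card = 2 := by
  have h := T.am_eq x
  rw [am_edge T.ccwV hx, ← T.par.sum] at h
  exact T.par.indN (by rw [← h]; push_cast; ring)
lemma LT.inner (T : LT N α β V t lab) {x : ℂ} (hx : x ∈ SReg V) :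
    (cn t lab x 0).card + 2 * (cn t lab x 2).card + 3 * (mo t x).card + 6 * (mi t x).card = 6 ∧
    (cn t lab x 1).card + (cn t lab x 2).card + 2 * (mo t x).card + 4 * (mi t x).card = 4 := by
  have h := T.am_eq x
  rw [am_int hx, ← T.par.sum] at h
  exact T.par.indN (by rw [← h]; push_cast; ring)
end
end TT

namespace TT
section
open Filter Topology

variable {N : ℕ} {α β : ℝ} {V : Fin 3 → ℂ} {t : Fin N → Fin 3 → ℂ} {lab : Fin N → Fin 3 → Fin 3}

lemma sum3 (f : Fin 3 → ℝ) (j : Fin 3) : ∑ k, f k = f j + f (j+1) + f (j+2) := by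
  rw [Fin.sum_univ_three]
  fin_cases j
  · rfl
  · show _ = f 1 + f 2 + f 0; ring
  · show _ = f 2 + f 0 + f 1; ring

lemma Par.singen {α β : ℝ} (h : Par α β) (l : Fin 3) : sin (af α β l) = kv α * lf (sv α) l := by
  fin_cases l
  · exact h.sina
  · exact h.sinb
  · show sin (2 * α + β) = kv α * 1
    rw [show 2 * α + β = π - (α + β) by linarith [h.sum], sin_pi_sub, h.sinab]; ring

lemma area_sum {P : Fin 3 → ℂ} (h : Ccw P) :
    ∑ j, ‖ed P j‖ * off P j = - cr (ed P 0) (ed P 1) := by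
  have : ∀ j, ‖ed P j‖ * off P j = cr (ed P j) (P j) := by
    intro j; unfold off; rw [← cr_smul_l, ← ed_dr h]
  simp_rw [this]
  rw [Fin.sum_univ_three]
  simp [ed, cr]; ring

lemma lab_cases {f : Fin 3 → Fin 3} (hf : Function.Injective f) (j : Fin 3) :
    (∃ j, f j = 0) ∧ f j ≠ f (j+1) ∧ f j ≠ f (j+2) ∧ f (j+1) ≠ f (j+2) := by
  refine ⟨(Finite.injective_iff_surjective.1 hf) 0, ?_, ?_, ?_⟩ <;>
  · intro h; have := hf h; revert this; fin_cases j <;> simp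

lemma LT.area (T : LT N α β V t lab) {A : Fin 3 → ℝ} (hA : ∀ j, IsAng V j (A j)) :
    N * (kv α * (sv α * (1 - sv α ^ 2))) = ‖ed V 0‖ * ‖ed V 1‖ * sin (A 1) := by
  have h := T.toTl.edges (fun _ o => o) (by intros; ring)
  simp only [area_sum T.ccwV, fun i => area_sum (T.ccw i)] at h
  have hV : cr (ed V 0) (ed V 1) = ‖ed V 0‖*‖ed V 1‖*sin (A 1) := cr_adj (j := 0) T.ccwV (hA 1)
  rw [hV] at h
  have : ∀ i, cr (ed (t i) 0) (ed (t i) 1) = kv α * (sv α * (1 - sv α ^ 2)) := by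
    intro i
    have h1 := cr_adj (j := 0) (T.ccw i) (T.ang i 1)
    rw [T.len, T.len, T.par.singen] at h1
    rw [show (0:Fin 3) + 1 = 1 from rfl] at h1
    rw [h1]
    rw [show (0:Fin 3) + 2 = 2 from rfl, show (1:Fin 3) + 2 = 0 from rfl]
    obtain ⟨_, h2, h3, h4⟩ := lab_cases (T.inj i) 0
    rw [show (0:Fin 3) + 1 = 1 from rfl] at h2 h4
    rw [show (0:Fin 3) + 2 = 2 from rfl] at h3 h4
    revert h2 h3 h4
    generalize lab i 0 = x; generalize lab i 1 = y; generalize lab i 2 = z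
    fin_cases x <;> fin_cases y <;> fin_cases z <;> simp <;> ring
  simp only [this] at h
  rw [Finset.sum_const] at h
  simp at h
  exact h

/-! colorings -/
open Classical in
def wt (ζ0 z : ℂ) (ε : ℝ) (ζ : ℂ) : ℝ :=
  if h : ∃ k : ℤ, ζ = ζ0 * z ^ k then ε ^ (Classical.choose h)
  else if h : ∃ k : ℤ, -ζ = ζ0 * z ^ k then - ε ^ (Classical.choose h) else 0

section
variable {ζ0 z : ℂ} {ε : ℝ}

lemma wt_uniq (h0 : ζ0 ≠ 0) (hz0 : z ≠ 0) (hz : ∀ k : ℤ, z ^ k = 1 ∨ z ^ k = -1 → k = 0)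
    {k m : ℤ} (h : ζ0 * z ^ k = ζ0 * z ^ m) : k = m := by
  have := mul_left_cancel₀ h0 h
  have : k - m = 0 := hz _ (Or.inl (by rw [zpow_sub₀ hz0, this]; exact div_self (zpow_ne_zero _ hz0)))
  omega

lemma wt_pos (h0 : ζ0 ≠ 0) (hz0 : z ≠ 0) (hz : ∀ k : ℤ, z ^ k = 1 ∨ z ^ k = -1 → k = 0) (k : ℤ) :
    wt ζ0 z ε (ζ0 * z ^ k) = ε ^ k := by
  have h : ∃ m : ℤ, ζ0 * z ^ k = ζ0 * z ^ m := ⟨k, rfl⟩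
  unfold wt
  rw [dif_pos h, ← wt_uniq h0 hz0 hz (Classical.choose_spec h)]

lemma wt_neg (h0 : ζ0 ≠ 0) (hz0 : z ≠ 0) (hz : ∀ k : ℤ, z ^ k = 1 ∨ z ^ k = -1 → k = 0) (k : ℤ) :
    wt ζ0 z ε (-(ζ0 * z ^ k)) = - ε ^ k := by
  have hn : ¬ ∃ m : ℤ, -(ζ0 * z ^ k) = ζ0 * z ^ m := by
    rintro ⟨m, hm⟩
    have h1 : - z ^ k = z ^ m := mul_left_cancel₀ h0 (by linear_combination hm)
    have h2 : z ^ (m - k) = -1 := by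
      rw [zpow_sub₀ hz0, ← h1, neg_div, div_self (zpow_ne_zero _ hz0)]
    have h3 := hz _ (Or.inr h2)
    rw [h3] at h2; norm_num at h2
  have h : ∃ m : ℤ, -(-(ζ0 * z ^ k)) = ζ0 * z ^ m := ⟨k, neg_neg _⟩
  unfold wt
  rw [dif_neg hn, dif_pos h]
  have := (neg_neg _).symm.trans (Classical.choose_spec h)
  rw [← wt_uniq h0 hz0 hz this]

lemma wt_zero {ζ : ℂ} (h1 : ¬ ∃ k : ℤ, ζ = ζ0 * z ^ k) (h2 : ¬ ∃ k : ℤ, ζ = -(ζ0 * z ^ k)) :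
    wt ζ0 z ε ζ = 0 := by
  have h3 : ¬ ∃ k : ℤ, -ζ = ζ0 * z ^ k := by
    rintro ⟨k, hk⟩; exact h2 ⟨k, by rw [← hk]; ring⟩
  unfold wt; rw [dif_neg h1, dif_neg h3]

lemma wt_odd (h0 : ζ0 ≠ 0) (hz0 : z ≠ 0) (hz : ∀ k : ℤ, z ^ k = 1 ∨ z ^ k = -1 → k = 0) (ζ : ℂ) :
    wt ζ0 z ε (-ζ) = - wt ζ0 z ε ζ := by
  by_cases h1 : ∃ k : ℤ, ζ = ζ0 * z ^ k
  · obtain ⟨k, rfl⟩ := h1; rw [wt_pos h0 hz0 hz, wt_neg h0 hz0 hz]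
  by_cases h2 : ∃ k : ℤ, ζ = -(ζ0 * z ^ k)
  · obtain ⟨k, rfl⟩ := h2; rw [neg_neg, wt_pos h0 hz0 hz, wt_neg h0 hz0 hz]; ring
  rw [wt_zero h1 h2, wt_zero, neg_zero]
  · rintro ⟨k, hk⟩; exact h2 ⟨k, by rw [← hk]; ring⟩
  · rintro ⟨k, hk⟩; exact h1 ⟨k, by linear_combination -hk⟩

lemma wt_mul (h0 : ζ0 ≠ 0) (hz0 : z ≠ 0) (hz : ∀ k : ℤ, z ^ k = 1 ∨ z ^ k = -1 → k = 0) (he : ε ≠ 0) (ζ : ℂ) :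
    wt ζ0 z ε (ζ * z) = ε * wt ζ0 z ε ζ := by
  by_cases h1 : ∃ k : ℤ, ζ = ζ0 * z ^ k
  · obtain ⟨k, rfl⟩ := h1
    rw [wt_pos h0 hz0 hz, mul_assoc, ← zpow_add_one₀ hz0, wt_pos h0 hz0 hz, zpow_add_one₀ he]; ring
  by_cases h2 : ∃ k : ℤ, ζ = -(ζ0 * z ^ k)
  · obtain ⟨k, rfl⟩ := h2
    rw [wt_neg h0 hz0 hz, neg_mul, mul_assoc, ← zpow_add_one₀ hz0, wt_neg h0 hz0 hz, zpow_add_one₀ he]; ring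
  rw [wt_zero h1 h2, wt_zero, mul_zero]
  · rintro ⟨k, hk⟩; exact h1 ⟨k - 1, by rw [zpow_sub_one₀ hz0, ← mul_assoc, ← hk]; field_simp⟩
  · rintro ⟨k, hk⟩; exact h2 ⟨k - 1, by
      rw [zpow_sub_one₀ hz0, ← mul_assoc, ← neg_mul, ← hk]; field_simp⟩

lemma wt_val (h0 : ζ0 ≠ 0) (hz0 : z ≠ 0) (hz : ∀ k : ℤ, z ^ k = 1 ∨ z ^ k = -1 → k = 0)
    (he : ε = 1 ∨ ε = -1) (ζ : ℂ) :
    ∃ m : ℤ, |m| ≤ 1 ∧ wt ζ0 z ε ζ = m := by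
  have hk : ∀ k : ℤ, ε ^ k = 1 ∨ ε ^ k = -1 := by
    intro k
    rcases he with rfl | rfl
    · left; simp
    · rcases Int.even_or_odd k with h | h
      · left; exact h.neg_one_zpow
      · right; exact h.neg_one_zpow
  by_cases h1 : ∃ k : ℤ, ζ = ζ0 * z ^ k
  · obtain ⟨k, rfl⟩ := h1
    rw [wt_pos h0 hz0 hz]
    rcases hk k with h | h
    · exact ⟨1, by simp, by simp [h]⟩
    · exact ⟨-1, by simp, by simp [h]⟩
  by_cases h2 : ∃ k : ℤ, ζ = -(ζ0 * z ^ k)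
  · obtain ⟨k, rfl⟩ := h2
    rw [wt_neg h0 hz0 hz]
    rcases hk k with h | h
    · exact ⟨-1, by simp, by simp [h]⟩
    · exact ⟨1, by simp, by simp [h]⟩
  exact ⟨0, by simp, by rw [wt_zero h1 h2]; simp⟩
end

lemma Par.zpow {α β : ℝ} (h : Par α β) (k : ℤ) (hk : cs (α + β) ^ k = 1 ∨ cs (α + β) ^ k = -1) : k = 0 := by
  have e : cs (α + β) ^ k = cs (k * (α + β)) := by
    rw [cs_exp, cs_exp, ← Complex.exp_int_mul]; push_cast; ring_nf
  rw [e] at hk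
  have hs : sin (k * (α + β)) = 0 := by
    rcases hk with hk | hk <;> · have := congrArg Complex.im hk; simpa using this
  obtain ⟨n, hn⟩ := sin_eq_zero_iff.1 hs
  rw [← h.sum] at hn
  have := h.ind (m := k - 3 * n) (n := k - 2 * n) (by push_cast; linarith)
  omega

theorem LT.color0 (T : LT N α β V t lab) {ε : ℝ} (he : ε = 1 ∨ ε = -1) :
    ∃ w : ℂ → ℝ, (∀ ζ, w (-ζ) = - w ζ) ∧ (∀ ζ, w (ζ * cs α) = - w ζ) ∧
      (∀ ζ, w (ζ * cs β) = - (ε * w ζ)) ∧ w (dr V 0) = 1 ∧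
      ∃ M : ℤ, |M| ≤ N ∧ ∑ j, ‖ed V j‖ * w (dr V j) = M * (ε * sv α + (1 - sv α ^ 2) + 1) := by
  have h0 : dr V 0 ≠ 0 := by intro h; have := norm_dr T.ccwV 0; rw [h] at this; simp at this
  have hz0 := cs_ne (α + β)
  have hz := T.par.zpow
  have he0 : ε ≠ 0 := by rcases he with rfl | rfl <;> norm_num
  have he2 : ε * ε = 1 := by rcases he with rfl | rfl <;> norm_num
  set w := wt (dr V 0) (cs (α + β)) ε with hw
  have odd : ∀ ζ, w (-ζ) = - w ζ := wt_odd h0 hz0 hz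
  have mul : ∀ ζ, w (ζ * cs (α + β)) = ε * w ζ := wt_mul h0 hz0 hz he0
  have hα : ∀ ζ, w (ζ * cs α) = - w ζ := by
    intro ζ
    have h1 : w (ζ * cs α * cs (α + β) * cs (α + β)) = w (-ζ) := by
      congr 1
      have : cs α * cs (α + β) * cs (α + β) = -1 := by
        rw [← cs_add, ← cs_add, ← cs_pi]; congr 1; linarith [T.par.sum]
      linear_combination ζ * this
    rw [mul, mul, odd, ← mul_assoc, he2] at h1; linarith
  have hβ : ∀ ζ, w (ζ * cs β) = - (ε * w ζ) := by
    intro ζ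
    have h1 : w (ζ * cs β) = w (-(ζ * cs (α + β) * cs (α + β) * cs (α + β))) := by
      congr 1
      have : cs (α + β) * cs (α + β) * cs (α + β) = - cs β := by
        rw [← cs_add, ← cs_add, ← mul_neg_one, ← cs_pi, ← cs_add]; congr 1; linarith [T.par.sum]
      linear_combination ζ * this
    rw [odd, mul, mul, mul, ← mul_assoc ε, he2] at h1; linarith
  have hγ : ∀ ζ, w (ζ * cs (2 * α + β)) = - (ε * w ζ) := by
    intro ζ
    rw [show 2 * α + β = α + α + β by ring, cs_add, cs_add, ← mul_assoc, ← mul_assoc, hβ, hα, hα]; ring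
  refine ⟨w, odd, hα, hβ, ?_, ?_⟩
  · have := wt_pos (ε := ε) h0 hz0 hz 0
    simpa using this
  · have key : ∀ i, ∃ m : ℤ, |m| ≤ 1 ∧ ∑ j, ‖ed (t i) j‖ * w (dr (t i) j) = m * (ε * sv α + (1 - sv α ^ 2) + 1) := by
      intro i
      obtain ⟨j, hj⟩ := (lab_cases (T.inj i) 0).1
      obtain ⟨_, n1, n2, n3⟩ := lab_cases (T.inj i) j
      obtain ⟨m, hm, hwm0⟩ := wt_val (ε := ε) h0 hz0 hz he (dr (t i) j)
      have hwm : w (dr (t i) j) = m := hwm0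
      refine ⟨m, hm, ?_⟩
      have a0 : w (dr (t i) (j+2)) = m := by
        have := (T.ang i j).2.2
        rw [hj, af0] at this
        have := congrArg w this
        rw [odd, hα] at this
        rw [← hwm]; linarith
      have a1 : ∀ A, (∀ ζ, w (ζ * cs A) = - (ε * w ζ)) → af α β (lab i (j+1)) = A → w (dr (t i) (j+1)) = ε * m := by
        intro A hA e
        have := (T.ang i (j+1)).2.2
        rw [e, f11] at this
        have := congrArg w this
        rw [odd, hA] at this
        have h5 : w (dr (t i) j) = ε * w (dr (t i) (j+1)) := by linarith
        rw [show (m:ℝ) = w (dr (t i) j) from hwm.symm, h5, ← mul_assoc, he2, one_mul]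
      rw [sum3 _ j, a0, hwm]
      simp only [T.len, f11, f22]
      rw [hj] at n1 n2 ⊢
      have : ∀ x : Fin 3, 0 ≠ x → x = 1 ∨ x = 2 := by decide
      rcases this _ n1 with h1 | h1 <;> rcases this _ n2 with h2 | h2
      · exact absurd (h1.trans h2.symm) n3
      · rw [a1 β hβ (by rw [h1]; rfl), h1, h2]; simp; ring
      · rw [a1 _ hγ (by rw [h1]; rfl), h1, h2]; simp; ring
      · exact absurd (h1.trans h2.symm) n3
    choose m hm1 hm2 using key
    refine ⟨∑ i, m i, ?_, ?_⟩
    · calc |∑ i, m i| ≤ ∑ i, |m i| := Finset.abs_sum_le_sum_abs _ _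
        _ ≤ ∑ i : Fin N, 1 := Finset.sum_le_sum (fun i _ => hm1 i)
        _ = N := by simp
    · have := T.toTl.edges (fun ζ _ => w ζ) (fun ζ _ => odd ζ)
      rw [← this]
      simp only [hm2]
      push_cast; rw [Finset.sum_mul]

theorem LT.color (T : LT N α β V t lab) {p q : Fin 3 → ℕ}
    (hA : ∀ k, IsAng V k (p k * α + q k * β)) {ε : ℝ} (he : ε = 1 ∨ ε = -1) :
    ∃ M : ℤ, |M| ≤ N ∧ ‖ed V 0‖ - (-1) ^ (p 1 + q 1) * ε ^ (q 1) * ‖ed V 1‖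
      - (-1) ^ (p 0 + q 0) * ε ^ (q 0) * ‖ed V 2‖ = M * (ε * sv α + (1 - sv α ^ 2) + 1) := by
  obtain ⟨w, odd, hα, hβ, h1, M, hM, e⟩ := T.color0 he
  refine ⟨M, hM, ?_⟩
  have hp : ∀ (n : ℕ) ζ, w (ζ * cs (n * α)) = (-1) ^ n * w ζ := by
    intro n; induction n with
    | zero => intro ζ; simp [cs_zero]
    | succ n ih => intro ζ; push_cast; rw [add_mul, one_mul, cs_add, ← mul_assoc, hα, ih]; ring
  have hq : ∀ (n : ℕ) ζ, w (ζ * cs (n * β)) = (-1) ^ n * ε ^ n * w ζ := by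
    intro n; induction n with
    | zero => intro ζ; simp [cs_zero]
    | succ n ih => intro ζ; push_cast; rw [add_mul, one_mul, cs_add, ← mul_assoc, hβ, ih]; ring
  have hc : ∀ k, - w (dr V (k+2)) = (-1) ^ (p k + q k) * ε ^ (q k) * w (dr V k) := by
    intro k
    have := congrArg w (hA k).2.2
    rw [odd, cs_add, ← mul_assoc, hq, hp] at this
    rw [this]; ring
  have c0 : - w (dr V 2) = (-1) ^ (p 0 + q 0) * ε ^ (q 0) * w (dr V 0) := hc 0
  have c1 : - w (dr V 0) = (-1) ^ (p 1 + q 1) * ε ^ (q 1) * w (dr V 1) := hc 1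
  have sg : ∀ n : ℕ, ((-1:ℝ) ^ n) * (-1) ^ n = 1 := by intro n; rw [← mul_pow]; simp
  have sg2 : ∀ n : ℕ, ε ^ n * ε ^ n = 1 := by
    intro n; rw [← mul_pow]; rcases he with rfl | rfl <;> simp
  have c1' : w (dr V 1) = - ((-1) ^ (p 1 + q 1) * ε ^ (q 1)) := by
    rw [h1] at c1
    have hs := sg (p 1 + q 1)
    have hs2 := sg2 (q 1)
    linear_combination (-((-1) ^ (p 1 + q 1) * ε ^ (q 1))) * c1 - w (dr V 1) * hs * (ε ^ q 1 * ε ^ q 1) - w (dr V 1) * hs2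
  rw [h1] at c0
  rw [← e, Fin.sum_univ_three, h1, c1', show w (dr V 2) = - ((-1) ^ (p 0 + q 0) * ε ^ (q 0)) by linarith]
  ring
end
end TT

namespace TT
section
open Filter Topology

variable {N : ℕ} {α β : ℝ} {V : Fin 3 → ℂ} {t : Fin N → Fin 3 → ℂ} {lab : Fin N → Fin 3 → Fin 3}

def pt (V : Fin 3 → ℂ) (k : Fin 3) (u : ℝ) : ℂ := V k + u * dr V k
/-- edge j of P lies along side k of V starting at parameter u -/
def Sd (V P : Fin 3 → ℂ) (k : Fin 3) (u : ℝ) (j : Fin 3) : Prop :=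
  P j = pt V k u ∧ dr P j = dr V k

lemma pt_zero : pt V k 0 = V k := by simp [pt]
lemma pt_end (h : Ccw V) (k : Fin 3) : pt V k ‖ed V k‖ = V (k+1) := by
  unfold pt; rw [← ed_dr h]; unfold ed; ring

lemma next_pt {P : Fin 3 → ℂ} (h : Ccw P) (j : Fin 3) : P (j+1) = P j + ‖ed P j‖ * dr P j := by
  rw [← ed_dr h]; unfold ed; ring

lemma sd_end {P : Fin 3 → ℂ} (h : Ccw P) {k j : Fin 3} {u : ℝ} (hs : Sd V P k u j) :
    P (j+1) = pt V k (u + ‖ed P j‖) := by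
  rw [next_pt h, hs.1, hs.2]; unfold pt; push_cast; ring

lemma OE_of {P : Fin 3 → ℂ} (h : Ccw P) {j : Fin 3} {x : ℂ} {τ : ℝ} (h0 : 0 < τ) (h1 : τ < ‖ed P j‖)
    (hx : x = P j + τ * dr P j) : OE P j x := by
  have hp := ed_pos h j
  refine ⟨τ / ‖ed P j‖, by positivity, by rwa [div_lt_one hp], ?_⟩
  have h2 : (‖ed P j‖ : ℂ) ≠ 0 := by exact_mod_cast hp.ne'
  have h3 := ed_dr h j
  have h4 : ((τ / ‖ed P j‖ : ℝ) : ℂ) * ed P j = τ * dr P j := by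
    generalize ‖ed P j‖ = L at *
    rw [h3]; push_cast; field_simp
  rw [hx, h4]

lemma sd_OE {P : Fin 3 → ℂ} (h : Ccw P) {k j : Fin 3} {u v : ℝ} (hs : Sd V P k u j)
    (h0 : u < v) (h1 : v < u + ‖ed P j‖) : OE P j (pt V k v) := by
  refine OE_of h (τ := v - u) (by linarith) (by linarith) ?_
  rw [hs.1, hs.2]; unfold pt; push_cast; ring

lemma pt_OE (h : Ccw V) {k : Fin 3} {u : ℝ} (h0 : 0 < u) (h1 : u < ‖ed V k‖) : OE V k (pt V k u) :=
  OE_of h h0 h1 rfl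

lemma up_of {P : Fin 3 → ℂ} (h : Ccw P) {j : Fin 3} {x ζ : ℂ} {τ : ℝ} (hd : dr P j = ζ)
    (h0 : 0 ≤ τ) (h1 : τ < ‖ed P j‖) (hx : x = P j + τ * ζ) : Up P j ζ x :=
  ⟨‖ed P j‖, ed_pos h j, by rw [← hd]; exact ed_dr h j, τ, h0, h1, hx⟩

lemma dr_ne {P : Fin 3 → ℂ} (h : Ccw P) (j : Fin 3) : dr P j ≠ 0 := by
  intro h0; have := norm_dr h j; rw [h0] at this; simp at this

lemma Tl.sd_ex0 (T : Tl N V t) {k : Fin 3} {u : ℝ} (h0 : 0 ≤ u) (h1 : u < ‖ed V k‖) :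
    ∃ i j, ∃ τ : ℝ, 0 ≤ τ ∧ τ < ‖ed (t i) j‖ ∧ dr (t i) j = dr V k ∧ pt V k u = t i j + τ * dr V k := by
  have hne := dr_ne T.ccwV k
  obtain ⟨g1, g2⟩ := up_fl T.ccwV (up_of T.ccwV (j := k) (x := pt V k u) rfl h0 h1 rfl)
  obtain ⟨i, hi⟩ := (T.fl_ex hne one_ne_zero).1 g1
  have hn : ¬ Fl (t i) (pt V k u) (dr V k) (-1) := fun h =>
    g2 ((T.fl_ex hne (by norm_num)).2 ⟨i, h⟩)
  obtain ⟨j, l, hl, he, τ, t0, t1, ht⟩ := fl_up (T.ccw i) hne hi hn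
  obtain ⟨e1, e2⟩ := dr_of (T.ccw i) hl (norm_dr T.ccwV k) he
  exact ⟨i, j, τ, t0, by rw [e2]; exact t1, e1, ht⟩

lemma Tl.sd_ex (T : Tl N V t) {k : Fin 3} {u : ℝ} (h0 : 0 ≤ u) (h1 : u < ‖ed V k‖)
    (hm : mo t (pt V k u) = ∅) : ∃ i j, Sd V (t i) k u j := by
  obtain ⟨i, j, τ, t0, t1, e1, ht⟩ := T.sd_ex0 h0 h1
  rcases t0.eq_or_lt with h | h
  · refine ⟨i, j, ?_, e1⟩
    rw [ht, ← h]; simp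
  · exfalso
    have : i ∈ mo t (pt V k u) := mem_mo.2 ⟨j, OE_of (T.ccw i) h t1 (by rw [ht, e1])⟩
    rw [hm] at this; simp at this

lemma LT.side_mo (T : LT N α β V t lab) {k : Fin 3} {x : ℂ} (hx : OE V k x) {i : Fin N} {j : Fin 3}
    (h : t i j = x) : mo t x = ∅ := by
  obtain ⟨h1, h2⟩ := T.side hx
  have : i ∈ cn t lab x (lab i j) := mem_cn.2 ⟨j, h, rfl⟩
  have hc := Finset.card_pos.2 ⟨i, this⟩
  rw [← Finset.card_eq_zero]
  have : ∀ l : Fin 3, 0 < (cn t lab x l).card → (mo t x).card = 0 := by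
    intro l hl
    have : l = 0 ∨ l = 1 ∨ l = 2 := by clear hl; revert l; decide
    rcases this with rfl | rfl | rfl <;> omega
  exact this _ hc

lemma LT.corner_mo (T : LT N α β V t lab) (k : Fin 3) : mo t (V k) = ∅ := by
  obtain ⟨A, hA⟩ := ang_ex T.ccwV k
  exact Finset.card_eq_zero.1 (T.corner k hA).1

lemma LT.side_gg (T : LT N α β V t lab) {k : Fin 3} {x : ℂ} (hx : OE V k x) {i i' : Fin N} {j j' : Fin 3}
    (h : t i j = x) (h' : t i' j' = x) (g : lab i j = 2) (g' : lab i' j' = 2) : i = i' := by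
  obtain ⟨h1, h2⟩ := T.side hx
  have a1 : i ∈ cn t lab x 2 := mem_cn.2 ⟨j, h, g⟩
  have a2 : i' ∈ cn t lab x 2 := mem_cn.2 ⟨j', h', g'⟩
  exact Finset.card_le_one.1 (by omega) _ a1 _ a2

lemma sd_ne {P : Fin 3 → ℂ} (h : Ccw P) {k j j' : Fin 3} {u v : ℝ} (hs : Sd V P k u j) (hs' : Sd V P k v j') : j = j' := by
  have e1 := ed_dr h j; have e2 := ed_dr h j'
  rw [hs.2] at e1; rw [hs'.2] at e2
  exact par_uniq h e1 e2

lemma LT.side_mo_sd (T : LT N α β V t lab) {k : Fin 3} {u : ℝ} (u0 : 0 ≤ u) (hu : u + ‖ed (t i) j‖ ≤ ‖ed V k‖)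
    (h : Sd V (t i) k u j) : mo t (pt V k (u + ‖ed (t i) j‖)) = ∅ := by
  rcases hu.lt_or_eq with h1 | h1
  · exact T.side_mo (pt_OE T.ccwV (by linarith [ed_pos (T.ccw i) j]) h1) (sd_end (T.ccw i) h)
  · rw [h1, pt_end T.ccwV]; exact T.corner_mo _

lemma LT.sd_le (T : LT N α β V t lab) {k : Fin 3} {u Y : ℝ} (hY : mo t (pt V k Y) = ∅) (hu : u < Y)
    (h : Sd V (t i) k u j) : u + ‖ed (t i) j‖ ≤ Y := by
  by_contra hn
  push Not at hn
  have : i ∈ mo t (pt V k Y) := mem_mo.2 ⟨j, sd_OE (T.ccw i) h hu hn⟩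
  rw [hY] at this; simp at this

lemma Par.lf_min {α β : ℝ} (h : Par α β) (l : Fin 3) : min (sv α) (1 - sv α ^ 2) ≤ lf (sv α) l := by
  have := h.s0; have := h.s1
  fin_cases l <;> simp
  right; positivity

/-- length of a chain -/
lemma LT.form0 (T : LT N α β V t lab) {k : Fin 3} {Y : ℝ} (hY : mo t (pt V k Y) = ∅) (hYX : Y ≤ ‖ed V k‖) (n : ℕ) :
    ∀ u, 0 ≤ u → u ≤ Y → mo t (pt V k u) = ∅ → Y - u ≤ n * min (sv α) (1 - sv α ^ 2) →
    ∃ p q r : ℕ, Y - u = p * sv α + q * (1 - sv α ^ 2) + r := by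
  have hm : 0 < min (sv α) (1 - sv α ^ 2) := by
    have := T.par.s0; have := T.par.s1
    refine lt_min (by assumption) (by nlinarith)
  induction n with
  | zero => intro u _ h1 _ h2; exact ⟨0, 0, 0, by simp at h2 ⊢; linarith⟩
  | succ n ih =>
    intro u h0 h1 hu h2
    rcases h1.eq_or_lt with h1 | h1
    · exact ⟨0, 0, 0, by simp; linarith⟩
    obtain ⟨i, j, hs⟩ := T.toTl.sd_ex h0 (lt_of_lt_of_le h1 hYX) hu
    have hle := T.sd_le hY h1 hs
    have hmin := T.par.lf_min (lab i (j+2))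
    have hlen := T.len i j
    obtain ⟨p, q, r, e⟩ := ih _ (by linarith [ed_pos (T.ccw i) j]) hle (T.side_mo_sd h0 (hle.trans hYX) hs)
      (by push_cast at h2; rw [hlen]; linarith)
    rw [hlen] at e
    revert e
    generalize lab i (j+2) = l
    intro e
    fin_cases l <;> simp at e
    · exact ⟨p+1, q, r, by push_cast; linarith⟩
    · exact ⟨p, q+1, r, by push_cast; linarith⟩
    · exact ⟨p, q, r+1, by push_cast; linarith⟩

lemma fin3_lab {f : Fin 3 → Fin 3} (hf : Function.Injective f) (j : Fin 3) (h : f (j+2) ≠ 2) (h' : f j ≠ 2) :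
    f (j+1) = 2 := by
  obtain ⟨_, h1, h2, h3⟩ := lab_cases hf j
  revert h h' h1 h2 h3
  generalize f j = x; generalize f (j+1) = y; generalize f (j+2) = z
  revert x y z; decide

lemma LT.form1 (T : LT N α β V t lab) {k : Fin 3} {Y : ℝ} (hY : mo t (pt V k Y) = ∅) (hYX : Y ≤ ‖ed V k‖) (n : ℕ) :
    ∀ u, 0 ≤ u → u < Y → mo t (pt V k u) = ∅ → Y - u ≤ n * min (sv α) (1 - sv α ^ 2) →
    (∀ i j, Sd V (t i) k u j → lab i j ≠ 2) →
    (∃ p q r : ℕ, Y - u = p * sv α + q * (1 - sv α ^ 2) + r ∧ 1 ≤ r) ∨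
    (∃ i j v, Sd V (t i) k v j ∧ v + ‖ed (t i) j‖ = Y ∧ lab i (j+1) = 2) := by
  have hm : 0 < min (sv α) (1 - sv α ^ 2) := by
    have := T.par.s0; have := T.par.s1
    refine lt_min (by assumption) (by nlinarith)
  induction n with
  | zero => intro u _ h1 _ h2; simp at h2; linarith
  | succ n ih =>
    intro u h0 h1 hu h2 hg
    obtain ⟨i, j, hs⟩ := T.toTl.sd_ex h0 (lt_of_lt_of_le h1 hYX) hu
    have hle := T.sd_le hY h1 hs
    have hmin := T.par.lf_min (lab i (j+2))
    have hlen := T.len i j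
    have hp := ed_pos (T.ccw i) j
    have hmo := T.side_mo_sd h0 (hle.trans hYX) hs
    by_cases hc : lab i (j+2) = 2
    · left
      obtain ⟨p, q, r, e⟩ := T.form0 hY hYX n _ (by linarith) hle hmo
        (by push_cast at h2; rw [hlen]; linarith)
      rw [hlen, hc] at e; simp at e
      exact ⟨p, q, r+1, by push_cast; linarith, by omega⟩
    · have hg1 : lab i (j+1) = 2 := fin3_lab (T.inj i) j hc (hg i j hs)
      rcases hle.eq_or_lt with h3 | h3
      · right; exact ⟨i, j, u, hs, h3, hg1⟩
      have := ih _ (by linarith) h3 hmo (by push_cast at h2; rw [hlen]; linarith) (by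
        intro i' j' hs' hl'
        have := T.side_gg (pt_OE T.ccwV (k := k) (u := u + ‖ed (t i) j‖) (by linarith) (by linarith))
          (sd_end (T.ccw i) hs) hs'.1 hg1 hl'
        subst this
        have := sd_ne (T.ccw i) hs hs'
        subst this
        have h5 := vert_inj (T.ccw i) (hs'.1.trans (sd_end (T.ccw i) hs).symm)
        revert h5; clear * -; fin_cases j <;> simp)
      rcases this with ⟨p, q, r, e, hr⟩ | h
      · left
        rw [hlen] at e
        revert e hc
        generalize lab i (j+2) = l
        intro hc e
        fin_cases l <;> simp at e hc
        · exact ⟨p+1, q, r, by push_cast; linarith, hr⟩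
        · exact ⟨p, q+1, r, by push_cast; linarith, hr⟩
      · exact Or.inr h

lemma Par.nb {α β : ℝ} (h : Par α β) (x : ℝ) : ∃ n : ℕ, x ≤ n * min (sv α) (1 - sv α ^ 2) := by
  have hm : 0 < min (sv α) (1 - sv α ^ 2) := by
    have := h.s0; have := h.s1
    refine lt_min (by assumption) (by nlinarith)
  obtain ⟨n, hn⟩ := exists_nat_ge (x / min (sv α) (1 - sv α ^ 2))
  exact ⟨n, by rwa [div_le_iff₀ hm] at hn⟩

lemma LT.no_g (T : LT N α β V t lab) {k : Fin 3} (h : cn t lab (V k) 2 = ∅) {i : Fin N} {j : Fin 3} (e : t i j = V k) :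
    lab i j ≠ 2 := by
  intro hl
  have : i ∈ cn t lab (V k) 2 := mem_cn.2 ⟨j, e, hl⟩
  rw [h] at this; simp at this

lemma LT.side_form (T : LT N α β V t lab) (hg : ∀ k, cn t lab (V k) 2 = ∅) (k : Fin 3) :
    ∃ p q r : ℕ, ‖ed V k‖ = p * sv α + q * (1 - sv α ^ 2) + r ∧ 1 ≤ r := by
  obtain ⟨n, hn⟩ := T.par.nb (‖ed V k‖ - 0)
  have e := T.form1 (k := k) (Y := ‖ed V k‖) (by rw [pt_end T.ccwV]; exact T.corner_mo _) le_rfl n 0 le_rfl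
    (ed_pos T.ccwV k) (by rw [pt_zero]; exact T.corner_mo _) hn
    (fun i j hs => T.no_g (hg k) (by rw [hs.1, pt_zero]))
  simp only [sub_zero] at e
  rcases e with e | ⟨i, j, v, hs, e1, e2⟩
  · exact e
  · exfalso
    refine T.no_g (hg (k+1)) ?_ e2
    rw [sd_end (T.ccw i) hs, e1, pt_end T.ccwV]
end
end TT

namespace TT
section
open Filter Topology

variable {N : ℕ} {α β : ℝ} {V : Fin 3 → ℂ} {t : Fin N → Fin 3 → ℂ} {lab : Fin N → Fin 3 → Fin 3}

def rt {X : Type} (V : Fin 3 → X) : Fin 3 → X := fun j => V (j+1)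

lemma ed_rt (V : Fin 3 → ℂ) (j : Fin 3) : ed (rt V) j = ed V (j+1) := rfl
lemma dr_rt (V : Fin 3 → ℂ) (j : Fin 3) : dr (rt V) j = dr V (j+1) := rfl
lemma ccw_rt (h : Ccw V) : Ccw (rt V) := ccw_rot h 1
lemma all_rt (p : Fin 3 → Prop) : (∀ j, p (j+1)) ↔ ∀ j, p j := by
  constructor
  · intro h j; have := h (j+2); rwa [f21] at this
  · intro h j; exact h _
lemma Reg_rt (x : ℂ) : x ∈ Reg (rt V) ↔ x ∈ Reg V :=
  all_rt (fun j => 0 ≤ cr (ed V j) (x - V j))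
lemma ang_rt {j : Fin 3} {A : ℝ} : IsAng (rt V) j A ↔ IsAng V (j+1) A := by
  unfold IsAng; rw [dr_rt, dr_rt, f21, f11]

lemma LT.rot (T : LT N α β V t lab) : LT N α β (rt V) t lab where
  ccwV := ccw_rt T.ccwV
  ccw := T.ccw
  disj := T.disj
  cover := fun x => by rw [Reg_rt]; exact T.cover x
  par := T.par
  inj := T.inj
  ang := T.ang
  len := T.len

def cj (P : Fin 3 → ℂ) : Fin 3 → ℂ := fun j => (starRingEnd ℂ) (P (-j))
lemma fneg1 (j : Fin 3) : -(j+1) = -j+2 := by revert j; decide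
lemma fneg2 (j : Fin 3) : -(j+2) = -j+1 := by revert j; decide
lemma fneg3 (j : Fin 3) : -(j+2)+2 = -j := by revert j; decide
lemma ed_cj (P : Fin 3 → ℂ) (j : Fin 3) : ed (cj P) j = -(starRingEnd ℂ) (ed P (-j+2)) := by
  unfold ed cj; rw [fneg1, f21]; simp
lemma dr_cj (P : Fin 3 → ℂ) (j : Fin 3) : dr (cj P) j = -(starRingEnd ℂ) (dr P (-j+2)) := by
  unfold dr; rw [ed_cj]; simp
lemma cr_conj (u v : ℂ) : cr ((starRingEnd ℂ) u) ((starRingEnd ℂ) v) = - cr u v := by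
  simp [cr]; ring
lemma cr_cj (P : Fin 3 → ℂ) (x : ℂ) (j : Fin 3) :
    cr (ed (cj P) j) (x - cj P j) = cr (ed P (-j+2)) ((starRingEnd ℂ) x - P (-j+2)) := by
  have h1 : x - cj P j = (starRingEnd ℂ) ((starRingEnd ℂ) x - P (-j)) := by unfold cj; simp
  have h2 : (starRingEnd ℂ) x - P (-j) = ((starRingEnd ℂ) x - P (-j+2)) - ed P (-j+2) := by
    unfold ed; rw [f21]; ring
  rw [h1, h2, ed_cj, cr_neg_l, cr_conj, cr_sub_r, cr_self]; ring
lemma all_neg (p : Fin 3 → Prop) : (∀ j, p (-j+2)) ↔ ∀ j, p j := by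
  constructor
  · intro h j; have := h (-j+2); rwa [show -(-j+2)+2 = j by clear * -; revert j; decide] at this
  · intro h j; exact h _
lemma Reg_cj (P : Fin 3 → ℂ) (x : ℂ) : x ∈ Reg (cj P) ↔ (starRingEnd ℂ) x ∈ Reg P := by
  show (∀ j, 0 ≤ cr (ed (cj P) j) (x - cj P j)) ↔ _
  simp_rw [cr_cj]
  exact all_neg (fun j => 0 ≤ cr (ed P j) ((starRingEnd ℂ) x - P j))
lemma SReg_cj (P : Fin 3 → ℂ) (x : ℂ) : x ∈ SReg (cj P) ↔ (starRingEnd ℂ) x ∈ SReg P := by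
  show (∀ j, 0 < cr (ed (cj P) j) (x - cj P j)) ↔ _
  simp_rw [cr_cj]
  exact all_neg (fun j => 0 < cr (ed P j) ((starRingEnd ℂ) x - P j))
lemma ccw_cj {P : Fin 3 → ℂ} (h : Ccw P) : Ccw (cj P) := by
  unfold Ccw cr at *
  simp [cj] at *
  rw [show (-1 : Fin 3) = 2 from rfl, show (-2 : Fin 3) = 1 from rfl]
  linarith
lemma ang_cj {P : Fin 3 → ℂ} {j : Fin 3} {A : ℝ} (h : IsAng P (-j) A) : IsAng (cj P) j A := by
  refine ⟨h.1, h.2.1, ?_⟩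
  have h2 := h.2.2
  rw [dr_cj, dr_cj, fneg3, ← map_neg _ (dr P (-j+2)), h2, map_mul]
  have : (starRingEnd ℂ) (cs A) * cs A = 1 := by
    rw [← cs_neg_mul A]; congr 1; apply Complex.ext <;> simp
  rw [mul_assoc, this]; simp

lemma LT.conj (T : LT N α β V t lab) : LT N α β (cj V) (fun i => cj (t i)) (fun i j => lab i (-j)) where
  ccwV := ccw_cj T.ccwV
  ccw := fun i => ccw_cj (T.ccw i)
  disj := fun i k h x h1 h2 => T.disj i k h _ ((SReg_cj _ _).1 h1) ((SReg_cj _ _).1 h2)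
  cover := fun x => by simp only [Reg_cj]; exact T.cover _
  par := T.par
  inj := fun i j k h => neg_inj.1 (T.inj i h)
  ang := fun i j => ang_cj (T.ang i (-j))
  len := fun i j => by
    rw [ed_cj, norm_neg, Complex.norm_conj, T.len, f22, fneg2]

/-- the statement for a given list of corner multiplicities -/
def QQ (N : ℕ) (α β : ℝ) (x y z : ℕ × ℕ) : Prop :=
  ∀ V t lab, LT N α β V t lab → IsAng V 0 (x.1 * α + x.2 * β) → IsAng V 1 (y.1 * α + y.2 * β) →
    IsAng V 2 (z.1 * α + z.2 * β) → ∃ l : Fin 3 → Fin 3, Function.Injective l ∧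
      x.1 * α + x.2 * β = af α β (l 0) ∧ y.1 * α + y.2 * β = af α β (l 1) ∧ z.1 * α + z.2 * β = af α β (l 2)

lemma QQ.rot {x y z : ℕ × ℕ} (h : QQ N α β x y z) : QQ N α β y z x := by
  intro V t lab T h0 h1 h2
  obtain ⟨l, hl, e0, e1, e2⟩ := h (rt (rt V)) t lab T.rot.rot (by rw [ang_rt, ang_rt]; exact h2)
    (by rw [ang_rt, ang_rt]; exact h0) (by rw [ang_rt, ang_rt]; exact h1)
  refine ⟨fun j => l (j+1), fun a b hab => add_right_cancel (hl hab), e1, e2, e0⟩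
lemma QQ.refl {x y z : ℕ × ℕ} (h : QQ N α β x y z) : QQ N α β x z y := by
  intro V t lab T h0 h1 h2
  obtain ⟨l, hl, e0, e1, e2⟩ := h _ _ _ T.conj (ang_cj h0) (ang_cj h2) (ang_cj h1)
  refine ⟨fun j => l (-j), fun a b hab => neg_injective (hl hab), e0, e2, e1⟩

lemma shapes (h0 : QQ N α β (2,1) (1,0) (0,1)) (h1 : QQ N α β (3,0) (0,1) (0,1))
    (h2 : QQ N α β (1,2) (1,0) (1,0)) (h3 : QQ N α β (2,0) (0,2) (1,0))
    (h4 : QQ N α β (2,0) (1,1) (0,1)) (h5 : QQ N α β (1,1) (1,1) (1,0))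
    {x y z : ℕ × ℕ} (hp : x.1 + y.1 + z.1 = 3) (hq : x.2 + y.2 + z.2 = 2)
    (hx : 0 < x.1 + x.2) (hy : 0 < y.1 + y.2) (hz : 0 < z.1 + z.2) : QQ N α β x y z := by
  obtain ⟨x1, x2⟩ := x
  obtain ⟨y1, y2⟩ := y
  obtain ⟨z1, z2⟩ := z
  simp only at *
  have a0 := h0.rot; have a1 := h1.rot; have a2 := h2.rot; have a3 := h3.rot; have a4 := h4.rot; have a5 := h5.rot
  have b0 := a0.rot; have b1 := a1.rot; have b2 := a2.rot; have b3 := a3.rot; have b4 := a4.rot; have b5 := a5.rot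
  have c0 := h0.refl; have c1 := h1.refl; have c2 := h2.refl; have c3 := h3.refl; have c4 := h4.refl; have c5 := h5.refl
  have d0 := a0.refl; have d1 := a1.refl; have d2 := a2.refl; have d3 := a3.refl; have d4 := a4.refl; have d5 := a5.refl
  have e0 := b0.refl; have e1 := b1.refl; have e2 := b2.refl; have e3 := b3.refl; have e4 := b4.refl; have e5 := b5.refl
  have kx : x1 ≤ 3 := by omega
  have ky : y1 ≤ 3 := by omega
  have lx : x2 ≤ 2 := by omega
  have ly : y2 ≤ 2 := by omega
  obtain rfl : z1 = 3 - x1 - y1 := by omega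
  obtain rfl : z2 = 2 - x2 - y2 := by omega
  interval_cases x1 <;> interval_cases y1 <;> first | omega | skip
  all_goals interval_cases x2 <;> first | omega | skip
  all_goals interval_cases y2 <;> first | omega | assumption

lemma QQ0 : QQ N α β (2,1) (1,0) (0,1) := by
  intro V t lab T _ _ _
  exact ⟨![2,0,1], by decide, by simp, by simp, by simp⟩
end
end TT

namespace TT
section
open Filter Topology

lemma alg1 {s l : ℝ} {N : ℕ} {M1 M2 : ℤ} (s0 : 0 < s) (s1 : s < 1) (l0 : 0 < l) (hN : (N:ℝ) = l ^ 2 * (3 - s ^ 2))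
    (h1 : l * (1 + s) = M1) (h2 : l * (1 - s) = M2) (h12 : N < 12) : N = 11 ∧ s = 1 / 2 ∧ l = 2 := by
  have p2 : 0 < M2 := by
    have : (0:ℝ) < M2 := by rw [← h2]; exact mul_pos l0 (by linarith)
    exact_mod_cast this
  have p1 : M2 < M1 := by
    have : (M2:ℝ) < M1 := by rw [← h2, ← h1]; nlinarith
    exact_mod_cast this
  have hz : 2 * (N:ℤ) = M1 ^ 2 + M2 ^ 2 + 4 * M1 * M2 := by
    have : 2 * (N:ℝ) = M1 ^ 2 + M2 ^ 2 + 4 * M1 * M2 := by rw [hN, ← h1, ← h2]; ring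
    exact_mod_cast this
  have hN' : (N:ℤ) < 12 := by exact_mod_cast h12
  have b2 : M2 < 2 := by nlinarith
  have e2 : M2 = 1 := by omega
  subst e2
  have b1 : M1 < 4 := by nlinarith
  have : M1 = 3 := by
    interval_cases M1
    · omega
    · rfl
  subst this
  push_cast at *
  have hl : l = 2 := by linarith
  subst hl
  refine ⟨by omega, by linarith, rfl⟩

lemma fin2 : ∀ N : Fin 12, ∀ m : Fin 12, ∀ n : Fin 12, m < n → 2 * (N:ℕ) < m * n → (m:ℕ) * n < 3 * N →
    (n - m : ℕ) ^ 2 * (4 * N ^ 2) = (n + m : ℕ) ^ 2 * (2 * (m * n) - 4 * N : ℕ) * (m * n - N : ℕ) → False := by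
  decide +kernel

lemma fin3 : ∀ N : Fin 12, ∀ m : Fin 12, ∀ n : Fin 12, 0 < m → m < n → (m:ℕ) * n < N →
    (n - m : ℕ) ^ 2 < 2 * (N - m * n : ℕ) →
    2 * (N - m * n : ℕ) * (n + m : ℕ) ^ 2 = (4 * (N - m * n : ℕ) - (n - m : ℕ) ^ 2) ^ 2 → False := by
  decide +kernel

lemma alg2 {s l : ℝ} {N : ℕ} {M1 M2 : ℤ} (s0 : 0 < s) (s1 : s < 1) (l0 : 0 < l)
    (hN : N * (1 - s ^ 2) = l ^ 2 * (2 - s ^ 2))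
    (h1 : l * (2 + s) = M1 * (1 + s)) (h2 : l * (2 - s) = M2 * (1 - s)) (h12 : N < 12) (hb : |M2| ≤ N) : False := by
  have q : 0 < 1 - s ^ 2 := by nlinarith
  have p1' : (0:ℝ) < M1 := by
    by_contra hn; push Not at hn
    have : 0 < l * (2 + s) := by positivity
    nlinarith
  have p2' : (0:ℝ) < M2 := by
    by_contra hn; push Not at hn
    have : 0 < l * (2 - s) := mul_pos l0 (by linarith)
    nlinarith
  have he : ((M2:ℝ) - M1) * (2 - s ^ 2) = (M1 + M2) * s := by
    apply mul_left_cancel₀ l0.ne'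
    linear_combination (M2 * (1 - s)) * h1 - (M1 * (1 + s)) * h2
  have e0 : (M1:ℝ) < M2 := by
    have : 0 < ((M1:ℝ) + M2) * s := by positivity
    rw [← he] at this
    have := pos_of_mul_pos_left this (by linarith)
    linarith
  have hP : N * (4 - s ^ 2) = M1 * M2 * (2 - s ^ 2) := by
    apply mul_left_cancel₀ q.ne'
    linear_combination (4 - s^2) * hN + (2 - s^2) * l * (2 - s) * h1 + (2-s^2) * (M1 * (1+s)) * h2
  obtain ⟨m, rfl⟩ := Int.eq_ofNat_of_zero_le (a := M1) (by exact_mod_cast p1'.le)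
  obtain ⟨n, rfl⟩ := Int.eq_ofNat_of_zero_le (a := M2) (by exact_mod_cast p2'.le)
  have hb' : n ≤ N := by rw [abs_of_nonneg (by positivity)] at hb; exact_mod_cast hb
  push_cast at *
  have hmn : m < n := by exact_mod_cast e0
  have hi : s ^ 2 * ((m:ℝ) * n - N) = 2 * (m * n) - 4 * N := by linear_combination hP
  have hii : (2 - s ^ 2) * ((m:ℝ) * n - N) = 2 * N := by linear_combination -hP
  have N0 : (0:ℝ) < N := by
    have : 0 < l ^ 2 * (2 - s ^ 2) := mul_pos (by positivity) (by nlinarith)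
    rw [← hN] at this
    exact pos_of_mul_pos_left this q.le
  have d0 : 0 < (m:ℝ) * n - N := by
    have : 0 < (2 - s ^ 2) * ((m:ℝ) * n - N) := by rw [hii]; linarith
    exact pos_of_mul_pos_right this (by nlinarith)
  have c1 : 2 * (N:ℝ) < m * n := by
    have : 0 < s ^ 2 * ((m:ℝ) * n - N) := by positivity
    linarith
  have c2 : (m:ℝ) * n < 3 * N := by nlinarith
  have c1' : 2 * N < m * n := by exact_mod_cast c1
  have c2' : m * n < 3 * N := by exact_mod_cast c2
  refine fin2 ⟨N, h12⟩ ⟨m, by omega⟩ ⟨n, by omega⟩ hmn c1' c2' ?_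
  show (n - m) ^ 2 * (4 * N ^ 2) = (n + m) ^ 2 * (2 * (m * n) - 4 * N) * (m * n - N)
  have : (((n - m) ^ 2 * (4 * N ^ 2) : ℕ) : ℝ) = ((n + m) ^ 2 * (2 * (m * n) - 4 * N) * (m * n - N) : ℕ) := by
    push_cast [Nat.cast_sub hmn.le, Nat.cast_sub (show N ≤ m * n by omega), Nat.cast_sub (show 4 * N ≤ 2 * (m * n) by omega)]
    rw [← hi]
    rw [show 4 * (N:ℝ) ^ 2 = (2 * N) ^ 2 by ring, ← hii]
    linear_combination (((m:ℝ) * n - N) ^ 2 * ((n - m) * (2 - s ^ 2) + (m + n) * s)) * he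
  exact_mod_cast this

lemma alg3 {s l : ℝ} {N : ℕ} {M1 M2 : ℤ} (s0 : 0 < s) (s1 : s < 1) (l0 : 0 < l)
    (hN : N = l ^ 2 * (2 - s ^ 2) * (3 - s ^ 2))
    (h1 : l * (1 - s) * (2 + s) = M1) (h2 : l * (1 + s) * (2 - s) = M2) (h12 : N < 12) : False := by
  have p1' : (0:ℝ) < M1 := by rw [← h1]; exact mul_pos (mul_pos l0 (by linarith)) (by linarith)
  have p2' : (0:ℝ) < M2 := by rw [← h2]; exact mul_pos (mul_pos l0 (by linarith)) (by linarith)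
  obtain ⟨m, rfl⟩ := Int.eq_ofNat_of_zero_le (a := M1) (by exact_mod_cast p1'.le)
  obtain ⟨n, rfl⟩ := Int.eq_ofNat_of_zero_le (a := M2) (by exact_mod_cast p2'.le)
  push_cast at *
  have e1 : (n:ℝ) - m = 2 * l * s := by rw [← h1, ← h2]; ring
  have e2 : (n:ℝ) + m = 2 * l * (2 - s ^ 2) := by rw [← h1, ← h2]; ring
  have e3 : (N:ℝ) - m * n = 2 * l ^ 2 := by rw [hN, ← h1, ← h2]; ring
  have m0 : 0 < m := by exact_mod_cast p1'
  have hmn : m < n := by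
    have : (m:ℝ) < n := by have : 0 < 2 * l * s := by positivity
                           linarith
    exact_mod_cast this
  have hP : m * n < N := by
    have : (m:ℝ) * n < N := by have : 0 < 2 * l ^ 2 := by positivity
                               linarith
    exact_mod_cast this
  have n12 : n < 12 := by nlinarith
  have k1 : (n - m) ^ 2 < 2 * (N - m * n) := by
    have : (((n - m) ^ 2 : ℕ) : ℝ) < (2 * (N - m * n) : ℕ) := by
      push_cast [Nat.cast_sub hmn.le, Nat.cast_sub hP.le]
      rw [e1, e3]
      have : 0 < l ^ 2 * (1 - s ^ 2) := mul_pos (by positivity) (by nlinarith)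
      nlinarith
    exact_mod_cast this
  refine fin3 ⟨N, h12⟩ ⟨m, by omega⟩ ⟨n, by omega⟩ m0 hmn hP k1 ?_
  show 2 * (N - m * n) * (n + m) ^ 2 = (4 * (N - m * n) - (n - m) ^ 2) ^ 2
  have : ((2 * (N - m * n) * (n + m) ^ 2 : ℕ) : ℝ) = ((4 * (N - m * n) - (n - m) ^ 2) ^ 2 : ℕ) := by
    push_cast [Nat.cast_sub hmn.le, Nat.cast_sub hP.le, Nat.cast_sub (show (n - m) ^ 2 ≤ 4 * (N - m * n) by omega)]
    rw [e1, e2, e3]; ring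
  exact_mod_cast this

lemma alg4 {s l : ℝ} {N : ℕ} {M : ℤ} {p q r : ℕ} (s0 : 0 < s) (s1 : s < 1) (l0 : 0 < l)
    (hN : N = l ^ 2 * (2 - s ^ 2)) (h1 : l * s = M) (hl : l = p * s + q * (1 - s ^ 2) + r) (hr : 1 ≤ r) (h12 : N < 12) :
    N = 7 ∧ s = 1 / 2 ∧ l = 2 := by
  have hM : (0:ℝ) < M := by rw [← h1]; positivity
  obtain ⟨m, rfl⟩ := Int.eq_ofNat_of_zero_le (a := M) (by exact_mod_cast hM.le)
  push_cast at *
  have m0 : 0 < m := by exact_mod_cast hM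
  have e1 : s ^ 2 * (N + m ^ 2) = 2 * m ^ 2 := by rw [hN, ← h1]; ring
  have hmN : m ^ 2 < N := by
    have : (m:ℝ) ^ 2 < N := by
      have : 0 < (l ^ 2) * (1 - s ^ 2) := mul_pos (by positivity) (by nlinarith)
      rw [hN, ← h1]; nlinarith
    exact_mod_cast this
  -- s rational
  have hs2 : s ^ 2 = ((2 * m ^ 2 / (N + m ^ 2) : ℚ) : ℝ) := by
    push_cast; rw [eq_div_iff (by positivity)]; exact e1
  set S : ℚ := 2 * m ^ 2 / (N + m ^ 2) with hS
  have S1 : S < 1 := by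
    have : (S:ℝ) < 1 := by rw [← hs2]; nlinarith
    exact_mod_cast this
  have e2 : s * (q * (1 - s ^ 2) + r) = m - p * s ^ 2 := by rw [← h1, hl]; ring
  have r1 : (1:ℝ) ≤ r := by exact_mod_cast hr
  have hd : (0:ℝ) < q * (1 - s ^ 2) + r := by
    have : 0 ≤ (q:ℝ) * (1 - s ^ 2) := mul_nonneg (by positivity) (by nlinarith)
    linarith
  have hs : s = (((m - p * S) / (q * (1 - S) + r) : ℚ) : ℝ) := by
    push_cast; rw [← hs2, eq_div_iff hd.ne']; exact e2
  set w : ℚ := (m - p * S) / (q * (1 - S) + r) with hw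
  have hsq : IsSquare ((2 * (N + m ^ 2) : ℕ) : ℚ) := by
    refine ⟨2 * m / w, ?_⟩
    have : ((((2 * (N + m ^ 2) : ℕ) : ℚ)) : ℝ) = ((2 * m / w * (2 * m / w) : ℚ) : ℝ) := by
      push_cast; rw [← hs]; field_simp; linear_combination e1
    exact_mod_cast this
  rw [Rat.isSquare_natCast_iff] at hsq
  have hm : m < 4 := by nlinarith
  have : N = 7 ∧ m = 1 := by
    obtain ⟨x, hx⟩ := hsq
    have hx' : x < 8 := by nlinarith
    interval_cases m <;> interval_cases x <;> omega
  obtain ⟨rfl, rfl⟩ := this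
  push_cast at e1 h1
  have : s = 1 / 2 := by nlinarith
  subst this
  exact ⟨rfl, rfl, by linarith⟩

lemma alg5 {s l : ℝ} {N : ℕ} {M1 M2 : ℤ} {p q r : ℕ} (s0 : 0 < s) (s1 : s < 1) (l0 : 0 < l)
    (hN : N * (1 - s ^ 2) = l ^ 2) (h1 : l = M1 * (1 + s)) (h2 : l = M2 * (1 - s))
    (hl : l * s = p * s + q * (1 - s ^ 2) + r) (hr : 1 ≤ r) (h12 : N < 12) : False := by
  have p1' : (0:ℝ) < M1 := by
    by_contra hn; push Not at hn; nlinarith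
  have p2' : (0:ℝ) < M2 := by
    by_contra hn; push Not at hn; nlinarith
  have q0 : 0 < 1 - s ^ 2 := by nlinarith
  obtain ⟨m, rfl⟩ := Int.eq_ofNat_of_zero_le (a := M1) (by exact_mod_cast p1'.le)
  obtain ⟨n, rfl⟩ := Int.eq_ofNat_of_zero_le (a := M2) (by exact_mod_cast p2'.le)
  push_cast at *
  have hmn' : (m:ℝ) < n := by
    by_contra hn; push Not at hn
    have : (n:ℝ) * (1 - s) < m * (1 + s) := by nlinarith
    linarith
  have hmn : m < n := by exact_mod_cast hmn'
  have m0 : 0 < m := by exact_mod_cast p1'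
  have hP : N = m * n := by
    have : (N:ℝ) = m * n := by
      apply mul_right_cancel₀ q0.ne'
      rw [hN]; linear_combination l * h1 + m * (1 + s) * h2
    exact_mod_cast this
  have es : s * (n + m) = n - m := by linear_combination h2 - h1
  have el : l * (n + m) = 2 * (m * n) := by linear_combination n * h1 + m * h2
  have key : 2 * (m * n) * (n - m) = p * ((n - m) * (n + m)) + q * (4 * (m * n)) + r * (n + m) ^ 2 := by
    have : ((2 * (m * n) * (n - m) : ℕ) : ℝ) = (p * ((n - m) * (n + m)) + q * (4 * (m * n)) + r * (n + m) ^ 2 : ℕ) := by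
      push_cast [Nat.cast_sub hmn.le]
      rw [← el, ← es]
      have : (4:ℝ) * (m * n) = (n + m) ^ 2 - (n - m) ^ 2 := by ring
      rw [this, ← es]
      linear_combination (n + m) ^ 2 * hl
    exact_mod_cast this
  have n12 : n < 12 := by nlinarith
  have m4 : m < 4 := by nlinarith
  have hmn12 : m * n < 12 := by omega
  clear hl h1 h2 el es hN
  obtain ⟨e, rfl⟩ := Nat.exists_eq_add_of_lt hmn
  have e10 : e < 11 := by omega
  interval_cases m <;> interval_cases e <;> norm_num at hmn12 <;> norm_num at key <;> omega
end
end TT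

namespace TT
section
open Filter Topology

variable {N : ℕ} {α β : ℝ} {V : Fin 3 → ℂ} {t : Fin N → Fin 3 → ℂ} {lab : Fin N → Fin 3 → Fin 3}

lemma fl_in_OE {P : Fin 3 → ℂ} (h : Ccw P) {j : Fin 3} {x ζ : ℂ} (hx : OE P j x) (hc : 0 < cr (dr P j) ζ) (σ : ℝ) :
    Fl P x ζ σ := by
  obtain ⟨c0, c1, c2⟩ := OE_cr h hx
  refine all3 (p := fun j => pos3 (cr (ed P j) (x - P j)) (cr (ed P j) ζ) (_ * dt (ed P j) ζ)) j ?_ ?_ ?_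
  · right; refine ⟨c0, Or.inl ?_⟩; rw [ed_dr h j, cr_smul_l]; exact mul_pos (ed_pos h j) hc
  · exact Or.inl c1
  · exact Or.inl c2

lemma fl_in_vert {P : Fin 3 → ℂ} (h : Ccw P) {j : Fin 3} {ζ : ℂ} (hc : 0 < cr (dr P j) ζ)
    (hc2 : 0 < cr (dr P (j+2)) ζ) (σ : ℝ) : Fl P (P j) ζ σ := by
  refine all3 (p := fun k => pos3 (cr (ed P k) (P j - P k)) (cr (ed P k) ζ) (_ * dt (ed P k) ζ)) j ?_ ?_ ?_
  · right; refine ⟨cr_start j, Or.inl ?_⟩; rw [ed_dr h j, cr_smul_l]; exact mul_pos (ed_pos h j) hc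
  · exact Or.inl (cr_opp h j)
  · right; refine ⟨cr_end j, Or.inl ?_⟩; rw [ed_dr h (j+2), cr_smul_l]; exact mul_pos (ed_pos h _) hc2

lemma dn_of {P : Fin 3 → ℂ} (h : Ccw P) {j : Fin 3} {x ζ : ℂ} {τ : ℝ} (hd : dr P j = -ζ)
    (h0 : 0 ≤ τ) (h1 : τ < ‖ed P j‖) (hx : x = P (j+1) + τ * ζ) : Dn P j ζ x :=
  ⟨‖ed P j‖, ed_pos h j, by have := ed_dr h j; rw [hd] at this; rw [← mul_neg]; exact this, τ, h0, h1, hx⟩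

lemma Tl.across (T : Tl N V t) {i : Fin N} {j : Fin 3} {x ζ : ℂ} {τ : ℝ} (hd : dr (t i) j = ζ)
    (h0 : 0 ≤ τ) (h1 : τ < ‖ed (t i) j‖) (hx : x = t i j + τ * ζ) (hV : Fl V x ζ (-1)) :
    ∃ v, ∃ k, ∃ σ : ℝ, v ≠ i ∧ dr (t v) k = -ζ ∧ 0 ≤ σ ∧ σ < ‖ed (t v) k‖ ∧ x = t v (k+1) + σ * ζ := by
  have hne : ζ ≠ 0 := by rw [← hd]; exact dr_ne (T.ccw i) j
  have hn : ‖ζ‖ = 1 := by rw [← hd]; exact norm_dr (T.ccw i) j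
  obtain ⟨g1, g2⟩ := up_fl (T.ccw i) (up_of (T.ccw i) hd h0 h1 hx)
  obtain ⟨v, hv⟩ := (T.fl_ex hne (by norm_num)).1 hV
  have hvi : v ≠ i := by rintro rfl; exact g2 hv
  obtain ⟨k, l, hl, he, σ, s0, s1, hs⟩ := fl_dn (T.ccw v) hne hv (fun h => hvi (T.fl_uniq h g1))
  obtain ⟨e1, e2⟩ := dr_of (T.ccw v) hl (ζ := -ζ) (by rw [norm_neg, hn]) (by rw [he]; ring)
  exact ⟨v, k, σ, hvi, e1, s0, by rw [e2]; exact s1, hs⟩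

lemma Tl.across' (T : Tl N V t) {i : Fin N} {j : Fin 3} {x ζ : ℂ} {τ : ℝ} (hd : dr (t i) j = -ζ)
    (h0 : 0 ≤ τ) (h1 : τ < ‖ed (t i) j‖) (hx : x = t i (j+1) + τ * ζ) (hV : Fl V x ζ 1) :
    ∃ v, ∃ k, ∃ σ : ℝ, v ≠ i ∧ dr (t v) k = ζ ∧ 0 ≤ σ ∧ σ < ‖ed (t v) k‖ ∧ x = t v k + σ * ζ := by
  have hn : ‖ζ‖ = 1 := by rw [← norm_neg, ← hd]; exact norm_dr (T.ccw i) j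
  have hne : ζ ≠ 0 := by intro h; rw [h] at hn; simp at hn
  obtain ⟨g1, g2⟩ := dn_fl (T.ccw i) (dn_of (T.ccw i) hd h0 h1 hx)
  obtain ⟨v, hv⟩ := (T.fl_ex hne one_ne_zero).1 hV
  have hvi : v ≠ i := by rintro rfl; exact g2 hv
  obtain ⟨k, l, hl, he, σ, s0, s1, hs⟩ := fl_up (T.ccw v) hne hv (fun h => hvi (T.fl_uniq h g1))
  obtain ⟨e1, e2⟩ := dr_of (T.ccw v) hl hn he
  exact ⟨v, k, σ, hvi, e1, s0, by rw [e2]; exact s1, hs⟩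

lemma mo_vert (hc : ∀ i, Ccw (t i)) {v : Fin N} {k : Fin 3} {x ζ : ℂ} {σ : ℝ} (hm : mo t x = ∅) (hd : dr (t v) k = ζ)
    (h0 : 0 ≤ σ) (h1 : σ < ‖ed (t v) k‖) (hx : x = t v k + σ * ζ) : t v k = x := by
  rcases h0.eq_or_lt with h | h
  · rw [hx, ← h]; simp
  · exfalso
    have : v ∈ mo t x := mem_mo.2 ⟨k, OE_of (hc v) h h1 (by rw [hd]; exact hx)⟩
    rw [hm] at this; simp at this

lemma mo_vert' (hc : ∀ i, Ccw (t i)) {v : Fin N} {k : Fin 3} {x ζ : ℂ} {σ : ℝ} (hm : mo t x = ∅) (hd : dr (t v) k = -ζ)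
    (h0 : 0 ≤ σ) (h1 : σ < ‖ed (t v) k‖) (hx : x = t v (k+1) + σ * ζ) : t v (k+1) = x := by
  rcases h0.eq_or_lt with h | h
  · rw [hx, ← h]; simp
  · exfalso
    have : v ∈ mo t x := mem_mo.2 ⟨k, OE_of (hc v) (τ := ‖ed (t v) k‖ - σ) (by linarith) (by linarith)
      (by rw [hx, next_pt (hc v) k, hd]; push_cast; ring)⟩
    rw [hm] at this; simp at this

lemma OE_uniq {P : Fin 3 → ℂ} (h : Ccw P) {j k : Fin 3} {x : ℂ} (hj : OE P j x) (hk : OE P k x) : j = k := by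
  obtain ⟨c0, c1, c2⟩ := OE_cr h hj
  have d := (OE_cr h hk).1
  rcases fin3_cases j k with rfl | rfl | rfl
  · rfl
  · rw [d] at c1; exact absurd c1 (lt_irrefl _)
  · rw [d] at c2; exact absurd c2 (lt_irrefl _)

lemma LT.inner_of (T : LT N α β V t lab) {x : ℂ} {i v : Fin N} {j : Fin 3} (h : t i j = x) (hv : v ∈ mo t x) : x ∈ SReg V := by
  rcases am_class T.ccwV x with ⟨k, hk⟩ | ⟨k, hk⟩ | hk | hk
  · rw [hk, T.corner_mo] at hv; simp at hv
  · rw [T.side_mo hk h] at hv; simp at hv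
  · exact hk
  · exact absurd ((T.cover x).2 ⟨i, by rw [← h]; exact vert_mem (T.ccw i) j⟩) hk

/-- a side point after a γ-end carries no other γ -/
lemma LT.ng (T : LT N α β V t lab) {k : Fin 3} {u : ℝ} {i : Fin N} {j : Fin 3} (h0 : 0 ≤ u)
    (hs : Sd V (t i) k u j) (h1 : u + ‖ed (t i) j‖ < ‖ed V k‖) (hg : lab i (j+1) = 2) :
    ∀ i' j', Sd V (t i') k (u + ‖ed (t i) j‖) j' → lab i' j' ≠ 2 := by
  intro i' j' hs' hl'
  have hp := ed_pos (T.ccw i) j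
  have := T.side_gg (pt_OE T.ccwV (k := k) (u := u + ‖ed (t i) j‖) (by linarith) (by linarith))
    (sd_end (T.ccw i) hs) hs'.1 hg hl'
  subst this
  have := sd_ne (T.ccw i) hs hs'
  subst this
  have h5 := vert_inj (T.ccw i) (hs'.1.trans (sd_end (T.ccw i) hs).symm)
  revert h5; clear * -; fin_cases j <;> simp

lemma LT.formX (T : LT N α β V t lab) {k : Fin 3} {u : ℝ} (hg : cn t lab (V (k+1)) 2 = ∅) (h0 : 0 ≤ u)
    (h1 : u < ‖ed V k‖) (hm : mo t (pt V k u) = ∅) (hn : ∀ i j, Sd V (t i) k u j → lab i j ≠ 2) :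
    ∃ p q r : ℕ, ‖ed V k‖ - u = p * sv α + q * (1 - sv α ^ 2) + r ∧ 1 ≤ r := by
  obtain ⟨n, hnn⟩ := T.par.nb (‖ed V k‖ - u)
  rcases T.form1 (k := k) (Y := ‖ed V k‖) (by rw [pt_end T.ccwV]; exact T.corner_mo _) le_rfl n u h0 h1 hm hnn hn
    with e | ⟨i, j, v, hs, e1, e2⟩
  · exact e
  · exfalso
    refine T.no_g hg ?_ e2
    rw [sd_end (T.ccw i) hs, e1, pt_end T.ccwV]

lemma ne0_cases {f : Fin 3 → Fin 3} (hf : Function.Injective f) {j : Fin 3} (h : f j = 0) :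
    (f (j+2) = 1 ∧ f (j+1) = 2) ∨ (f (j+2) = 2 ∧ f (j+1) = 1) := by
  obtain ⟨_, h1, h2, h3⟩ := lab_cases hf j
  revert h h1 h2 h3
  generalize f j = x; generalize f (j+1) = y; generalize f (j+2) = z
  revert x y z; decide
lemma ne1_cases {f : Fin 3 → Fin 3} (hf : Function.Injective f) {j : Fin 3} (h : f j = 1) :
    (f (j+2) = 0 ∧ f (j+1) = 2) ∨ (f (j+2) = 2 ∧ f (j+1) = 0) := by
  obtain ⟨_, h1, h2, h3⟩ := lab_cases hf j
  revert h h1 h2 h3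
  generalize f j = x; generalize f (j+1) = y; generalize f (j+2) = z
  revert x y z; decide
lemma ne2_cases {f : Fin 3 → Fin 3} (hf : Function.Injective f) {j : Fin 3} (h : f j = 2) :
    (f (j+2) = 0 ∧ f (j+1) = 1) ∨ (f (j+2) = 1 ∧ f (j+1) = 0) := by
  obtain ⟨_, h1, h2, h3⟩ := lab_cases hf j
  revert h h1 h2 h3
  generalize f j = x; generalize f (j+1) = y; generalize f (j+2) = z
  revert x y z; decide

lemma LT.cnt (T : LT N α β V t lab) {k : Fin 3} {p q : ℕ} (h : IsAng V k (p * α + q * β)) :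
    p = (cn t lab (V k) 0).card + 2 * (cn t lab (V k) 2).card ∧
    q = (cn t lab (V k) 1).card + (cn t lab (V k) 2).card :=
  T.par.indN (T.corner k h).2.2

lemma lab_mem {x : ℂ} {i : Fin N} {j : Fin 3} (h : t i j = x) {l : Fin 3} (hl : cn t lab x l = ∅) : lab i j ≠ l := by
  intro e
  have : i ∈ cn t lab x l := mem_cn.2 ⟨j, h, e⟩
  rw [hl] at this; simp at this

lemma lab012 (l : Fin 3) : l = 0 ∨ l = 1 ∨ l = 2 := by revert l; decide

/-- corner with only α angles -/
lemma LT.onlyα (T : LT N α β V t lab) {k : Fin 3} {p : ℕ} (h : IsAng V k (p * α + (0:ℕ) * β)) {i : Fin N} {j : Fin 3}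
    (e : t i j = V k) : lab i j = 0 := by
  obtain ⟨h1, h2⟩ := T.cnt h
  have c1 : cn t lab (V k) 1 = ∅ := Finset.card_eq_zero.1 (by omega)
  have c2 : cn t lab (V k) 2 = ∅ := Finset.card_eq_zero.1 (by omega)
  rcases lab012 (lab i j) with h | h | h
  · exact h
  · exact absurd h (lab_mem e c1)
  · exact absurd h (lab_mem e c2)

lemma LT.first (T : LT N α β V t lab) {p : ℕ} (h : IsAng V 0 (p * α + (0:ℕ) * β)) :
    ∃ i j, Sd V (t i) 0 0 j ∧ t i j = V 0 ∧ lab i j = 0 := by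
  obtain ⟨i, j, hs⟩ := T.toTl.sd_ex (k := 0) (u := 0) le_rfl (ed_pos T.ccwV 0) (by rw [pt_zero]; exact T.corner_mo 0)
  have e : t i j = V 0 := by rw [hs.1, pt_zero]
  exact ⟨i, j, hs, e, T.onlyα h e⟩

/-- directions of tile edges from a vertex -/
lemma dirs {P : Fin 3 → ℂ} {j : Fin 3} {A φ : ℝ} (hA : IsAng P j A) (hd : dr P j = cs φ) : dr P (j+2) = - cs (φ + A) := by
  rw [cs_add, ← hd, ← hA.2.2]; ring
lemma dirs' {P : Fin 3 → ℂ} {j : Fin 3} {A φ : ℝ} (hA : IsAng P (j+1) A) (hd : dr P j = cs φ) :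
    dr P (j+1) = cs (φ + (π - A)) := by
  have h := hA.2.2
  rw [f11, hd] at h
  rw [show φ + (π - A) = φ + π + -A by ring, cs_add, cs_add, cs_pi]
  linear_combination (-cs (-A)) * h - dr P (j+1) * cs_neg_mul A

lemma LT.second (T : LT N α β V t lab) {p : ℕ} (hp : 2 ≤ p) (h : IsAng V 0 (p * α + (0:ℕ) * β)) :
    ∃ i j, t i j = V 0 ∧ dr (t i) j = dr V 0 * cs α ∧ lab i j = 0 := by
  obtain ⟨i, j, hs, e, hl⟩ := T.first h
  obtain ⟨φ, hφ⟩ := ex_cs (norm_dr T.ccwV 0)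
  have hd : dr (t i) j = cs φ := hs.2.trans hφ
  have hA := T.ang i j
  rw [hl, af0] at hA
  have hd2 := dirs hA hd
  have a0 := T.par.a0
  have b0 := T.par.b0
  have hsum := T.par.sum
  have hp' : (2:ℝ) ≤ p := by exact_mod_cast hp
  have hF : Fl V (V 0) (cs (φ + α)) 1 := (fl_vertex T.ccwV h hφ a0 (by linarith)).2 (by push_cast; nlinarith)
  obtain ⟨v, k, σ, _, v1, v2, v3, v4⟩ := T.toTl.across' (i := i) (j := j+2) (ζ := cs (φ + α)) (x := V 0) (τ := 0)
    hd2 le_rfl (ed_pos (T.ccw i) _) (by rw [f21, e]; simp) hF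
  have hv := mo_vert T.ccw (T.corner_mo 0) v1 v2 v3 v4
  exact ⟨v, k, hv, by rw [v1, cs_add, hφ], T.onlyα h hv⟩
end
end TT

namespace TT
section
open Filter Topology

variable {N : ℕ} {α β : ℝ} {V : Fin 3 → ℂ} {t : Fin N → Fin 3 → ℂ} {lab : Fin N → Fin 3 → Fin 3}

lemma LT.len0 (T : LT N α β V t lab) (hs : sv α = 1/2) {i : Fin N} {j : Fin 3} (h : lab i j = 0) : ‖ed (t i) (j+1)‖ = 1/2 := by
  rw [T.len, f11, h, hs]; simp [lf]
lemma LT.len1 (T : LT N α β V t lab) (hs : sv α = 1/2) {i : Fin N} {j : Fin 3} (h : lab i j = 1) : ‖ed (t i) (j+1)‖ = 3/4 := by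
  rw [T.len, f11, h, hs]; simp [lf]; norm_num
lemma LT.len2 (T : LT N α β V t lab) {i : Fin N} {j : Fin 3} (h : lab i j = 2) : ‖ed (t i) (j+1)‖ = 1 := by
  rw [T.len, f11, h]; simp [lf]

lemma LT.cn_uniq (_ : LT N α β V t lab) {x : ℂ} {l : Fin 3} (h : (cn t lab x l).card ≤ 1) {i i' : Fin N} {j j' : Fin 3}
    (e : t i j = x) (hl : lab i j = l) (e' : t i' j' = x) (hl' : lab i' j' = l) : i = i' :=
  Finset.card_le_one.1 h i (mem_cn.2 ⟨j, e, hl⟩) i' (mem_cn.2 ⟨j', e', hl'⟩)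

lemma cn_pos {x : ℂ} {l : Fin 3} {i : Fin N} {j : Fin 3} (e : t i j = x) (hl : lab i j = l) : 1 ≤ (cn t lab x l).card :=
  Finset.card_pos.2 ⟨i, mem_cn.2 ⟨j, e, hl⟩⟩

lemma cs_ne_of {φ ψ : ℝ} (h0 : φ < ψ) (h1 : ψ < φ + π) : cs φ ≠ cs ψ := by
  intro h
  have := cr_cs φ (ψ - φ)
  rw [show φ + (ψ - φ) = ψ by ring, ← h, cr_self] at this
  have := sin_pos_of_pos_of_lt_pi (x := ψ - φ) (by linarith) (by linarith)
  linarith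

lemma cr_cs_pos {φ ψ : ℝ} (h0 : φ < ψ) (h1 : ψ < φ + π) : 0 < cr (cs φ) (cs ψ) := by
  have := cr_cs φ (ψ - φ)
  rw [show φ + (ψ - φ) = ψ by ring] at this
  rw [this]
  exact sin_pos_of_pos_of_lt_pi (by linarith) (by linarith)

lemma cs_add_pi (φ : ℝ) : cs (φ + π) = - cs φ := by rw [cs_add, cs_pi]; ring

lemma LT.lemL (T : LT N α β V t lab) (hs : sv α = 1/2) {p : ℕ} (hp : 2 ≤ p) (h : IsAng V 0 (p * α + (0:ℕ) * β))
    {i0 : Fin N} {j0 : Fin 3} (h0 : Sd V (t i0) 0 0 j0) (l0 : lab i0 j0 = 0) (l1 : lab i0 (j0+1) = 1) (hX : 1 < ‖ed V 0‖) :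
    ∀ i j, Sd V (t i) 0 1 j → lab i j ≠ 2 := by
  intro i j hS hl
  have a0 := T.par.a0
  have b0 := T.par.b0
  have hsum := T.par.sum
  obtain ⟨φ, hφ⟩ := ex_cs (norm_dr T.ccwV 0)
  have l2 : lab i0 (j0+2) = 2 := by
    rcases ne0_cases (T.inj i0) l0 with ⟨_, h⟩ | ⟨h, _⟩
    · rw [l1] at h; exact absurd h (by decide)
    · exact h
  have e0 : t i0 j0 = V 0 := by rw [h0.1, pt_zero]
  have d0 : dr (t i0) j0 = cs φ := h0.2.trans hφ
  have A0 := T.ang i0 j0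
  have A1 := T.ang i0 (j0+1)
  rw [l0, af0] at A0
  rw [l1, af1] at A1
  have d2 := dirs A0 d0
  have d1 := dirs' A1 d0
  have n0 : ‖ed (t i0) j0‖ = 1 := by have := T.len2 l2; rwa [f21] at this
  have n1 := T.len0 hs l0
  have n2 : ‖ed (t i0) (j0+2)‖ = 3/4 := by have := T.len1 hs l1; rwa [f12] at this
  have eQ : t i0 (j0+1) = pt V 0 1 := by rw [sd_end (T.ccw i0) h0, n0]; simp
  have oQ : OE V 0 (pt V 0 1) := pt_OE T.ccwV one_pos hX
  have mQ := T.side_mo oQ eQ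
  have eG : t i0 (j0+2) = pt V 0 1 + (1/2:ℝ) * cs (φ + (π - β)) := by
    have := next_pt (T.ccw i0) (j0+1)
    rw [f12, n1, d1, eQ] at this; exact this
  have eG2 : t i0 (j0+2) = V 0 + (3/4:ℝ) * cs (φ + α) := by
    have := next_pt (T.ccw i0) (j0+2)
    rw [f21, n2, d2, e0] at this; rw [this]; ring
  obtain ⟨v, k, σ, v0, v1, v2, v3, v4⟩ := T.toTl.across (i := i0) (j := j0+1) (ζ := cs (φ + (π - β))) (x := pt V 0 1) (τ := 0)
    d1 le_rfl (ed_pos (T.ccw i0) _) (by rw [eQ]; simp) (fl_in_OE T.ccwV oQ (by rw [hφ]; exact cr_cs_pos (by linarith) (by linarith)) _)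
  have ev := mo_vert' T.ccw mQ v1 v2 v3 v4
  have hside := T.side oQ
  have c1 := cn_pos eQ l1
  have c2 := cn_pos hS.1 hl
  have Av := T.ang v (k+1)
  rcases lab012 (lab v (k+1)) with hv | hv | hv
  · -- label α at Q
    have nv : 1/2 < ‖ed (t v) k‖ := by
      rw [T.len]
      rcases ne0_cases (T.inj v) hv with ⟨_, h⟩ | ⟨_, h⟩
      · rw [f12] at h; rw [h]; simp [lf]; norm_num
      · rw [f12] at h; rw [h, hs]; simp [lf]; norm_num
    have hD := (dn_fl (T.ccw v) (dn_of (T.ccw v) v1 (τ := 1/2) (by norm_num) nv (by rw [ev]))).1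
    rw [← eG] at hD
    obtain ⟨w, m, w0, w1, w2⟩ := T.second hp h
    have w1' : dr (t w) m = cs (φ + α) := by rw [w1, hφ, cs_add]
    have hF : Fl (t w) (t i0 (j0+2)) (cs (φ + (π - β))) (-1) := by
      rcases ne0_cases (T.inj w) w2 with ⟨hb, hc⟩ | ⟨hb, hc⟩
      · -- b edge
        have nw : ‖ed (t w) m‖ = 3/4 := by have := T.len1 hs hb; rwa [f21] at this
        have ew : t w (m+1) = t i0 (j0+2) := by rw [next_pt (T.ccw w) m, nw, w1', w0, eG2]
        have Aw := T.ang w (m+1)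
        rw [hc, af2] at Aw
        have dw := dirs' Aw w1'
        rw [← ew]
        refine fl_in_vert (T.ccw w) ?_ ?_ _
        · rw [dw]; exact cr_cs_pos (by linarith) (by linarith)
        · rw [f11, w1']; exact cr_cs_pos (by linarith) (by linarith)
      · have nw : ‖ed (t w) m‖ = 1 := by have := T.len2 hb; rwa [f21] at this
        refine fl_in_OE (T.ccw w) (j := m) (OE_of (T.ccw w) (τ := 3/4) (by norm_num) (by rw [nw]; norm_num) ?_) ?_ _
        · rw [w0, w1', eG2]
        · rw [w1']; exact cr_cs_pos (by linarith) (by linarith)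
    have hvw := T.fl_uniq hD hF
    subst hvw
    have : k + 1 = m := T.inj v (hv.trans w2.symm)
    subst this
    have e5 : pt V 0 1 = V 0 := ev.symm.trans w0
    rw [pt] at e5
    exact dr_ne T.ccwV 0 (by simpa using e5)
  · exact v0 (T.cn_uniq (by omega) ev hv eQ l1)
  · have hvi := T.cn_uniq (by omega) ev hv hS.1 hl
    subst hvi
    have : k + 1 = j := T.inj v (hv.trans hl.symm)
    subst this
    rw [hv, af2] at Av
    have := dirs Av (hS.2.trans hφ)
    rw [f11] at this
    rw [v1] at this
    exact cs_ne_of (φ := φ + (2*α+β)) (ψ := φ + (π - β)) (by linarith) (by linarith) (neg_injective this).symm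
end
end TT

namespace TT
section
open Filter Topology

variable {N : ℕ} {α β : ℝ} {V : Fin 3 → ℂ} {t : Fin N → Fin 3 → ℂ} {lab : Fin N → Fin 3 → Fin 3}

lemma fnum {p q r n : ℕ} {s X : ℝ} (hs : s = 1/2) (e : X = p * s + q * (1 - s^2) + r) (hX : X = n / 4) :
    2 * p + 3 * q + 4 * r = n := by
  subst hs
  rw [hX] at e
  have : (2 * p + 3 * q + 4 * r : ℝ) = n := by linarith
  exact_mod_cast this

lemma LT.firstc (T : LT N α β V t lab) (hs : sv α = 1/2) {p n : ℕ} (hp : 2 ≤ p) (h : IsAng V 0 (p * α + (0:ℕ) * β))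
    (hg : cn t lab (V 1) 2 = ∅) (hX : 1 < ‖ed V 0‖) (hn : ‖ed V 0‖ - 3/4 = n / 4)
    (hb : ∀ p q r : ℕ, 2 * p + 3 * q + 4 * r = n → 1 ≤ r → False) :
    ∃ i0 j0, Sd V (t i0) 0 0 j0 ∧ t i0 j0 = V 0 ∧ lab i0 j0 = 0 ∧ lab i0 (j0+1) = 1 ∧ lab i0 (j0+2) = 2 ∧ ‖ed (t i0) j0‖ = 1 ∧
      ∀ i j, Sd V (t i) 0 1 j → lab i j ≠ 2 := by
  obtain ⟨i, j, hS, e, l0⟩ := T.first h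
  rcases ne0_cases (T.inj i) l0 with ⟨l2, l1⟩ | ⟨l2, l1⟩
  · exfalso
    have n0 : ‖ed (t i) j‖ = 3/4 := by have := T.len1 hs l2; rwa [f21] at this
    have g := T.ng le_rfl hS (by rw [n0]; linarith) l1
    have m := T.side_mo_sd le_rfl (by rw [n0]; linarith) hS
    rw [n0, zero_add] at g m
    obtain ⟨p, q, r, e, hr⟩ := T.formX (k := 0) (u := 3/4) hg (by norm_num) (by linarith) m g
    exact hb p q r (fnum hs e hn) hr
  · exact ⟨i, j, hS, e, l0, l1, l2, by have := T.len2 l2; rwa [f21] at this, T.lemL hs hp h hS l0 l1 hX⟩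

lemma LT.E7 (T : LT N α β V t lab) (hs : sv α = 1/2) {p : ℕ} (hp : 2 ≤ p) (h : IsAng V 0 (p * α + (0:ℕ) * β))
    (hg : cn t lab (V 1) 2 = ∅) (hX : ‖ed V 0‖ = 3/2) : False := by
  obtain ⟨i, j, hS, e, l0, l1, l2, n0, g⟩ := T.firstc hs (n := 3) hp h hg (by rw [hX]; norm_num) (by rw [hX]; norm_num)
    (by intros; omega)
  have m := T.side_mo_sd le_rfl (by rw [n0]; linarith) hS
  rw [n0, zero_add] at m
  obtain ⟨p, q, r, e, hr⟩ := T.formX (k := 0) (u := 1) hg (by norm_num) (by linarith) m g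
  have := fnum (n := 2) hs e (by rw [hX]; norm_num)
  omega

lemma LT.sideAB (T : LT N α β V t lab) (hs : sv α = 1/2) {p : ℕ} (hp : 2 ≤ p) (h : IsAng V 0 (p * α + (0:ℕ) * β))
    (h1 : IsAng V 1 ((0:ℕ) * α + (1:ℕ) * β)) (hX : ‖ed V 0‖ = 2) :
    (∃ i0 j0, Sd V (t i0) 0 0 j0 ∧ t i0 j0 = V 0 ∧ lab i0 j0 = 0 ∧ lab i0 (j0+1) = 1 ∧ lab i0 (j0+2) = 2) ∧
    (∃ i j, t i j = V 1 ∧ dr (t i) j = dr V 1 ∧ lab i j = 1 ∧ lab i (j+1) = 2 ∧ lab i (j+2) = 0 ∧ t i (j+2) = pt V 0 1) := by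
  obtain ⟨k1, k2⟩ := T.cnt h1
  have hg0 : cn t lab (V 1) 0 = ∅ := Finset.card_eq_zero.1 (by omega)
  have hg : cn t lab (V 1) 2 = ∅ := Finset.card_eq_zero.1 (by omega)
  obtain ⟨i, j, hS, e, l0, l1, l2, n0, g⟩ := T.firstc hs (n := 5) hp h hg (by rw [hX]; norm_num) (by rw [hX]; norm_num)
    (by intros; omega)
  refine ⟨⟨i, j, hS, e, l0, l1, l2⟩, ?_⟩
  have m := T.side_mo_sd le_rfl (by rw [n0]; linarith) hS
  rw [n0, zero_add] at m
  obtain ⟨v, k, hv⟩ := T.toTl.sd_ex (k := 0) (u := 1) (by norm_num) (by linarith) m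
  have gv := g v k hv
  rcases lab012 (lab v (k+2)) with hl | hl | hl
  · exfalso
    have nv : ‖ed (t v) k‖ = 1/2 := by have := T.len0 hs hl; rwa [f21] at this
    have lv : lab v (k+1) = 2 := by
      rcases ne0_cases (T.inj v) hl with ⟨_, h⟩ | ⟨_, h⟩
      · rw [f21] at h; exact absurd h gv
      · rename_i h'; rw [f22] at h'; exact h'
    have g' := T.ng (by norm_num) hv (by rw [nv]; linarith) lv
    have m' := T.side_mo_sd (by norm_num) (by rw [nv]; linarith) hv
    rw [nv] at g' m'
    obtain ⟨p, q, r, e, hr⟩ := T.formX (k := 0) hg (by norm_num) (by linarith) m' g'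
    have := fnum (n := 2) hs e (by rw [hX]; norm_num)
    omega
  · exfalso
    have nv : ‖ed (t v) k‖ = 3/4 := by have := T.len1 hs hl; rwa [f21] at this
    have m' := T.side_mo_sd (by norm_num) (by rw [nv]; linarith) hv
    rw [nv] at m'
    obtain ⟨n, hn⟩ := T.par.nb (‖ed V 0‖ - (1 + 3/4))
    obtain ⟨p, q, r, e⟩ := T.form0 (k := 0) (Y := ‖ed V 0‖) (by rw [pt_end T.ccwV]; exact T.corner_mo _) le_rfl n _ (by norm_num) (by linarith) m' hn
    have := fnum (n := 1) hs e (by rw [hX]; norm_num)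
    omega
  · have nv : ‖ed (t v) k‖ = 1 := by have := T.len2 hl; rwa [f21] at this
    have ev : t v (k+1) = V 1 := by
      rw [sd_end (T.ccw v) hv, nv, show (1:ℝ)+1 = ‖ed V 0‖ by rw [hX]; norm_num, pt_end T.ccwV]; simp
    have lv : lab v (k+1) = 1 := by
      rcases lab012 (lab v (k+1)) with h | h | h
      · exact absurd h (lab_mem ev hg0)
      · exact h
      · exact absurd h (lab_mem ev hg)
    have lk : lab v k = 0 := by
      rcases ne1_cases (T.inj v) lv with ⟨h, h'⟩ | ⟨h, h'⟩
      · rwa [f11] at h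
      · rw [f12, hl] at h'; exact absurd h' (by decide)
    have A := T.ang v (k+1)
    rw [lv, af1] at A
    refine ⟨v, k+1, ev, ?_, lv, by rwa [f12], by rwa [f11], by rw [f11]; exact hv.1⟩
    have q1 := A.2.2
    have q2 := h1.2.2
    rw [f11, hv.2] at q1
    rw [show (1:Fin 3)+2 = 0 from rfl, q1] at q2
    simp at q2
    rcases q2 with h | h
    · exact h
    · exact absurd h (cs_ne _)
end
end TT

namespace TT
section
open Filter Topology

variable {N : ℕ} {α β : ℝ} {V : Fin 3 → ℂ} {t : Fin N → Fin 3 → ℂ} {lab : Fin N → Fin 3 → Fin 3}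

lemma LT.E11a (T : LT N α β V t lab) (hs : sv α = 1/2) (h : IsAng V 0 ((3:ℕ) * α + (0:ℕ) * β))
    (h1 : IsAng V 1 ((0:ℕ) * α + (1:ℕ) * β)) (hX : ‖ed V 0‖ = 2) (hX1 : ‖ed V 1‖ = 11/4)
    (hC : ∃ i j, Sd V (t i) 1 (9/4) j ∧ lab i j = 2)
    {i2 : Fin N} {j2 : Fin 3} (e2 : t i2 j2 = V 0) (d2 : dr (t i2) j2 = dr V 0 * cs α) (n2 : ‖ed (t i2) j2‖ = 1) : False := by
  have a0 := T.par.a0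
  have b0 := T.par.b0
  have hsum := T.par.sum
  obtain ⟨⟨i1, j1, hS, e1, l10, l11, l12⟩, iB, jB, eB, dB, lB0, lB1, lB2, eBQ⟩ := T.sideAB hs (by norm_num) h h1 hX
  obtain ⟨φ, hφ⟩ := ex_cs (norm_dr T.ccwV 0)
  have d10 : dr (t i1) j1 = cs φ := hS.2.trans hφ
  rw [hφ, ← cs_add] at d2
  have hξ : dr V 1 = cs (φ + (π - β)) := by
    have := dirs' (P := V) (j := 0) (A := (0:ℕ) * α + (1:ℕ) * β) h1 hφ
    simpa using this
  have A10 := T.ang i1 j1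
  have A11 := T.ang i1 (j1+1)
  rw [l10, af0] at A10
  rw [l11, af1] at A11
  have d12 := dirs A10 d10
  have d11 := dirs' A11 d10
  have n10 : ‖ed (t i1) j1‖ = 1 := by have := T.len2 l12; rwa [f21] at this
  have n11 := T.len0 hs l10
  have n12 : ‖ed (t i1) (j1+2)‖ = 3/4 := by have := T.len1 hs l11; rwa [f12] at this
  have eQ : t i1 (j1+1) = pt V 0 1 := by rw [sd_end (T.ccw i1) hS, n10]; simp
  have oQ : OE V 0 (pt V 0 1) := pt_OE T.ccwV one_pos (by linarith)
  have mQ := T.side_mo oQ eQ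
  obtain ⟨K, hK⟩ : ∃ K, K = t i1 (j1+2) := ⟨_, rfl⟩
  have eK : K = pt V 0 1 + (1/2:ℝ) * cs (φ + (π - β)) := by
    have := next_pt (T.ccw i1) (j1+1)
    rw [f12, n11, d11, eQ] at this; rw [hK]; exact this
  have eK2 : K = V 0 + (3/4:ℝ) * cs (φ + α) := by
    have := next_pt (T.ccw i1) (j1+2)
    rw [f21, n12, d12, e1] at this; rw [hK, this]; ring
  have oK : OE (t i2) j2 K := OE_of (T.ccw i2) (τ := 3/4) (by norm_num) (by rw [n2]; norm_num) (by rw [eK2, e2, d2])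
  have mK : i2 ∈ mo t K := mem_mo.2 ⟨j2, oK⟩
  have sK := T.inner_of hK.symm mK
  have iK := T.inner sK
  have mK1 : 1 ≤ (mo t K).card := Finset.card_pos.2 ⟨i2, mK⟩
  -- tile u
  obtain ⟨u, ju, σ, u0, u1, u2, u3, u4⟩ := T.toTl.across (i := i1) (j := j1+1) (ζ := cs (φ + (π - β))) (x := pt V 0 1) (τ := 0)
    d11 le_rfl (ed_pos (T.ccw i1) _) (by rw [eQ]; simp) (fl_in_OE T.ccwV oQ (by rw [hφ]; exact cr_cs_pos (by linarith) (by linarith)) _)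
  have eu := mo_vert' T.ccw mQ u1 u2 u3 u4
  have nu' : ¬ 1/2 < ‖ed (t u) ju‖ := by
    intro hn
    have hD := (dn_fl (T.ccw u) (dn_of (T.ccw u) u1 (τ := 1/2) (by norm_num) hn (by rw [eu]))).1
    rw [← eK] at hD
    have hF : Fl (t i2) K (cs (φ + (π - β))) (-1) := fl_in_OE (T.ccw i2) oK (by rw [d2]; exact cr_cs_pos (by linarith) (by linarith)) _
    have := T.fl_uniq hD hF
    subst this
    have := vert_mem (T.ccw u) (ju+1) j2
    rw [eu, e2, ed_dr (T.ccw u) j2, n2, d2, pt, hφ] at this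
    have e : V 0 + ((1:ℝ):ℂ) * cs φ - V 0 = cs φ := by push_cast; ring
    rw [e, cr_smul_l, cr_swap] at this
    have := cr_cs_pos (φ := φ) (ψ := φ + α) (by linarith) (by linarith)
    linarith
  have lu2 : lab u (ju+2) = 0 := by
    rw [T.len] at nu'
    rcases lab012 (lab u (ju+2)) with h | h | h
    · exact h
    · rw [h, hs] at nu'; simp [lf] at nu'; norm_num at nu'
    · rw [h] at nu'; simp [lf] at nu'; norm_num at nu'
  have nu : ‖ed (t u) ju‖ = 1/2 := by have := T.len0 hs lu2; rwa [f21] at this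
  have euK : t u ju = K := by
    have := next_pt (T.ccw u) ju
    rw [eu, nu, u1] at this; rw [eK, this]; ring
  have lu : lab u ju = 1 ∧ lab u (ju+1) = 2 := by
    rcases ne0_cases (T.inj u) lu2 with ⟨h, h'⟩ | ⟨h, h'⟩
    · rw [f22] at h; rw [f21] at h'
      exfalso
      refine u0 (T.cn_uniq ?_ euK h' hK.symm l12)
      omega
    · rw [f22] at h; rw [f21] at h'; exact ⟨h', h⟩
  obtain ⟨lu0, lu1⟩ := lu
  have u1' : dr (t u) ju = cs (φ - β) := by rw [u1, show φ + (π - β) = φ - β + π by ring, cs_add_pi, neg_neg]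
  have Au0 := T.ang u ju
  have Au1 := T.ang u (ju+1)
  rw [lu0, af1] at Au0
  rw [lu1, af2] at Au1
  have du1 := dirs' Au1 u1'
  have du2 := dirs Au0 u1'
  rw [show φ - β + (π - (2*α+β)) = φ + α by linarith] at du1
  rw [sub_add_cancel] at du2
  have nu1 := T.len1 hs lu0
  have nu2 : ‖ed (t u) (ju+2)‖ = 1 := by have := T.len2 lu1; rwa [f12] at this
  -- R
  have nB0 : ‖ed (t iB) jB‖ = 1/2 := by have := T.len0 hs lB2; rwa [f21] at this
  have nB1 := T.len1 hs lB0
  have AB1 := T.ang iB (jB+1)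
  rw [lB1, af2] at AB1
  have dB' : dr (t iB) jB = cs (φ + (π - β)) := dB.trans hξ
  have dB1 := dirs' AB1 dB'
  rw [show φ + (π - β) + (π - (2*α+β)) = φ + α + π by linarith, cs_add_pi] at dB1
  obtain ⟨R, hR⟩ : ∃ R, R = pt V 1 (1/2) := ⟨_, rfl⟩
  have eBR : t iB (jB+1) = R := by rw [next_pt (T.ccw iB) jB, eB, nB0, dB, hR, pt]
  have euR : t u (ju+2) = R := by
    have q1 := next_pt (T.ccw u) (ju+1)
    have q2 := next_pt (T.ccw iB) (jB+1)
    rw [f12, eu, nu1, du1] at q1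
    rw [f12, eBQ, nB1, dB1, eBR] at q2
    rw [q1, q2]; ring
  have eKR : K = R - cs φ := by
    have := next_pt (T.ccw u) (ju+2)
    rw [f21, euR, euK, nu2, du2] at this
    rw [this]; push_cast; ring
  have oR : OE V 1 R := by rw [hR]; exact pt_OE T.ccwV (by norm_num) (by linarith)
  have mR := T.side_mo oR euR
  have cR := T.side oR
  have cR0 := cn_pos euR lu2
  have cR2 := cn_pos eBR lB1
  obtain ⟨w, jw, hw⟩ := T.toTl.sd_ex (k := 1) (u := 1/2) (by norm_num) (by linarith) (by rw [← hR]; exact mR)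
  have ew : t w jw = R := by rw [hw.1, hR]
  have lw : lab w jw = 1 := by
    rcases lab012 (lab w jw) with hl | hl | hl
    · exfalso
      have := T.cn_uniq (by omega) ew hl euR lu2
      subst this
      have := T.inj w (hl.trans lu2.symm)
      subst this
      have q := hw.2
      rw [du2, hξ, ← cs_add_pi] at q
      exact cs_ne_of (by linarith) (by linarith) q.symm
    · exact hl
    · exfalso
      have := T.cn_uniq (by omega) ew hl eBR lB1
      subst this
      have := sd_ne (T.ccw w) hw (v := 0) (j' := jB) ⟨by rw [eB, pt_zero], dB⟩
      subst this
      rw [hl] at lB0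
      exact absurd lB0 (by decide)
  have lw2 : lab w (jw+2) = 2 ∧ lab w (jw+1) = 0 := by
    rcases ne1_cases (T.inj w) lw with ⟨g1, g2⟩ | g
    · exfalso
      have nw : ‖ed (t w) jw‖ = 1/2 := by have := T.len0 hs g1; rwa [f21] at this
      have ng := T.ng (by norm_num) hw (by rw [nw]; linarith) g2
      have nm := T.side_mo_sd (by norm_num) (by rw [nw]; linarith) hw
      rw [nw] at ng nm
      obtain ⟨iC, jC, sC, lC⟩ := hC
      obtain ⟨n, hn⟩ := T.par.nb (9/4 - (1/2 + 1/2))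
      have oC : OE V 1 (pt V 1 (9/4)) := pt_OE T.ccwV (by norm_num) (by linarith)
      rcases T.form1 (k := 1) (Y := 9/4) (T.side_mo oC sC.1) (by linarith) n _ (by norm_num) (by norm_num) nm hn ng with
        ⟨p, q, r, e, hr⟩ | ⟨i, j, v, q1, q2, q3⟩
      · have := fnum (n := 5) hs e (by norm_num)
        omega
      · have := T.side_gg oC (by rw [sd_end (T.ccw i) q1, q2]) sC.1 q3 lC
        subst this
        have := sd_ne (T.ccw i) q1 sC
        subst this
        have := T.inj i (q3.trans lC.symm)
        revert this; clear * -; fin_cases j <;> simp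
    · exact g
  obtain ⟨lw2, lw1⟩ := lw2
  have Aw := T.ang w jw
  rw [lw, af1] at Aw
  have dw := dirs Aw (hw.2.trans hξ)
  rw [show φ + (π - β) + β = φ + π by ring, cs_add_pi, neg_neg] at dw
  have nw : ‖ed (t w) (jw+2)‖ = 1/2 := by have := T.len0 hs lw1; rwa [f12] at this
  have ew2 : t w (jw+2) = K + (1/2:ℝ) * cs φ := by
    have := next_pt (T.ccw w) (jw+2)
    rw [f21, ew, nw, dw] at this
    rw [eKR, this]; push_cast; ring
  -- tile y
  obtain ⟨y, jy, σ', y0, y1, y2, y3, y4⟩ := T.toTl.across' (i := u) (j := ju+2) (ζ := cs φ) (x := K) (τ := 0)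
    du2 le_rfl (ed_pos (T.ccw u) _) (by rw [f21, euK]; simp) (fun j => Or.inl (sK j))
  have cK1 := cn_pos euK lu0
  have cK2 := cn_pos hK.symm l12
  have yK : t y jy = K := by
    rcases y2.eq_or_lt with q | q
    · rw [y4, ← q]; simp
    · exfalso
      have oy : OE (t y) jy K := OE_of (T.ccw y) q y3 (by rw [y1]; exact y4)
      have := Finset.card_le_one.1 (show (mo t K).card ≤ 1 by omega) y (mem_mo.2 ⟨jy, oy⟩) i2 mK
      subst this
      have := OE_uniq (T.ccw y) oy oK
      subst this
      rw [y1] at d2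
      exact cs_ne_of (by linarith) (by linarith) d2
  rcases lab012 (lab y jy) with hl | hl | hl
  · have ny : 6/10 < ‖ed (t y) jy‖ := by
      rw [T.len]
      rcases ne0_cases (T.inj y) hl with ⟨h, _⟩ | ⟨h, _⟩
      · rw [h, hs]; simp [lf]; norm_num
      · rw [h]; simp [lf]; norm_num
    have U1 := up_of (T.ccw y) y1 (τ := 6/10) (by norm_num) ny rfl
    have U2 := up_of (T.ccw w) dw (τ := 1/10) (x := t y jy + ((6/10:ℝ):ℂ) * cs φ) (by norm_num) (by rw [nw]; norm_num)
      (by rw [yK, ew2]; push_cast; ring)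
    have := T.fl_uniq (up_fl (T.ccw y) U1).1 (up_fl (T.ccw w) U2).1
    subst this
    have q1 := ed_dr (T.ccw y) jy
    have q2 := ed_dr (T.ccw y) (jw+2)
    rw [y1] at q1
    rw [dw] at q2
    have := par_uniq (T.ccw y) q1 q2
    subst this
    rw [yK] at ew2
    exact cs_ne φ (by simpa using ew2)
  · exact y0 (T.cn_uniq (by omega) yK hl euK lu0)
  · have := T.cn_uniq (by omega) yK hl hK.symm l12
    subst this
    have := T.inj y (hl.trans l12.symm)
    subst this
    rw [y1] at d12
    have : cs (φ + π) = cs (φ + α) := by rw [cs_add_pi, d12, neg_neg]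
    exact cs_ne_of (by linarith) (by linarith) this.symm
end
end TT

namespace TT
section
open Filter Topology

variable {N : ℕ} {α β : ℝ} {V : Fin 3 → ℂ} {t : Fin N → Fin 3 → ℂ} {lab : Fin N → Fin 3 → Fin 3}

lemma norm_cj (P : Fin 3 → ℂ) (j : Fin 3) : ‖ed (cj P) j‖ = ‖ed P (-j+2)‖ := by
  rw [ed_cj, norm_neg, Complex.norm_conj]

lemma conj_inj {x y : ℂ} (h : (starRingEnd ℂ) x = (starRingEnd ℂ) y) : x = y := (starRingEnd ℂ).injective h

lemma LT.hC (T : LT N α β V t lab) (hs : sv α = 1/2) (h : IsAng V 0 ((3:ℕ) * α + (0:ℕ) * β))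
    (h2 : IsAng V 2 ((0:ℕ) * α + (1:ℕ) * β)) (hX : ‖ed V 2‖ = 2) (hX1 : ‖ed V 1‖ = 11/4) :
    ∃ i j, Sd V (t i) 1 (9/4) j ∧ lab i j = 2 := by
  obtain ⟨_, i, j, q1, q2, q3, q4, q5, _⟩ := T.conj.sideAB hs (p := 3) (by norm_num) (ang_cj (j := 0) h) (ang_cj (j := 1) h2)
    (by rw [norm_cj]; exact hX)
  rw [fneg1] at q4
  rw [fneg2] at q5
  have e : t i (-j) = V 2 := conj_inj q1
  have d : dr (t i) (-j+2) = dr V 1 := by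
    rw [dr_cj, dr_cj] at q2
    exact conj_inj (neg_injective q2)
  have n : ‖ed (t i) (-j+2)‖ = 1/2 := by have := T.len0 hs q5; rwa [f12] at this
  refine ⟨i, -j+2, ⟨?_, d⟩, q4⟩
  have g1 := next_pt (T.ccw i) (-j+2)
  have g2 := next_pt T.ccwV 1
  rw [f21, e, n, d] at g1
  rw [show (1:Fin 3)+1 = 2 from rfl, g1, hX1] at g2
  rw [pt]
  have : t i (-j+2) = V 1 + ((11/4:ℝ):ℂ) * dr V 1 - ((1/2:ℝ):ℂ) * dr V 1 := by rw [← g2]; ring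
  rw [this]; push_cast; ring

lemma LT.E11 (T : LT N α β V t lab) (hs : sv α = 1/2) (h : IsAng V 0 ((3:ℕ) * α + (0:ℕ) * β))
    (h1 : IsAng V 1 ((0:ℕ) * α + (1:ℕ) * β)) (h2 : IsAng V 2 ((0:ℕ) * α + (1:ℕ) * β))
    (hX : ‖ed V 0‖ = 2) (hX1 : ‖ed V 1‖ = 11/4) (hX2 : ‖ed V 2‖ = 2) : False := by
  obtain ⟨i, j, e, d, l⟩ := T.second (p := 3) (by norm_num) h
  rcases ne0_cases (T.inj i) l with ⟨l2, l1⟩ | ⟨l2, l1⟩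
  · have n : ‖ed (t i) (j+2)‖ = 1 := by have := T.len2 l1; rwa [f12] at this
    have g0 : IsAng (cj V) 0 ((3:ℕ) * α + (0:ℕ) * β) := ang_cj (j := 0) h
    have g1 : IsAng (cj V) 1 ((0:ℕ) * α + (1:ℕ) * β) := ang_cj (j := 1) h2
    have g2 : IsAng (cj V) 2 ((0:ℕ) * α + (1:ℕ) * β) := ang_cj (j := 2) h1
    have n0 : ‖ed (cj V) 0‖ = 2 := by rw [norm_cj]; exact hX2
    have n1 : ‖ed (cj V) 1‖ = 11/4 := by rw [norm_cj]; exact hX1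
    have n2 : ‖ed (cj V) 2‖ = 2 := by rw [norm_cj]; exact hX
    refine T.conj.E11a hs g0 g1 n0 n1 (T.conj.hC hs g0 g2 n2 n1) (i2 := i) (j2 := -j) ?_ ?_ ?_
    · simp [cj, e]
    · rw [dr_cj, dr_cj, neg_neg]
      have A := T.ang i j
      rw [l, af0] at A
      have q1 := A.2.2
      have q2 := h.2.2
      rw [d] at q1
      rw [show (0:Fin 3)+2 = 2 from rfl] at q2
      rw [show -(0:Fin 3)+2 = 2 from rfl, ← map_neg, ← map_neg, q1, q2]
      have c1 : (starRingEnd ℂ) (cs α) * cs α = 1 := by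
        rw [mul_comm, Complex.mul_conj, Complex.normSq_eq_norm_sq, norm_cs]; simp
      rw [show (((3:ℕ):ℝ) * α + ((0:ℕ):ℝ) * β) = α + α + α by push_cast; ring, cs_add, cs_add]
      simp only [map_mul]
      linear_combination (-(starRingEnd ℂ) (dr V 0) * (starRingEnd ℂ) (cs α) * (starRingEnd ℂ) (cs α)) * c1
    · rw [norm_cj, neg_neg]; exact n
  · have n : ‖ed (t i) j‖ = 1 := by have := T.len2 l2; rwa [f21] at this
    exact T.E11a hs h h1 hX hX1 (T.hC hs h h2 hX2 hX1) e d n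
end
end TT

namespace TT
section
open Filter Topology

variable {N : ℕ} {α β : ℝ} {V : Fin 3 → ℂ} {t : Fin N → Fin 3 → ℂ} {lab : Fin N → Fin 3 → Fin 3}

lemma LT.pack (T : LT N α β V t lab) {p0 q0 p1 q1 p2 q2 : ℕ} (h0 : IsAng V 0 (p0 * α + q0 * β))
    (h1 : IsAng V 1 (p1 * α + q1 * β)) (h2 : IsAng V 2 (p2 * α + q2 * β)) :
    ∃ μ, 0 < μ ∧ ‖ed V 0‖ = μ * sin (p2 * α + q2 * β) ∧ ‖ed V 1‖ = μ * sin (p0 * α + q0 * β) ∧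
      ‖ed V 2‖ = μ * sin (p1 * α + q1 * β) ∧
      N*(kv α*(sv α*(1-sv α^2))) = ‖ed V 0‖*‖ed V 1‖*sin (p1 * α + q1 * β) ∧
      (∃ M : ℤ, |M| ≤ N ∧ ‖ed V 0‖ - (-1) ^ (p1 + q1) * ‖ed V 1‖
      - (-1) ^ (p0 + q0) * ‖ed V 2‖ = M * ((2 - sv α) * (1 + sv α))) ∧
      (∃ M : ℤ, |M| ≤ N ∧ ‖ed V 0‖ - (-1) ^ (p1 + q1) * (-1) ^ q1 * ‖ed V 1‖
      - (-1) ^ (p0 + q0) * (-1) ^ q0 * ‖ed V 2‖ = M * ((1 - sv α) * (2 + sv α))) := by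
  obtain ⟨P, rfl, rfl, rfl⟩ : ∃ P : Fin 3 → ℕ, P 0 = p0 ∧ P 1 = p1 ∧ P 2 = p2 := ⟨![p0,p1,p2], rfl, rfl, rfl⟩
  obtain ⟨Q, rfl, rfl, rfl⟩ : ∃ P : Fin 3 → ℕ, P 0 = q0 ∧ P 1 = q1 ∧ P 2 = q2 := ⟨![q0,q1,q2], rfl, rfl, rfl⟩
  have hA : ∀ k, IsAng V k (P k * α + Q k * β) := by
    intro k
    match k with
    | 0 => exact h0
    | 1 => exact h1
    | 2 => exact h2
  obtain ⟨μ, m0, hm⟩ := sides_mu T.ccwV hA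
  have m1 := hm 0
  have m2 := hm 1
  have m3 := hm 2
  rw [show (0:Fin 3)+2=2 from rfl] at m1
  rw [show (1:Fin 3)+2=0 from rfl] at m2
  rw [show (2:Fin 3)+2=1 from rfl] at m3
  have ar := T.area hA
  refine ⟨μ, m0, m1, m2, m3, ar, ?_, ?_⟩
  · obtain ⟨M, hM, e⟩ := T.color hA (ε := 1) (Or.inl rfl)
    refine ⟨M, hM, ?_⟩
    simp only [one_pow, mul_one] at e
    rw [e]; ring
  · obtain ⟨M, hM, e⟩ := T.color hA (ε := -1) (Or.inr rfl)
    refine ⟨M, hM, ?_⟩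
    rw [e]; ring

lemma QQ1 (hN : N < 12) : QQ N α β (3,0) (0,1) (0,1) := by
  intro V t lab T h0 h1 h2
  exfalso
  obtain ⟨μ, m0, e0, e1, e2, ar, ⟨M1, _, c1⟩, M2, b2, c2⟩ := T.pack h0 h1 h2
  have s0 := T.par.s0
  have s1 := T.par.s1
  have k0 := T.par.k0
  have g1 := T.par.sin3a
  have g2 := T.par.sinb
  simp only [Nat.cast_zero, Nat.cast_one, Nat.cast_ofNat, zero_mul, one_mul, add_zero, zero_add, g1, g2] at e0 e1 e2 ar
  rw [e0, e1, e2] at c1 c2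
  rw [e0, e1] at ar
  have hs : sv α ≠ 0 := s0.ne'
  have hk : kv α ≠ 0 := k0.ne'
  have q0 : 0 < 1 - sv α ^ 2 := by nlinarith
  obtain ⟨l, hl⟩ : ∃ l, l = μ * kv α * (1 - sv α ^ 2) := ⟨_, rfl⟩
  have l0 : 0 < l := by rw [hl]; positivity
  have k1 : l * (1 + sv α) = M1 := by
    apply mul_right_cancel₀ (b := (2 - sv α) * (1 + sv α)) (mul_pos (by linarith) (by linarith)).ne'
    rw [← c1, hl]; norm_num; ring
  have k2 : l * (1 - sv α) = M2 := by
    apply mul_right_cancel₀ (b := (1 - sv α) * (2 + sv α)) (mul_pos (by linarith) (by linarith)).ne'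
    rw [← c2, hl]; norm_num; ring
  have k3 : (N:ℝ) = l ^ 2 * (3 - sv α ^ 2) := by
    apply mul_right_cancel₀ (b := kv α * (sv α * (1 - sv α ^ 2))) (by positivity)
    rw [ar, hl]; ring
  obtain ⟨_, a2, a3⟩ := alg1 s0 s1 l0 k3 k1 k2 hN
  rw [a2] at hl e1 e0 e2
  refine T.E11 a2 h0 h1 h2 ?_ ?_ ?_
  · rw [e0]; linarith
  · have : l * 11 / 8 = 11/4 := by rw [a3]; norm_num
    rw [e1, ← this, hl]; ring
  · rw [e2]; linarith

lemma QQ2 (hN : N < 12) : QQ N α β (1,2) (1,0) (1,0) := by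
  intro V t lab T h0 h1 h2
  exfalso
  obtain ⟨μ, m0, e0, e1, e2, ar, ⟨M1, _, c1⟩, M2, b2, c2⟩ := T.pack h0 h1 h2
  have s0 := T.par.s0
  have s1 := T.par.s1
  have k0 := T.par.k0
  have g1 := T.par.sina2b
  have g2 := T.par.sina
  simp only [Nat.cast_zero, Nat.cast_one, Nat.cast_ofNat, zero_mul, one_mul, add_zero, zero_add, g1, g2] at e0 e1 e2 ar
  rw [e0, e1, e2] at c1 c2
  rw [e0, e1] at ar
  have hs : sv α ≠ 0 := s0.ne'
  have hk : kv α ≠ 0 := k0.ne'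
  obtain ⟨l, hl⟩ : ∃ l, l = μ * kv α * sv α := ⟨_, rfl⟩
  have l0 : 0 < l := by rw [hl]; positivity
  have k1 : l * (2 + sv α) = M1 * (1 + sv α) := by
    apply mul_right_cancel₀ (b := (2 - sv α)) (by linarith : (0:ℝ) < _).ne'
    norm_num at c1
    rw [hl]; linear_combination c1
  have k2 : l * (2 - sv α) = M2 * (1 - sv α) := by
    apply mul_right_cancel₀ (b := (2 + sv α)) (by linarith : (0:ℝ) < _).ne'
    norm_num at c2
    rw [hl]; linear_combination c2
  have k3 : (N:ℝ) * (1 - sv α ^ 2) = l ^ 2 * (2 - sv α ^ 2) := by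
    apply mul_right_cancel₀ (b := kv α * sv α) (by positivity)
    rw [hl]; linear_combination ar
  exact alg2 s0 s1 l0 k3 k1 k2 hN b2

lemma QQ3 (hN : N < 12) : QQ N α β (2,0) (0,2) (1,0) := by
  intro V t lab T h0 h1 h2
  exfalso
  obtain ⟨μ, m0, e0, e1, e2, ar, ⟨M1, _, c1⟩, M2, b2, c2⟩ := T.pack h0 h1 h2
  have s0 := T.par.s0
  have s1 := T.par.s1
  have k0 := T.par.k0
  have g1 := T.par.sin2a
  have g2 := T.par.sina
  have g3 := T.par.sin2b
  simp only [Nat.cast_zero, Nat.cast_one, Nat.cast_ofNat, zero_mul, one_mul, add_zero, zero_add, g1, g2, g3] at e0 e1 e2 ar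
  rw [e0, e1, e2] at c1 c2
  rw [e0, e1] at ar
  have hs : sv α ≠ 0 := s0.ne'
  have hk : kv α ≠ 0 := k0.ne'
  have q0 : 0 < 1 - sv α ^ 2 := by nlinarith
  obtain ⟨l, hl⟩ : ∃ l, l = μ * kv α * sv α := ⟨_, rfl⟩
  have l0 : 0 < l := by rw [hl]; positivity
  have k1 : l * (1 - sv α) * (2 + sv α) = ((-M1 : ℤ):ℝ) := by
    apply mul_right_cancel₀ (b := (2 - sv α) * (1 + sv α)) (mul_pos (by linarith) (by linarith)).ne'
    norm_num at c1
    rw [hl]; push_cast; linear_combination -c1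
  have k2 : l * (1 + sv α) * (2 - sv α) = ((-M2 : ℤ):ℝ) := by
    apply mul_right_cancel₀ (b := (1 - sv α) * (2 + sv α)) (mul_pos (by linarith) (by linarith)).ne'
    norm_num at c2
    rw [hl]; push_cast; linear_combination -c2
  have k3 : (N:ℝ) = l ^ 2 * (2 - sv α ^ 2) * (3 - sv α ^ 2) := by
    apply mul_right_cancel₀ (b := kv α * sv α * (1 - sv α ^ 2)) (by positivity)
    rw [hl]; linear_combination ar
  exact alg3 s0 s1 l0 k3 k1 k2 hN

lemma QQ4 (hN : N < 12) : QQ N α β (2,0) (1,1) (0,1) := by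
  intro V t lab T h0 h1 h2
  exfalso
  obtain ⟨μ, m0, e0, e1, e2, ar, ⟨M1, _, c1⟩, _⟩ := T.pack h0 h1 h2
  have z0 := T.cnt h0
  have z1 := T.cnt h1
  have z2 := T.cnt h2
  have hg : ∀ k, cn t lab (V k) 2 = ∅ := by
    change 2 = _ ∧ 0 = _ at z0
    change 1 = _ ∧ 1 = _ at z1
    change 0 = _ ∧ 1 = _ at z2
    have w0 : cn t lab (V 0) 2 = ∅ := Finset.card_eq_zero.1 (by omega)
    have w1 : cn t lab (V 1) 2 = ∅ := Finset.card_eq_zero.1 (by omega)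
    have w2 : cn t lab (V 2) 2 = ∅ := Finset.card_eq_zero.1 (by omega)
    intro k; fin_cases k
    · exact w0
    · exact w1
    · exact w2
  obtain ⟨p, q, r, f1, f2⟩ := T.side_form hg 2
  have s0 := T.par.s0
  have s1 := T.par.s1
  have k0 := T.par.k0
  have g1 := T.par.sin2a
  have g2 := T.par.sinb
  have g3 := T.par.sinab
  simp only [Nat.cast_zero, Nat.cast_one, Nat.cast_ofNat, zero_mul, one_mul, add_zero, zero_add, g1, g2, g3] at e0 e1 e2 ar
  rw [e0, e1, e2] at c1
  rw [e0, e1] at ar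
  have hs : sv α ≠ 0 := s0.ne'
  have hk : kv α ≠ 0 := k0.ne'
  have q0 : 0 < 1 - sv α ^ 2 := by nlinarith
  obtain ⟨l, hl⟩ : ∃ l, l = μ * kv α := ⟨_, rfl⟩
  have l0 : 0 < l := by rw [hl]; positivity
  have k1 : l * sv α = ((-M1 : ℤ):ℝ) := by
    apply mul_right_cancel₀ (b := (2 - sv α) * (1 + sv α)) (mul_pos (by linarith) (by linarith)).ne'
    norm_num at c1
    rw [hl]; push_cast; linear_combination -c1
  have k3 : (N:ℝ) = l ^ 2 * (2 - sv α ^ 2) := by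
    apply mul_right_cancel₀ (b := kv α * sv α * (1 - sv α ^ 2)) (by positivity)
    rw [hl]; linear_combination ar
  obtain ⟨_, a2, a3⟩ := alg4 s0 s1 l0 k3 k1 (by rw [hl, ← e2, f1]) f2 hN
  refine T.E7 a2 (p := 2) le_rfl h0 (hg 1) ?_
  rw [a2] at e0
  have : l * 3 / 4 = 3/2 := by rw [a3]; norm_num
  rw [e0, ← this, hl]; ring

lemma QQ5 (hN : N < 12) : QQ N α β (1,1) (1,1) (1,0) := by
  intro V t lab T h0 h1 h2
  exfalso
  obtain ⟨μ, m0, e0, e1, e2, ar, ⟨M1, _, c1⟩, M2, b2, c2⟩ := T.pack h0 h1 h2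
  have z0 := T.cnt h0
  have z1 := T.cnt h1
  have z2 := T.cnt h2
  have hg : ∀ k, cn t lab (V k) 2 = ∅ := by
    change 1 = _ ∧ 1 = _ at z0
    change 1 = _ ∧ 1 = _ at z1
    change 1 = _ ∧ 0 = _ at z2
    have w0 : cn t lab (V 0) 2 = ∅ := Finset.card_eq_zero.1 (by omega)
    have w1 : cn t lab (V 1) 2 = ∅ := Finset.card_eq_zero.1 (by omega)
    have w2 : cn t lab (V 2) 2 = ∅ := Finset.card_eq_zero.1 (by omega)
    intro k; fin_cases k
    · exact w0
    · exact w1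
    · exact w2
  obtain ⟨p, q, r, f1, f2⟩ := T.side_form hg 0
  have s0 := T.par.s0
  have s1 := T.par.s1
  have k0 := T.par.k0
  have g2 := T.par.sina
  have g3 := T.par.sinab
  simp only [Nat.cast_zero, Nat.cast_one, zero_mul, one_mul, add_zero, g2, g3] at e0 e1 e2 ar
  rw [e0, e1, e2] at c1 c2
  rw [e0, e1] at ar
  have hs : sv α ≠ 0 := s0.ne'
  have hk : kv α ≠ 0 := k0.ne'
  obtain ⟨l, hl⟩ : ∃ l, l = μ * kv α := ⟨_, rfl⟩
  have l0 : 0 < l := by rw [hl]; positivity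
  have k1 : l = ((-M1 : ℤ):ℝ) * (1 + sv α) := by
    apply mul_right_cancel₀ (b := (2 - sv α)) (by linarith : (0:ℝ) < _).ne'
    norm_num at c1
    rw [hl]; push_cast; linear_combination -c1
  have k2 : l = M2 * (1 - sv α) := by
    apply mul_right_cancel₀ (b := (2 + sv α)) (by linarith : (0:ℝ) < _).ne'
    norm_num at c2
    rw [hl]; linear_combination c2
  have k3 : (N:ℝ) * (1 - sv α ^ 2) = l ^ 2 := by
    apply mul_right_cancel₀ (b := kv α * sv α) (by positivity)
    rw [hl]; linear_combination ar
  exact alg5 s0 s1 l0 k3 k1 k2 (by rw [hl, ← f1, e0]; ring) f2 hN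

theorem LT.final (T : LT N α β V t lab) (hN : N < 12) :
    ∃ l : Fin 3 → Fin 3, Function.Injective l ∧ ∀ k, IsAng V k (af α β (l k)) := by
  choose A hA using fun k => ang_ex T.ccwV k
  have hs := ang_sum T.ccwV hA
  have c := fun k => (T.corner k (hA k)).2.2
  have hp : ∀ k, 0 < ((cn t lab (V k) 0).card + 2 * (cn t lab (V k) 2).card) + ((cn t lab (V k) 1).card + (cn t lab (V k) 2).card) := by
    intro k
    by_contra hn
    have h1 : (cn t lab (V k) 0).card = 0 := by omega
    have h2 : (cn t lab (V k) 1).card = 0 := by omega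
    have h3 : (cn t lab (V k) 2).card = 0 := by omega
    have := c k
    rw [h1, h2, h3] at this
    have h4 := (hA k).1
    rw [this] at h4
    simp at h4
  obtain ⟨x, hx⟩ : ∃ x : Fin 3 → ℕ, ∀ k, x k = (cn t lab (V k) 0).card + 2 * (cn t lab (V k) 2).card := ⟨_, fun _ => rfl⟩
  obtain ⟨y, hy⟩ : ∃ y : Fin 3 → ℕ, ∀ k, y k = (cn t lab (V k) 1).card + (cn t lab (V k) 2).card := ⟨_, fun _ => rfl⟩
  simp only [← hx, ← hy] at c hp
  have e := T.par.indN (p := x 0 + x 1 + x 2) (q := y 0 + y 1 + y 2) (p' := 3) (q' := 2) (by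
    have := T.par.sum
    rw [c 0, c 1, c 2] at hs
    push_cast; linarith)
  have := shapes (N := N) (α := α) (β := β) QQ0 (QQ1 hN) (QQ2 hN) (QQ3 hN) (QQ4 hN) (QQ5 hN) (x := (x 0, y 0)) (y := (x 1, y 1)) (z := (x 2, y 2))
    e.1 e.2 (hp 0) (hp 1) (hp 2)
  obtain ⟨l, hl, l0, l1, l2⟩ := this V t lab T (by rw [← c 0]; exact hA 0) (by rw [← c 1]; exact hA 1) (by rw [← c 2]; exact hA 2)
  refine ⟨l, hl, fun k => ?_⟩
  have ha := hA k
  rw [c k] at ha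
  fin_cases k
  · change IsAng V 0 (af α β (l 0)); rw [← l0]; exact ha
  · change IsAng V 1 (af α β (l 1)); rw [← l1]; exact ha
  · change IsAng V 2 (af α β (l 2)); rw [← l2]; exact ha
end
end TT

namespace TT
section
open Filter Topology

lemma reg_hull {P : Fin 3 → ℂ} (h : Ccw P) : Reg P = convexHull ℝ (Set.range P) := by
  apply Set.Subset.antisymm
  · intro x hx
    have h0 : 0 ≤ cr (P 1 - P 0) (x - P 0) := hx 0
    have h1 : 0 ≤ cr (P 2 - P 1) (x - P 1) := hx 1
    have h2 : 0 ≤ cr (P 0 - P 2) (x - P 2) := hx 2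
    unfold Ccw at h
    obtain ⟨D, hD⟩ : ∃ D, D = cr (P 1 - P 0) (P 2 - P 0) := ⟨_, rfl⟩
    rw [← hD] at h
    have hne := h.ne'
    have key := (convex_convexHull ℝ (Set.range P)).sum_mem (t := Finset.univ)
      (w := ![cr (P 2 - P 1) (x - P 1) / D, cr (P 0 - P 2) (x - P 2) / D, cr (P 1 - P 0) (x - P 0) / D]) (z := P)
      (by
        intro i _
        match i with
        | 0 => exact div_nonneg h1 h.le
        | 1 => exact div_nonneg h2 h.le
        | 2 => exact div_nonneg h0 h.le)
      (by
        rw [Fin.sum_univ_three]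
        change cr (P 2 - P 1) (x - P 1) / D + cr (P 0 - P 2) (x - P 2) / D + cr (P 1 - P 0) (x - P 0) / D = 1
        field_simp
        rw [hD]
        simp only [cr, Complex.sub_re, Complex.sub_im]; ring)
      (fun i _ => subset_convexHull ℝ _ ⟨i, rfl⟩)
    rw [Fin.sum_univ_three] at key
    change (cr (P 2 - P 1) (x - P 1) / D) • P 0 + (cr (P 0 - P 2) (x - P 2) / D) • P 1
      + (cr (P 1 - P 0) (x - P 0) / D) • P 2 ∈ _ at key
    convert key using 1
    apply Complex.ext
    · simp only [Complex.add_re, Complex.smul_re, smul_eq_mul]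
      field_simp
      rw [hD]
      simp only [cr, Complex.sub_re, Complex.sub_im]; ring
    · simp only [Complex.add_im, Complex.smul_im, smul_eq_mul]
      field_simp
      rw [hD]
      simp only [cr, Complex.sub_re, Complex.sub_im]; ring
  · apply convexHull_min
    · rintro _ ⟨i, rfl⟩
      unfold Ccw at h
      have e1 : cr (P 2 - P 1) (P 0 - P 1) = cr (P 1 - P 0) (P 2 - P 0) := by
        simp only [cr, Complex.sub_re, Complex.sub_im]; ring
      have e2 : cr (P 0 - P 2) (P 1 - P 2) = cr (P 1 - P 0) (P 2 - P 0) := by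
        simp only [cr, Complex.sub_re, Complex.sub_im]; ring
      have z : ∀ u v, cr u (v - v) = 0 := by intro u v; simp [cr]
      have z' : ∀ u, cr u u = 0 := by intro u; simp [cr]; ring
      have z2 : ∀ u v, cr (u - v) (u - v) = 0 := fun u v => z' _
      intro j
      match i, j with
      | 0, 0 => change 0 ≤ cr (P 1 - P 0) (P 0 - P 0); rw [z]
      | 0, 1 => change 0 ≤ cr (P 2 - P 1) (P 0 - P 1); rw [e1]; exact h.le
      | 0, 2 => change 0 ≤ cr (P 0 - P 2) (P 0 - P 2); rw [z2]
      | 1, 0 => change 0 ≤ cr (P 1 - P 0) (P 1 - P 0); rw [z2]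
      | 1, 1 => change 0 ≤ cr (P 2 - P 1) (P 1 - P 1); rw [z]
      | 1, 2 => change 0 ≤ cr (P 0 - P 2) (P 1 - P 2); rw [e2]; exact h.le
      | 2, 0 => change 0 ≤ cr (P 1 - P 0) (P 2 - P 0); exact h.le
      | 2, 1 => change 0 ≤ cr (P 2 - P 1) (P 2 - P 1); rw [z2]
      | 2, 2 => change 0 ≤ cr (P 0 - P 2) (P 2 - P 2); rw [z]
    · intro x hx y hy a b ha hb hab j
      have e : cr (ed P j) (a • x + b • y - P j) = a * cr (ed P j) (x - P j) + b * cr (ed P j) (y - P j) := by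
        have : a = 1 - b := by linarith
        rw [this]
        simp only [cr, Complex.sub_re, Complex.sub_im, Complex.add_re, Complex.add_im, Complex.smul_re, Complex.smul_im, smul_eq_mul]; ring
      rw [e]
      exact add_nonneg (mul_nonneg ha (hx j)) (mul_nonneg hb (hy j))

lemma sreg_open (P : Fin 3 → ℂ) : IsOpen (SReg P) := by
  have : SReg P = ⋂ j, {x | 0 < cr (ed P j) (x - P j)} := by ext; simp [SReg]
  rw [this]
  apply isOpen_iInter_of_finite
  intro j
  apply isOpen_lt continuous_const
  unfold cr
  fun_prop

lemma sreg_reg (P : Fin 3 → ℂ) : SReg P ⊆ Reg P := fun _ h j => (h j).le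

/-- twice the signed area -/
def ar2 (P : Fin 3 → ℂ) : ℝ := cr (P 1 - P 0) (P 2 - P 0)

lemma ex_ccw {P : Fin 3 → ℂ} (h : ar2 P ≠ 0) : ∃ τ : Equiv.Perm (Fin 3), Ccw (fun j => P (τ j)) := by
  rcases lt_or_gt_of_ne h with h | h
  · refine ⟨Equiv.swap 1 2, ?_⟩
    unfold Ccw
    have e0 : (Equiv.swap (1:Fin 3) 2) 0 = 0 := by decide
    have e1 : (Equiv.swap (1:Fin 3) 2) 1 = 2 := by decide
    have e2 : (Equiv.swap (1:Fin 3) 2) 2 = 1 := by decide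
    simp only [e0, e1, e2]
    unfold ar2 cr at h
    unfold cr
    linarith
  · exact ⟨1, h⟩

lemma ar2_aff {P : Fin 3 → ℂ} (h : AffineIndependent ℝ P) : ar2 P ≠ 0 := by
  intro h0
  rw [affineIndependent_iff] at h
  unfold ar2 cr at h0
  simp only [Complex.sub_re, Complex.sub_im] at h0
  have k := fun w a b => h Finset.univ w a b
  have r := k ![((P 1).re - (P 0).re) - ((P 2).re - (P 0).re), (P 2).re - (P 0).re, -((P 1).re - (P 0).re)]
    (by rw [Fin.sum_univ_three]; simp)
    (by
      rw [Fin.sum_univ_three]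
      apply Complex.ext
      · simp; ring
      · simp; linarith)
  have i := k ![((P 1).im - (P 0).im) - ((P 2).im - (P 0).im), (P 2).im - (P 0).im, -((P 1).im - (P 0).im)]
    (by rw [Fin.sum_univ_three]; simp)
    (by
      rw [Fin.sum_univ_three]
      apply Complex.ext
      · simp; linarith
      · simp; ring)
  have r2 := r 2 (Finset.mem_univ _)
  have i2 := i 2 (Finset.mem_univ _)
  simp at r2 i2
  have e : P 1 = P 0 := by apply Complex.ext <;> linarith
  have c := k ![-1, 1, 0] (by rw [Fin.sum_univ_three]; simp) (by rw [Fin.sum_univ_three]; simp [e]) 1 (Finset.mem_univ _)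
  simp at c

lemma ar2_sq (P : Fin 3 → ℂ) : 4 * ar2 P ^ 2 = 4 * dist (P 0) (P 1) ^ 2 * dist (P 0) (P 2) ^ 2
    - (dist (P 0) (P 1) ^ 2 + dist (P 0) (P 2) ^ 2 - dist (P 1) (P 2) ^ 2) ^ 2 := by
  have e : ∀ x y : ℂ, dist x y ^ 2 = (x.re - y.re) ^ 2 + (x.im - y.im) ^ 2 := by
    intro x y
    rw [Complex.dist_eq, Complex.sq_norm, Complex.normSq_apply]; simp; ring
  simp only [e, ar2, cr, Complex.sub_re, Complex.sub_im]
  ring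

lemma inj3 {l : Fin 3 → Fin 3} (hl : Function.Injective l) :
    (l 0 = 0 ∧ l 1 = 1 ∧ l 2 = 2) ∨ (l 0 = 0 ∧ l 1 = 2 ∧ l 2 = 1) ∨ (l 0 = 1 ∧ l 1 = 0 ∧ l 2 = 2) ∨
    (l 0 = 1 ∧ l 1 = 2 ∧ l 2 = 0) ∨ (l 0 = 2 ∧ l 1 = 0 ∧ l 2 = 1) ∨ (l 0 = 2 ∧ l 1 = 1 ∧ l 2 = 0) := by
  have h1 : l 0 ≠ l 1 := fun h => absurd (hl h) (by decide)
  have h2 : l 0 ≠ l 2 := fun h => absurd (hl h) (by decide)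
  have h3 : l 1 ≠ l 2 := fun h => absurd (hl h) (by decide)
  revert h1 h2 h3
  generalize l 0 = a
  generalize l 1 = b
  generalize l 2 = c
  revert a b c
  decide

lemma ar2_congr {P Q : Fin 3 → ℂ} {l : Fin 3 → Fin 3} (hl : Function.Injective l)
    (h : ∀ i j, dist (Q i) (Q j) = dist (P (l i)) (P (l j))) : ar2 Q ^ 2 = ar2 P ^ 2 := by
  have a := ar2_sq P
  have b := ar2_sq Q
  rw [h, h, h] at b
  have c1 := dist_comm (P 1) (P 0)
  have c2 := dist_comm (P 2) (P 0)
  have c3 := dist_comm (P 2) (P 1)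
  rcases inj3 hl with ⟨h0, h1, h2⟩ | ⟨h0, h1, h2⟩ | ⟨h0, h1, h2⟩ | ⟨h0, h1, h2⟩ | ⟨h0, h1, h2⟩ | ⟨h0, h1, h2⟩ <;>
  · rw [h0, h1, h2] at b
    try simp only [c1, c2, c3] at b
    linarith

lemma ang_eq {P : Fin 3 → ℂ} (h : Ccw P) {j : Fin 3} {A : ℝ} (hA : IsAng P j A) :
    ∠ (P (j+1)) (P j) (P (j+2)) = A := by
  have e1 : P (j+1) -ᵥ P j = ‖ed P j‖ • dr P j := by
    rw [vsub_eq_sub, Complex.real_smul, ← ed_dr h j]; rfl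
  have e2 : P (j+2) -ᵥ P j = ‖ed P (j+2)‖ • (dr P j * cs A) := by
    rw [← hA.2.2, Complex.real_smul, mul_neg, ← ed_dr h (j+2), vsub_eq_sub]
    unfold ed
    rw [f21]; ring
  unfold EuclideanGeometry.angle
  rw [e1, e2, InnerProductGeometry.angle_smul_left_of_pos _ _ (ed_pos h _),
    InnerProductGeometry.angle_smul_right_of_pos _ _ (ed_pos h _)]
  unfold InnerProductGeometry.angle
  have n := norm_dr h j
  have n2 : ‖dr P j * cs A‖ = 1 := by rw [norm_mul, n, norm_cs]; simp
  rw [n, n2, Complex.inner]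
  have : (dr P j * cs A * (starRingEnd ℂ) (dr P j)) = cs A := by
    have : dr P j * (starRingEnd ℂ) (dr P j) = 1 := by rw [Complex.mul_conj, Complex.normSq_eq_norm_sq, n]; simp
    linear_combination cs A * this
  rw [this]
  simp
  exact arccos_cos hA.1.le hA.2.1.le
end
end TT

namespace TT
section
open Filter Topology

lemma ne01 : ∀ j : Fin 3, j ≠ j + 1 := by decide
lemma ne02 : ∀ j : Fin 3, j ≠ j + 2 := by decide
lemma ne12 : ∀ j : Fin 3, j + 1 ≠ j + 2 := by decide

lemma third {l : Fin 3 → Fin 3} (hl : Function.Injective l) (j : Fin 3) :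
    (l (j+1) = l j + 1 ∧ l (j+2) = l j + 2) ∨ (l (j+1) = l j + 2 ∧ l (j+2) = l j + 1) := by
  have h1 : l j ≠ l (j+1) := fun h => ne01 j (hl h)
  have h2 : l j ≠ l (j+2) := fun h => ne02 j (hl h)
  have h3 : l (j+1) ≠ l (j+2) := fun h => ne12 j (hl h)
  revert h1 h2 h3
  generalize l j = a
  generalize l (j+1) = b
  generalize l (j+2) = c
  revert a b c
  decide

/-- angles are transported -/
lemma ang_tr {Q : Fin 3 → ℂ} {T : Tri} {r : ℝ} (hr : 0 < r) {l : Fin 3 → Fin 3} (hl : Function.Injective l)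
    (hQ : Ccw Q) (hd : ∀ i j, dist (Q i) (Q j) = r * dist (T (l i)) (T (l j))) (j : Fin 3) :
    IsAng Q j (triAngle T (l j)) := by
  obtain ⟨A, hA⟩ := ang_ex hQ j
  have e := ang_eq hQ hA
  have s : Similar ![Q (j+1), Q j, Q (j+2)] ![T (l (j+1)), T (l j), T (l (j+2))] := by
    rw [similar_iff_exists_dist_eq]
    refine ⟨⟨r, hr.le⟩, ?_, ?_⟩
    · intro h; exact hr.ne' (congrArg NNReal.toReal h)
    · have v1 : (![Q (j+1), Q j, Q (j+2)] : Fin 3 → ℂ) = fun i => Q (![j+1, j, j+2] i) := by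
        funext i; fin_cases i <;> rfl
      have v2 : (![T (l (j+1)), T (l j), T (l (j+2))] : Fin 3 → Pt) = fun i => T (l (![j+1, j, j+2] i)) := by
        funext i; fin_cases i <;> rfl
      rw [v1, v2]
      intro a b
      exact hd _ _
  have e2 := s.angle_eq
  have e3 : ∠ (T (l (j+1))) (T (l j)) (T (l (j+2))) = triAngle T (l j) := by
    unfold triAngle
    rcases third hl j with ⟨h1, h2⟩ | ⟨h1, h2⟩
    · rw [h1, h2]
    · rw [h1, h2, EuclideanGeometry.angle_comm]
  rw [← e3, ← e2, e]; exact hA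

/-- sides up to scale, as function of the two labels -/
def gg (α β : ℝ) (i j : Fin 3) : ℝ := if i = j then 0 else sin (af α β (-(i+j)))

lemma side_form {Q : Fin 3 → ℂ} {α β : ℝ} {l : Fin 3 → Fin 3} (hl : Function.Injective l)
    (hQ : Ccw Q) (hA : ∀ j, IsAng Q j (af α β (l j))) :
    ∃ μ, 0 < μ ∧ ∀ i j, dist (Q i) (Q j) = μ * gg α β (l i) (l j) := by
  obtain ⟨μ, m0, hm⟩ := sides_mu hQ hA
  refine ⟨μ, m0, ?_⟩
  have gc : ∀ i j, gg α β i j = gg α β j i := by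
    intro i j; unfold gg; simp only [eq_comm (a := i), add_comm i]
  have k1 : ∀ i, dist (Q i) (Q (i+1)) = μ * gg α β (l i) (l (i+1)) := by
    intro i
    rw [dist_comm, Complex.dist_eq]
    change ‖ed Q i‖ = _
    rw [hm]
    have hn : l i ≠ l (i+1) := fun h => ne01 i (hl h)
    unfold gg
    rw [if_neg hn]
    have : l (i+2) = -(l i + l (i+1)) := by
      rcases third hl i with ⟨h1, h2⟩ | ⟨h1, h2⟩
      · rw [h1, h2]; generalize l i = a; revert a; decide
      · rw [h1, h2]; generalize l i = a; revert a; decide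
    rw [this]
  have k0 : ∀ i, dist (Q i) (Q i) = μ * gg α β (l i) (l i) := by intro i; simp [gg]
  intro i j
  have : j = i ∨ j = i + 1 ∨ i = j + 1 := by revert i j; decide
  rcases this with rfl | rfl | rfl
  · exact k0 _
  · exact k1 _
  · rw [dist_comm, gc]; exact k1 _

lemma ex_map {r : ℝ} (hr : 0 < r) : ∃ f : Pt ≃ₗ[ℝ] ℂ, ∀ x y, dist (f x) (f y) = r * dist x y := by
  refine ⟨(Complex.orthonormalBasisOneI.repr.symm.toLinearEquiv).trans (LinearEquiv.smulOfNeZero ℝ ℂ r hr.ne'), ?_⟩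
  intro x y
  simp only [LinearEquiv.trans_apply, LinearEquiv.smulOfNeZero_apply]
  rw [dist_smul₀, Real.norm_of_nonneg hr.le]
  congr 1
  exact Complex.orthonormalBasisOneI.repr.symm.dist_map x y

lemma mem_tri (f : Pt ≃ₗ[ℝ] ℂ) (P : Tri) (τ : Equiv.Perm (Fin 3)) (h : Ccw (fun j => f (P (τ j)))) (x : Pt) :
    f x ∈ Reg (fun j => f (P (τ j))) ↔ x ∈ triSet P := by
  rw [reg_hull h]
  have : Set.range (fun j => f (P (τ j))) = (f : Pt →ₗ[ℝ] ℂ) '' Set.range P := by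
    rw [← Set.range_comp]
    exact (τ.surjective.range_comp (fun j => f (P j)))
  rw [this, ← LinearMap.image_convexHull]
  exact f.injective.mem_set_image

lemma int_tri (f : Pt ≃ₗ[ℝ] ℂ) (P : Tri) (τ : Equiv.Perm (Fin 3)) (h : Ccw (fun j => f (P (τ j)))) {x : Pt}
    (hx : f x ∈ SReg (fun j => f (P (τ j)))) : x ∈ interior (triSet P) := by
  have hc : Continuous f := f.toLinearMap.continuous_of_finiteDimensional
  have ho := (sreg_open (fun j => f (P (τ j)))).preimage hc
  exact interior_maximal (fun y hy => (mem_tri f P τ h y).1 (sreg_reg _ hy)) ho hx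

lemma af_eq {T : Tri} {α β : ℝ} (h0 : triAngle T 0 = α) (h1 : triAngle T 1 = β)
    (h2 : triAngle T 2 = 2 * α + β) (k : Fin 3) : triAngle T k = af α β k := by
  match k with
  | 0 => exact h0
  | 1 => exact h1
  | 2 => exact h2

lemma aff_ar2 (f : Pt ≃ₗ[ℝ] ℂ) {P : Tri} (h : IsTriangle P) : ar2 (fun j => f (P j)) ≠ 0 := by
  apply ar2_aff
  have := h.map' (f : Pt →ₗ[ℝ] ℂ).toAffineMap f.injective
  exact this
end
end TT


open TT

/-- If `3α + 2β = π`, triangle `ABC` is `N`-tiled by a tile with angles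
`(α, β, γ)` not similar to `ABC`, and `α` is not a rational multiple of `π`,
then `N ≥ 12`. -/
theorem twelve_le_of_tiling_3a2b (N : ℕ) (ABC T : Tri)
    (hABC : IsTriangle ABC) (hT : IsTriangle T)
    (α β γ : ℝ) (hangles : HasAngles T α β γ)
    (hsum : 3 * α + 2 * β = π)
    (tiles : Fin N → Tri) (ht : IsTiling N ABC T tiles)
    (hsim : ¬ SimilarTri T ABC)
    (hirr : ¬ ∃ q : ℚ, α = (q : ℝ) * π) :
    12 ≤ N := by
  by_contra hN
  push Not at hN
  have hd : 0 < dist (T 0) (T 1) := dist_pos.2 (fun h => absurd (hT.injective h) (by decide))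
  obtain ⟨f, hf⟩ := ex_map (inv_pos.2 hd)
  have hr := inv_pos.2 hd
  obtain ⟨h0, h1, h2⟩ := hangles
  -- the tile itself
  obtain ⟨τ, hτ⟩ := ex_ccw (aff_ar2 f hT)
  have aT := fun j => ang_tr hr τ.injective hτ (fun i j => hf _ _) j
  have hγ : γ = 2 * α + β := by
    have s := ang_sum hτ aT
    have : triAngle T (τ 0) + triAngle T (τ 1) + triAngle T (τ 2) = triAngle T 0 + triAngle T 1 + triAngle T 2 := by
      have := Equiv.sum_comp τ (triAngle T)
      simpa [Fin.sum_univ_three] using this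
    rw [this, h0, h1, h2] at s
    linarith
  rw [hγ] at h2
  have haf := af_eq h0 h1 h2
  simp only [haf] at aT
  have pos : ∀ k, 0 < af α β k := by
    intro k
    have := (aT (τ.symm k)).1
    rwa [Equiv.apply_symm_apply] at this
  have par : Par α β := ⟨hsum, pos 0, pos 1, hirr⟩
  -- the tiles
  choose σ hσ using ht.congr
  have hne : ∀ i, ar2 (fun j => f (tiles i j)) ≠ 0 := by
    intro i h
    have := ar2_congr (P := fun j => f (T j)) (Q := fun j => f (tiles i j)) (σ i).injective
      (by intro a b; simp only [hf, hσ i a b])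
    rw [h] at this
    exact aff_ar2 f hT (pow_eq_zero_iff (two_ne_zero) |>.1 (by rw [← this]; ring))
  choose ρ hρ using fun i => ex_ccw (hne i)
  obtain ⟨υ, hυ⟩ := ex_ccw (aff_ar2 f hABC)
  have hQ : ∀ i a b, dist (f (tiles i (ρ i a))) (f (tiles i (ρ i b)))
      = (dist (T 0) (T 1))⁻¹ * dist (T (σ i (ρ i a))) (T (σ i (ρ i b))) := by
    intro i a b; rw [hf, hσ]
  have linj : ∀ i, Function.Injective (fun j => σ i (ρ i j)) := fun i => (σ i).injective.comp (ρ i).injective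
  have angs : ∀ i j, IsAng (fun j => f (tiles i (ρ i j))) j (af α β (σ i (ρ i j))) := by
    intro i j
    have := ang_tr hr (linj i) (hρ i) (hQ i) j
    rwa [haf] at this
  have L : LT N α β (fun j => f (ABC (υ j))) (fun i j => f (tiles i (ρ i j))) (fun i j => σ i (ρ i j)) := by
    refine ⟨⟨hυ, hρ, ?_, ?_⟩, par, linj, angs, ?_⟩
    · intro i k hik x hx hx'
      obtain ⟨y, rfl⟩ := f.surjective x
      have m : y ∈ interior (triSet (tiles i)) ∩ interior (triSet (tiles k)) :=
        ⟨int_tri f _ _ (hρ i) hx, int_tri f _ _ (hρ k) hx'⟩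
      rw [ht.disj i k hik] at m
      exact m
    · intro x
      obtain ⟨y, rfl⟩ := f.surjective x
      rw [mem_tri f _ _ hυ, ← ht.cover, Set.mem_iUnion]
      exact exists_congr fun i => (mem_tri f _ _ (hρ i) y).symm
    · intro i j
      obtain ⟨μ, m0, hm⟩ := sides_mu (hρ i) (angs i)
      obtain ⟨k, hk⟩ := (Finite.injective_iff_surjective.1 (linj i)) 2
      have e := hm (k+1)
      simp only [f11, par.singen] at e hm
      have hk' : σ i (ρ i k) = 2 := hk
      rw [hk'] at e
      have e1 : ‖ed (fun j => f (tiles i (ρ i j))) (k+1)‖ = 1 := by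
        unfold ed
        rw [f12, ← Complex.dist_eq, hQ]
        have q : dist (T (σ i (ρ i (k+2)))) (T (σ i (ρ i (k+1)))) = dist (T 0) (T 1) := by
          rcases third (linj i) k with ⟨g1, g2⟩ | ⟨g1, g2⟩
          · simp only [hk'] at g1 g2
            rw [g1, g2, dist_comm]; rfl
          · simp only [hk'] at g1 g2
            rw [g1, g2]; rfl
        rw [q]
        exact inv_mul_cancel₀ hd.ne'
      have e2 : lf (sv α) 2 = 1 := rfl
      rw [e1, e2] at e
      rw [hm]
      linear_combination (-lf (sv α) (σ i (ρ i (j+2)))) * e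
  obtain ⟨l, hl, hlA⟩ := L.final hN
  apply hsim
  obtain ⟨μ, m0, hm⟩ := side_form τ.injective hτ aT
  obtain ⟨ν, n0, hn⟩ := side_form hl hυ hlA
  simp only [hf] at hm hn
  let e : Equiv.Perm (Fin 3) := Equiv.ofBijective l (Finite.injective_iff_bijective.1 hl)
  have he : ∀ k, l (e.symm k) = k := fun k => e.apply_symm_apply k
  refine ⟨μ / ν, div_pos m0 n0, e.symm.trans υ, ?_⟩
  intro i j
  have a := hm (τ.symm i) (τ.symm j)
  have b := hn (e.symm i) (e.symm j)
  simp only [Equiv.apply_symm_apply, he] at a b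
  simp only [Equiv.trans_apply]
  have hi := hr.ne'
  apply mul_left_cancel₀ hi
  rw [a, mul_left_comm, b]
  field_simp
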